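/- arXiv:0706.2807 — 3 statements merged into one kernel-verified Lean document; each statement's English description precedes it below -/
import Mathlib

section
/- As x → ∞, (log x) · ( ∏_{p ≤ x, p ≡ 3 (mod 4)} (1 − 1/p) )² tends to (4/π) · e^{−γ} · ( ∏_{p ≡ 1 (mod 4)} (1 − 1/p²) )^{−1}, where the product over all primes p ≡ 1 (mod 4) is absolutely convergent. Equivalently, C(4,3)² = (4/π) e^{−γ} ∏_{p ≡ 1 (mod 4)} (1 − 1/p²)^{−1}, which together with Uchiyama's formula for C(4,1) expresses the relation C(4,1)·C(4,3) = 2 e^{−γ}. -/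
open Filter Topology Finset

open Polynomial in
/-- One-sided polynomial approximation of the indicator of `[c, 1]`, in the form Karamata's
method needs. -/
theorem exists_polynomial_karamata {c : ℝ} (hc0 : 0 < c) (hc1 : c < 1) {ε : ℝ} (hε : 0 < ε) :
    ∃ q₁ q₂ : ℝ[X], (∀ x ∈ Set.Icc (0 : ℝ) 1,
      x + x * (1 - x) * q₁.eval x ≤ (if c ≤ x then 1 else 0) ∧
      (if c ≤ x then 1 else 0) ≤ x + x * (1 - x) * q₂.eval x ∧ q₁.eval x ≤ q₂.eval x) ∧
      ∫ x in (0 : ℝ)..1, (q₂ - q₁).eval x ≤ ε := by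
  set M : ℝ := 1 / c + 1 / (1 - c) with hM
  have hc1' : 0 < 1 - c := by linarith
  have hMpos : 0 < M := by positivity
  set δ : ℝ := ε / (2 * M) with hδ
  have hδpos : 0 < δ := by positivity
  set R : ℝ → ℝ := fun x => 1 / max x c with hR
  set L : ℝ → ℝ := fun x => -(1 / (1 - min x c)) with hL
  set θ : ℝ → ℝ := fun x => max 0 (min 1 ((x - c) / δ)) with hθ
  have hmax : ∀ x, 0 < max x c := fun x => lt_max_of_lt_right hc0
  have hmin : ∀ x, 0 < 1 - min x c := fun x => by
    have := min_le_right x c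
    linarith
  have hRc : Continuous R := by
    refine continuous_const.div (by fun_prop) fun x => (hmax x).ne'
  have hLc : Continuous L := by
    refine (continuous_const.div (by fun_prop) fun x => (hmin x).ne').neg
  have hθc : Continuous θ := by fun_prop
  have hθ0 : ∀ x, 0 ≤ θ x := fun x => le_max_left _ _
  have hθ1 : ∀ x, θ x ≤ 1 := fun x => max_le zero_le_one (min_le_left _ _)
  have hθmono : ∀ x, θ x ≤ θ (x + δ) := fun x => by
    simp only [hθ]
    gcongr
    linarith
  have hθle : ∀ x, x ≤ c → θ x = 0 := fun x hx => by
    have : (x - c) / δ ≤ 0 := div_nonpos_of_nonpos_of_nonneg (by linarith) hδpos.le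
    simp only [hθ]
    rw [max_eq_left]
    exact (min_le_right _ _).trans this
  have hθge : ∀ x, c ≤ x → θ (x + δ) = 1 := fun x hx => by
    have : 1 ≤ (x + δ - c) / δ := by rw [le_div_iff₀ hδpos]; linarith
    simp only [hθ]
    rw [min_eq_left this]
    norm_num
  have hRL0 : ∀ x, 0 ≤ R x - L x := fun x => by
    have h1 := hmax x
    have h2 := hmin x
    simp only [hR, hL]
    rw [sub_neg_eq_add]
    positivity
  have hRL : ∀ x, R x - L x ≤ M := fun x => by
    simp only [hR, hL, hM]
    rw [sub_neg_eq_add]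
    gcongr
    · exact le_max_right _ _
    · exact min_le_right _ _
  set φ₁ : ℝ → ℝ := fun x => L x + (R x - L x) * θ x with hφ₁
  set φ₂ : ℝ → ℝ := fun x => L x + (R x - L x) * θ (x + δ) with hφ₂
  have hφ₁c : Continuous φ₁ := by fun_prop
  have hφ₂c : Continuous φ₂ := by fun_prop
  have hη : 0 < ε / 8 := by positivity
  obtain ⟨q₁, hq₁⟩ := exists_polynomial_near_of_continuousOn 0 1 (fun x => φ₁ x - ε / 8)
    (by fun_prop) (ε / 8) hη
  obtain ⟨q₂, hq₂⟩ := exists_polynomial_near_of_continuousOn 0 1 (fun x => φ₂ x + ε / 8)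
    (by fun_prop) (ε / 8) hη
  have hφ : ∀ x, φ₁ x ≤ φ₂ x := fun x => by
    have := mul_le_mul_of_nonneg_left (hθmono x) (hRL0 x)
    simp only [hφ₁, hφ₂]
    linarith
  have hq₁φ : ∀ x ∈ Set.Icc (0 : ℝ) 1, q₁.eval x ≤ φ₁ x ∧ φ₁ x - ε / 4 ≤ q₁.eval x :=
    fun x hx => by
      have := abs_lt.mp (hq₁ x hx)
      constructor <;> linarith [this.1, this.2]
  have hq₂φ : ∀ x ∈ Set.Icc (0 : ℝ) 1, φ₂ x ≤ q₂.eval x ∧ q₂.eval x ≤ φ₂ x + ε / 4 :=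
    fun x hx => by
      have := abs_lt.mp (hq₂ x hx)
      constructor <;> linarith [this.1, this.2]
  refine ⟨q₁, q₂, fun x hx => ?_, ?_⟩
  · have hx2 : 0 ≤ x * (1 - x) := mul_nonneg hx.1 (by linarith [hx.2])
    have h1 := mul_le_mul_of_nonneg_left (hq₁φ x hx).1 hx2
    have h2 := mul_le_mul_of_nonneg_left (hq₂φ x hx).1 hx2
    refine ⟨?_, ?_, ((hq₁φ x hx).1.trans (hφ x)).trans (hq₂φ x hx).1⟩
    · split_ifs with h
      · have hub : φ₁ x ≤ R x := by
          have := mul_le_mul_of_nonneg_left (hθ1 x) (hRL0 x)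
          simp only [hφ₁]; linarith
        have h3 := mul_le_mul_of_nonneg_left hub hx2
        have : x * (1 - x) * R x = 1 - x := by
          have : x ≠ 0 := by linarith
          simp only [hR, max_eq_left h]
          field_simp
        linarith
      · push Not at h
        have : x * (1 - x) * φ₁ x = -x := by
          have : 1 - x ≠ 0 := by linarith
          simp only [hφ₁, hθle x h.le, hL, min_eq_left h.le]
          field_simp
          ring
        linarith
    · split_ifs with h
      · have : x * (1 - x) * φ₂ x = 1 - x := by
          have : x ≠ 0 := by linarith
          simp only [hφ₂, hθge x h, hR, max_eq_left h]
          field_simp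
          ring
        linarith
      · push Not at h
        have hlb : L x ≤ φ₂ x := by
          have := mul_nonneg (hRL0 x) (hθ0 (x + δ))
          simp only [hφ₂]; linarith
        have h3 := mul_le_mul_of_nonneg_left hlb hx2
        have : x * (1 - x) * L x = -x := by
          have : 1 - x ≠ 0 := by linarith
          simp only [hL, min_eq_left h.le]
          field_simp
        linarith
  · have hint : ∀ a b : ℝ, IntervalIntegrable θ MeasureTheory.volume a b :=
      fun a b => hθc.intervalIntegrable a b
    have hθint : ∫ x in (0 : ℝ)..1, (θ (x + δ) - θ x) ≤ δ := by
      have hcs : Continuous fun x => θ (x + δ) := by fun_prop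
      rw [intervalIntegral.integral_sub (hcs.intervalIntegrable _ _) (hint _ _),
        intervalIntegral.integral_comp_add_right]
      have e1 := intervalIntegral.integral_add_adjacent_intervals (hint (0 + δ) 1) (hint 1 (1 + δ))
      have e2 := intervalIntegral.integral_add_adjacent_intervals (hint 0 (0 + δ)) (hint (0 + δ) 1)
      have e3 : 0 ≤ ∫ x in (0 : ℝ)..(0 + δ), θ x :=
        intervalIntegral.integral_nonneg (by linarith) fun x _ => hθ0 x
      have e4 : ∫ x in (1 : ℝ)..(1 + δ), θ x ≤ ∫ x in (1 : ℝ)..(1 + δ), (1 : ℝ) :=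
        intervalIntegral.integral_mono_on (by linarith) (hint _ _)
          (continuous_const.intervalIntegrable _ _) fun x _ => hθ1 x
      have e5 : ∫ x in (1 : ℝ)..(1 + δ), (1 : ℝ) = δ := by simp
      linarith
    calc ∫ x in (0 : ℝ)..1, (q₂ - q₁).eval x
        ≤ ∫ x in (0 : ℝ)..1, (M * (θ (x + δ) - θ x) + ε / 2) := by
          refine intervalIntegral.integral_mono_on zero_le_one
            ((q₂ - q₁).continuous.intervalIntegrable _ _)
            (Continuous.intervalIntegrable (by fun_prop) _ _) fun x hx => ?_
          have h3 := mul_le_mul_of_nonneg_right (hRL x) (sub_nonneg.mpr (hθmono x))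
          have h4 : φ₂ x - φ₁ x = (R x - L x) * (θ (x + δ) - θ x) := by
            simp only [hφ₁, hφ₂]; ring
          rw [Polynomial.eval_sub]
          linarith [(hq₁φ x hx).2, (hq₂φ x hx).2]
      _ = M * (∫ x in (0 : ℝ)..1, (θ (x + δ) - θ x)) + ε / 2 := by
          rw [intervalIntegral.integral_add (Continuous.intervalIntegrable (by fun_prop) _ _)
            (Continuous.intervalIntegrable (by fun_prop) _ _),
            intervalIntegral.integral_const_mul]
          simp
      _ ≤ M * δ + ε / 2 := by gcongr
      _ = ε := by rw [hδ]; field_simp; ring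

open Polynomial in
theorem summable_mul_eval_exp {ι : Type*} {w lam : ι → ℝ}
    (hs : ∀ σ > 0, Summable fun i => w i * Real.exp (-(σ * lam i))) {σ : ℝ} (hσ : 0 < σ)
    (q : ℝ[X]) :
    Summable fun i =>
      w i * (Real.exp (-(σ * lam i)) * q.eval (Real.exp (-(σ * lam i)))) := by
  induction q using Polynomial.induction_on' with
  | add p q hp hq =>
    refine (hp.add hq).congr fun i => ?_
    rw [Polynomial.eval_add]; ring
  | monomial n a =>
    refine ((hs ((n + 1) * σ) (by positivity)).mul_left a).congr fun i => ?_
    have : Real.exp (-((n + 1) * σ * lam i)) = Real.exp (-(σ * lam i)) ^ (n + 1) := by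
      rw [← Real.exp_nat_mul]; push_cast; ring_nf
    rw [Polynomial.eval_monomial, this]; ring

open Polynomial in
theorem tendsto_tsum_mul_eval_exp_sub {ι κ : Type*} {w lam : ι → ℝ} {v mu : κ → ℝ}
    (hs : ∀ σ > 0, Summable fun i => w i * Real.exp (-(σ * lam i)))
    (ht : ∀ σ > 0, Summable fun i => v i * Real.exp (-(σ * mu i))) {C : ℝ}
    (h : Tendsto (fun σ => ∑' i, w i * Real.exp (-(σ * lam i)) -
      ∑' i, v i * Real.exp (-(σ * mu i))) (𝓝[>] 0) (𝓝 C)) (q : ℝ[X]) :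
    Tendsto (fun σ =>
      ∑' i, w i * (Real.exp (-(σ * lam i)) * q.eval (Real.exp (-(σ * lam i)))) -
      ∑' i, v i * (Real.exp (-(σ * mu i)) * q.eval (Real.exp (-(σ * mu i)))))
      (𝓝[>] 0) (𝓝 (C * q.eval 1)) := by
  induction q using Polynomial.induction_on' with
  | add p q hp hq =>
    rw [Polynomial.eval_add, mul_add]
    refine (hp.add hq).congr' ?_
    filter_upwards [self_mem_nhdsWithin] with σ hσ
    simp only [Polynomial.eval_add, mul_add]
    rw [(summable_mul_eval_exp hs hσ p).tsum_add (summable_mul_eval_exp hs hσ q),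
      (summable_mul_eval_exp ht hσ p).tsum_add (summable_mul_eval_exp ht hσ q)]
    ring
  | monomial n a =>
    have hn : Tendsto (fun σ : ℝ => (n + 1) * σ) (𝓝[>] 0) (𝓝[>] 0) := by
      refine tendsto_nhdsWithin_iff.mpr ⟨?_, ?_⟩
      · have : Tendsto (fun σ : ℝ => (n + 1) * σ) (𝓝 0) (𝓝 ((n + 1) * 0)) :=
          tendsto_const_nhds.mul tendsto_id
        rw [mul_zero] at this
        exact this.mono_left nhdsWithin_le_nhds
      · filter_upwards [self_mem_nhdsWithin] with σ hσ
        have : (0 : ℝ) < σ := hσ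
        exact Set.mem_Ioi.mpr (by positivity)
    have := (h.comp hn).const_mul a
    rw [Polynomial.eval_monomial, one_pow, mul_one, mul_comm C]
    refine this.congr fun σ => ?_
    have key : ∀ t : ℝ, Real.exp (-((n + 1) * σ * t)) = Real.exp (-(σ * t)) ^ (n + 1) := by
      intro t
      rw [← Real.exp_nat_mul]; push_cast; ring_nf
    simp only [Function.comp, key, Polynomial.eval_monomial]
    rw [mul_sub, ← tsum_mul_left, ← tsum_mul_left]
    congr 1 <;> exact tsum_congr fun i => by ring

theorem hasSum_exp_neg_mul_succ {σ : ℝ} (hσ : 0 < σ) :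
    HasSum (fun k : ℕ => Real.exp (-(σ * (k + 1)))) (1 / (Real.exp σ - 1)) := by
  have h1 : Real.exp (-σ) < 1 := by simpa using hσ
  have := (hasSum_geometric_of_lt_one (Real.exp_pos (-σ)).le h1).mul_left (Real.exp (-σ))
  have hterm : (fun k : ℕ => Real.exp (-(σ * (k + 1)))) =
      fun k => Real.exp (-σ) * Real.exp (-σ) ^ k := by
    funext k
    rw [← Real.exp_nat_mul, ← Real.exp_add]; ring_nf
  have hval : 1 / (Real.exp σ - 1) = Real.exp (-σ) * (1 - Real.exp (-σ))⁻¹ := by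
    have h2 : Real.exp σ - 1 ≠ 0 := by
      have := Real.add_one_lt_exp hσ.ne'
      linarith
    have h3 : 1 - Real.exp (-σ) ≠ 0 := by linarith
    have h4 : Real.exp (-σ) * Real.exp σ = 1 := by rw [← Real.exp_add]; simp
    rw [← div_eq_mul_inv, div_eq_div_iff h2 h3]
    linear_combination -h4
  rwa [hterm, hval]

open Polynomial in
/-- Riemann sums of a polynomial along a geometric mesh. -/
theorem tendsto_mul_tsum_exp_mul_eval (q : ℝ[X]) :
    Tendsto (fun σ : ℝ => σ * ∑' k : ℕ,
      (Real.exp (-(σ * (k + 1))) * q.eval (Real.exp (-(σ * (k + 1))))))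
      (𝓝[>] 0) (𝓝 (∫ x in (0 : ℝ)..1, q.eval x)) := by
  have hs : ∀ σ > (0 : ℝ), Summable fun k : ℕ => 1 * Real.exp (-(σ * ((k : ℝ) + 1))) :=
    fun σ hσ => by simpa using (hasSum_exp_neg_mul_succ hσ).summable
  induction q using Polynomial.induction_on' with
  | add p q hp hq =>
    simp only [Polynomial.eval_add]
    rw [intervalIntegral.integral_add (p.continuous.intervalIntegrable _ _)
      (q.continuous.intervalIntegrable _ _)]
    refine (hp.add hq).congr' ?_
    filter_upwards [self_mem_nhdsWithin] with σ hσ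
    simp only [mul_add]
    have h1 := summable_mul_eval_exp hs hσ p
    have h2 := summable_mul_eval_exp hs hσ q
    simp only [one_mul, mul_add] at h1 h2
    rw [h1.tsum_add h2]
    ring
  | monomial n a =>
    have hI : ∫ x in (0 : ℝ)..1, (monomial n a).eval x = a * (1 / (n + 1)) := by
      simp [Polynomial.eval_monomial, integral_pow]
    rw [hI]
    have hd : HasDerivAt (fun σ : ℝ => Real.exp ((n + 1) * σ)) (n + 1) 0 := by
      have := ((hasDerivAt_id (0 : ℝ)).const_mul ((n : ℝ) + 1)).exp
      simpa using this
    have hd2 := (hasDerivAt_iff_tendsto_slope_zero.mp hd).mono_left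
      (nhdsWithin_mono 0 (fun x (hx : 0 < x) => hx.ne'))
    have hn : ((n : ℝ) + 1) ≠ 0 := by positivity
    have := (hd2.inv₀ hn).const_mul a
    rw [← one_div] at this
    refine this.congr' ?_
    filter_upwards [self_mem_nhdsWithin] with σ hσ
    have hσ : (0 : ℝ) < σ := hσ
    have hsum := (hasSum_exp_neg_mul_succ (σ := (n + 1) * σ) (by positivity)).tsum_eq
    have key : ∀ t : ℝ, Real.exp (-((n + 1) * σ * t)) = Real.exp (-(σ * t)) ^ (n + 1) := by
      intro t
      rw [← Real.exp_nat_mul]; push_cast; ring_nf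
    have h3 : ∑' k : ℕ, (Real.exp (-(σ * (k + 1))) *
        (monomial n a).eval (Real.exp (-(σ * (k + 1))))) =
        a * ∑' k : ℕ, Real.exp (-((n + 1) * σ * (k + 1))) := by
      rw [← tsum_mul_left]
      refine tsum_congr fun k => ?_
      rw [Polynomial.eval_monomial, key]; ring
    rw [h3, hsum]
    simp
    ring

/-- The generating series of the harmonic weights. -/
theorem hasSum_harmonic_weight {σ : ℝ} (hσ : 0 < σ) :
    HasSum (fun k : ℕ => 1 / ((k : ℝ) + 1) * Real.exp (-(σ * (k + 1))))
      (-Real.log (1 - Real.exp (-σ))) := by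
  have h1 : Real.exp (-σ) < 1 := by simpa using hσ
  have := Real.hasSum_pow_div_log_of_abs_lt_one (x := Real.exp (-σ))
    (by rwa [abs_of_pos (Real.exp_pos _)])
  convert this using 1
  funext k
  rw [← Real.exp_nat_mul]; push_cast; ring_nf

/-- **Karamata's Tauberian theorem at a logarithmic singularity**: if a general Dirichlet series
with nonnegative coefficients is `-log (1 - e^{-σ}) + C + o(1)` as `σ → 0⁺`, then its coefficient
sums up to `y` are `H_{⌊y⌋} + C + o(1)`. -/
theorem tendsto_tsum_sub_harmonic {ι : Type} {w lam : ι → ℝ} (hw : ∀ i, 0 ≤ w i)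
    (hlam : ∀ i, 0 ≤ lam i)
    (hs : ∀ σ > 0, Summable fun i => w i * Real.exp (-(σ * lam i))) {C : ℝ}
    (h : Tendsto (fun σ => ∑' i, w i * Real.exp (-(σ * lam i)) +
      Real.log (1 - Real.exp (-σ))) (𝓝[>] 0) (𝓝 C)) :
    Tendsto (fun y : ℝ => ∑' i, w i * (if lam i ≤ y then 1 else 0) - harmonic ⌊y⌋₊)
      atTop (𝓝 C) := by
  set c : ℝ := Real.exp (-1) with hc
  have hc0 : 0 < c := Real.exp_pos _
  have hc1 : c < 1 := by simp [hc]
  set v : ℕ → ℝ := fun k => 1 / ((k : ℝ) + 1) with hv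
  set mu : ℕ → ℝ := fun k => (k : ℝ) + 1 with hmu
  have hv0 : ∀ k, 0 ≤ v k := fun k => by positivity
  have hmu0 : ∀ k, 0 ≤ mu k := fun k => by positivity
  have ht : ∀ σ > 0, Summable fun k => v k * Real.exp (-(σ * mu k)) :=
    fun σ hσ => (hasSum_harmonic_weight hσ).summable
  have hdiff : Tendsto (fun σ => ∑' i, w i * Real.exp (-(σ * lam i)) -
      ∑' k, v k * Real.exp (-(σ * mu k))) (𝓝[>] 0) (𝓝 C) := by
    refine h.congr' ?_
    filter_upwards [self_mem_nhdsWithin] with σ hσ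
    rw [(hasSum_harmonic_weight hσ).tsum_eq, sub_neg_eq_add]
  set J : ℝ → ℝ := fun x => if c ≤ x then 1 else 0 with hJ
  have hJ0 : ∀ x, 0 ≤ J x := fun x => by simp only [hJ]; split_ifs <;> norm_num
  have hJle : ∀ x, 0 < x → J x ≤ c⁻¹ * x := fun x hx => by
    simp only [hJ]
    split_ifs with hcx
    · rw [inv_mul_eq_div, le_div_iff₀ hc0]; linarith
    · positivity
  have hsJ : ∀ {κ : Type} {u nu : κ → ℝ}, (∀ i, 0 ≤ u i) →
      (∀ σ > 0, Summable fun i => u i * Real.exp (-(σ * nu i))) → ∀ σ > 0,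
      Summable fun i => u i * J (Real.exp (-(σ * nu i))) := by
    intro κ u nu hu hsu σ hσ
    refine Summable.of_nonneg_of_le (fun i => mul_nonneg (hu i) (hJ0 _)) (fun i => ?_)
      ((hsu σ hσ).mul_left c⁻¹)
    calc u i * J (Real.exp (-(σ * nu i))) ≤ u i * (c⁻¹ * Real.exp (-(σ * nu i))) :=
          mul_le_mul_of_nonneg_left (hJle _ (Real.exp_pos _)) (hu i)
      _ = _ := by ring
  have hlim : Tendsto (fun σ => ∑' i, w i * J (Real.exp (-(σ * lam i))) -
      ∑' k, v k * J (Real.exp (-(σ * mu k)))) (𝓝[>] 0) (𝓝 C) := by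
    rw [Metric.tendsto_nhds]
    intro ε hε
    obtain ⟨q₁, q₂, hq, hint⟩ := exists_polynomial_karamata hc0 hc1 (ε := ε / 4) (by positivity)
    set P₁ : Polynomial ℝ := 1 + (1 - Polynomial.X) * q₁ with hP₁
    set P₂ : Polynomial ℝ := 1 + (1 - Polynomial.X) * q₂ with hP₂
    have hP₁e : ∀ x, x * P₁.eval x = x + x * (1 - x) * q₁.eval x := fun x => by
      simp [hP₁]; ring
    have hP₂e : ∀ x, x * P₂.eval x = x + x * (1 - x) * q₂.eval x := fun x => by
      simp [hP₂]; ring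
    have hl₁ := tendsto_tsum_mul_eval_exp_sub hs ht hdiff P₁
    have hl₂ := tendsto_tsum_mul_eval_exp_sub hs ht hdiff P₂
    have hP₁1 : P₁.eval 1 = 1 := by simp [hP₁]
    have hP₂1 : P₂.eval 1 = 1 := by simp [hP₂]
    rw [hP₁1, mul_one] at hl₁
    rw [hP₂1, mul_one] at hl₂
    have hQ := (tendsto_mul_tsum_exp_mul_eval (q₂ - q₁)).eventually_lt_const
      (show _ < ε / 2 by linarith)
    filter_upwards [self_mem_nhdsWithin, Metric.tendsto_nhds.mp hl₁ (ε / 2) (by positivity),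
      Metric.tendsto_nhds.mp hl₂ (ε / 2) (by positivity), hQ] with σ hσ h₁ h₂ hQ
    have hσ : 0 < σ := hσ
    have hmem : ∀ t : ℝ, 0 ≤ t → Real.exp (-(σ * t)) ∈ Set.Icc (0 : ℝ) 1 := fun t ht =>
      ⟨(Real.exp_pos _).le, by simpa using by positivity⟩
    have hle₁ : ∀ {κ : Type} {u nu : κ → ℝ}, (∀ i, 0 ≤ u i) → (∀ i, 0 ≤ nu i) →
        (∀ σ > 0, Summable fun i => u i * Real.exp (-(σ * nu i))) →
        ∑' i, u i * (Real.exp (-(σ * nu i)) * P₁.eval (Real.exp (-(σ * nu i)))) ≤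
          ∑' i, u i * J (Real.exp (-(σ * nu i))) := by
      intro κ u nu hu hnu hsu
      refine (summable_mul_eval_exp hsu hσ P₁).tsum_le_tsum (fun i => ?_) (hsJ hu hsu σ hσ)
      rw [hP₁e]
      exact mul_le_mul_of_nonneg_left (hq _ (hmem _ (hnu i))).1 (hu i)
    have hle₂ : ∀ {κ : Type} {u nu : κ → ℝ}, (∀ i, 0 ≤ u i) → (∀ i, 0 ≤ nu i) →
        (∀ σ > 0, Summable fun i => u i * Real.exp (-(σ * nu i))) →
        ∑' i, u i * J (Real.exp (-(σ * nu i))) ≤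
          ∑' i, u i * (Real.exp (-(σ * nu i)) * P₂.eval (Real.exp (-(σ * nu i)))) := by
      intro κ u nu hu hnu hsu
      refine (hsJ hu hsu σ hσ).tsum_le_tsum (fun i => ?_) (summable_mul_eval_exp hsu hσ P₂)
      rw [hP₂e]
      exact mul_le_mul_of_nonneg_left (hq _ (hmem _ (hnu i))).2.1 (hu i)
    have hH : ∑' k, v k * (Real.exp (-(σ * mu k)) * P₂.eval (Real.exp (-(σ * mu k)))) -
        ∑' k, v k * (Real.exp (-(σ * mu k)) * P₁.eval (Real.exp (-(σ * mu k)))) ≤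
        σ * ∑' k : ℕ, (Real.exp (-(σ * (k + 1))) *
          (q₂ - q₁).eval (Real.exp (-(σ * (k + 1))))) := by
      have hone : ∀ σ > (0 : ℝ), Summable fun k : ℕ => 1 * Real.exp (-(σ * ((k : ℝ) + 1))) :=
        fun σ hσ => by simpa using (hasSum_exp_neg_mul_succ hσ).summable
      have hsQ := summable_mul_eval_exp hone hσ (q₂ - q₁)
      simp only [one_mul] at hsQ
      rw [← (summable_mul_eval_exp ht hσ P₂).tsum_sub (summable_mul_eval_exp ht hσ P₁),
        ← tsum_mul_left]
      refine ((summable_mul_eval_exp ht hσ P₂).sub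
        (summable_mul_eval_exp ht hσ P₁)).tsum_le_tsum (fun k => ?_) (hsQ.mul_left σ)
      set x := Real.exp (-(σ * mu k)) with hx
      have hxm := hmem _ (hmu0 k)
      rw [hP₁e, hP₂e, Polynomial.eval_sub]
      have h1x : 1 - x ≤ σ * mu k := by
        have := Real.add_one_le_exp (-(σ * mu k))
        linarith
      have hvx : v k * (1 - x) ≤ σ := by
        calc v k * (1 - x) ≤ v k * (σ * mu k) := mul_le_mul_of_nonneg_left h1x (hv0 k)
          _ = σ := by simp only [hv, hmu]; field_simp
      have hnn : 0 ≤ x * (q₂.eval x - q₁.eval x) :=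
        mul_nonneg hxm.1 (sub_nonneg.mpr (hq x hxm).2.2)
      calc _ = v k * (1 - x) * (x * (q₂.eval x - q₁.eval x)) := by ring
        _ ≤ _ := mul_le_mul_of_nonneg_right hvx hnn
    rw [Real.dist_eq, abs_lt] at h₁ h₂ ⊢
    have a1 := hle₁ hw hlam hs
    have a2 := hle₂ hw hlam hs
    have b1 := hle₁ hv0 hmu0 ht
    have b2 := hle₂ hv0 hmu0 ht
    constructor <;> linarith [h₁.1, h₁.2, h₂.1, h₂.2]
  refine (hlim.comp tendsto_inv_atTop_nhdsGT_zero).congr' ?_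
  filter_upwards [eventually_gt_atTop 0] with y hy
  have hJexp : ∀ t : ℝ, J (Real.exp (-(y⁻¹ * t))) = if t ≤ y then 1 else 0 := fun t => by
    have : c ≤ Real.exp (-(y⁻¹ * t)) ↔ t ≤ y := by
      rw [hc, Real.exp_le_exp, neg_le_neg_iff, inv_mul_eq_div, div_le_one hy]
    simp only [hJ, this]
  simp only [Function.comp, hJexp]
  congr 1
  rw [tsum_eq_sum (s := Finset.range ⌊y⌋₊)]
  · rw [harmonic]
    push_cast
    refine Finset.sum_congr rfl fun k hk => ?_
    have hk : mu k ≤ y := by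
      have h1 : k + 1 ≤ ⌊y⌋₊ := Finset.mem_range.mp hk
      have h2 := (Nat.le_floor_iff hy.le).mp h1
      simpa [hmu] using h2
    simp [hk, hv]
  · intro k hk
    have hk : ¬ mu k ≤ y := fun hle => hk (Finset.mem_range.mpr
      ((Nat.le_floor_iff hy.le).mpr (by simpa [hmu] using hle) : k + 1 ≤ ⌊y⌋₊))
    simp [hk]

theorem HasProd.hasSum_log {ι : Type*} {g : ι → ℝ} {a : ℝ} (h : HasProd g a)
    (hg : ∀ i, 0 < g i) (ha : 0 < a) : HasSum (fun i => Real.log (g i)) (Real.log a) := by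
  refine (((Real.continuousAt_log ha.ne').tendsto.comp h :)).congr fun s => ?_
  exact Real.log_prod fun i _ => (hg i).ne'

/-- The completely multiplicative function `n ↦ χ₄(n)^(e+1) n^(-s)`. -/
noncomputable def chiFourSummand (e : ℕ) (s : ℝ) : ℕ →*₀ ℝ where
  toFun n := ((ZMod.χ₄ n : ℤ) : ℝ) ^ (e + 1) * (n : ℝ) ^ (-s)
  map_zero' := by simp
  map_one' := by simp
  map_mul' m n := by
    push_cast
    rw [map_mul, Real.mul_rpow (Nat.cast_nonneg _) (Nat.cast_nonneg _)]
    push_cast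
    ring

theorem chiFourSummand_apply (e : ℕ) (s : ℝ) (n : ℕ) :
    chiFourSummand e s n = ((ZMod.χ₄ n : ℤ) : ℝ) ^ (e + 1) * (n : ℝ) ^ (-s) := rfl

theorem abs_chiFourSummand_le (e : ℕ) (s : ℝ) (n : ℕ) :
    ‖chiFourSummand e s n‖ ≤ (n : ℝ) ^ (-s) := by
  have h0 : (0 : ℝ) ≤ (n : ℝ) ^ (-s) := by positivity
  have h1 : |((ZMod.χ₄ n : ℤ) : ℝ)| ≤ 1 := by
    rw [ZMod.χ₄_nat_eq_if_mod_four]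
    split_ifs <;> simp
  rw [chiFourSummand_apply, Real.norm_eq_abs, abs_mul, abs_pow, abs_of_nonneg h0]
  exact mul_le_of_le_one_left h0 (pow_le_one₀ (abs_nonneg _) h1)

theorem summable_norm_chiFourSummand (e : ℕ) {s : ℝ} (hs : 1 < s) :
    Summable fun n => ‖chiFourSummand e s n‖ :=
  Summable.of_nonneg_of_le (fun _ => norm_nonneg _) (abs_chiFourSummand_le e s)
    (Real.summable_nat_rpow.mpr (by linarith))

theorem chiFourSummand_two_mul (e : ℕ) (s : ℝ) (k : ℕ) : chiFourSummand e s (2 * k) = 0 := by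
  rw [chiFourSummand_apply, ZMod.χ₄_nat_eq_if_mod_four]
  simp

theorem chiFourSummand_two_mul_add_one (e : ℕ) (s : ℝ) (k : ℕ) :
    chiFourSummand e s (2 * k + 1) = ((-1) ^ k) ^ (e + 1) * (2 * (k : ℝ) + 1) ^ (-s) := by
  rw [chiFourSummand_apply, ZMod.χ₄_eq_neg_one_pow (by omega)]
  have : (2 * k + 1) / 2 = k := by omega
  rw [this]
  push_cast
  rfl

theorem tsum_chiFourSummand (e : ℕ) {s : ℝ} (hs : 1 < s) :
    ∑' n, chiFourSummand e s n =
      ∑' k : ℕ, ((-1) ^ k) ^ (e + 1) * (2 * (k : ℝ) + 1) ^ (-s) := by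
  have hsum := (summable_norm_chiFourSummand e hs).of_norm
  have h := tsum_even_add_odd (f := chiFourSummand e s)
    (hsum.comp_injective fun a b h => by simpa using h)
    (hsum.comp_injective fun a b h => by simpa using h)
  simpa [chiFourSummand_two_mul, chiFourSummand_two_mul_add_one] using h.symm

theorem summable_two_mul_add_one_rpow {s : ℝ} (hs : 1 < s) :
    Summable fun k : ℕ => (2 * (k : ℝ) + 1) ^ (-s) := by
  have h := (Real.summable_nat_rpow (p := -s)).mpr (by linarith)
  refine (h.comp_injective (i := fun k : ℕ => 2 * k + 1) fun a b h => by simpa using h).congr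
    fun k => ?_
  simp

theorem tsum_two_mul_add_one_rpow {s : ℝ} (hs : 1 < s) :
    ∑' k : ℕ, (2 * (k : ℝ) + 1) ^ (-s) = (1 - 2 ^ (-s)) * ∑' n : ℕ, 1 / (n : ℝ) ^ s := by
  have hsum := (Real.summable_nat_rpow (p := -s)).mpr (by linarith)
  have h := tsum_even_add_odd (f := fun n : ℕ => (n : ℝ) ^ (-s))
    (hsum.comp_injective fun a b h => by simpa using h)
    (hsum.comp_injective fun a b h => by simpa using h)
  have h2 : ∀ k : ℕ, ((2 * k : ℕ) : ℝ) ^ (-s) = 2 ^ (-s) * (k : ℝ) ^ (-s) := fun k => by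
    push_cast
    rw [Real.mul_rpow (by norm_num) (Nat.cast_nonneg _)]
  have h3 : ∀ n : ℕ, 1 / (n : ℝ) ^ s = (n : ℝ) ^ (-s) := fun n => by
    rw [Real.rpow_neg (Nat.cast_nonneg _), one_div]
  simp only [h2, tsum_mul_left] at h
  simp only [h3]
  push_cast at h
  linarith

theorem antitone_two_mul_add_one_rpow {s : ℝ} (hs : 0 < s) :
    Antitone fun k : ℕ => (2 * (k : ℝ) + 1) ^ (-s) := by
  intro a b hab
  refine Real.rpow_le_rpow_of_nonpos (by positivity) ?_ (by linarith)
  gcongr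

theorem tendsto_sum_alternating_rpow {s : ℝ} (hs : 1 < s) :
    Tendsto (fun n => ∑ k ∈ Finset.range n, (-1) ^ k * (2 * (k : ℝ) + 1) ^ (-s)) atTop
      (𝓝 (∑' k : ℕ, (-1) ^ k * (2 * (k : ℝ) + 1) ^ (-s))) := by
  refine (Summable.hasSum ?_).tendsto_sum_nat
  refine Summable.of_norm ((summable_two_mul_add_one_rpow hs).congr fun k => ?_)
  have : (0 : ℝ) ≤ (2 * (k : ℝ) + 1) ^ (-s) := by positivity
  simp [abs_of_nonneg this]

theorem tsum_alternating_rpow_pos {s : ℝ} (hs : 1 < s) :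
    0 < ∑' k : ℕ, (-1) ^ k * (2 * (k : ℝ) + 1) ^ (-s) := by
  have h := (antitone_two_mul_add_one_rpow (by linarith)).alternating_series_le_tendsto
    (tendsto_sum_alternating_rpow hs) 1
  refine lt_of_lt_of_le ?_ h
  have : (3 : ℝ) ^ (-s) < 1 := Real.rpow_lt_one_of_one_lt_of_neg (by norm_num) (by linarith)
  norm_num [Finset.sum_range_succ]
  exact this

/-- Continuity at `1⁺` of the Dirichlet beta function, with the Leibniz value `π / 4`. -/
theorem tendsto_tsum_alternating_rpow :
    Tendsto (fun s : ℝ => ∑' k : ℕ, (-1) ^ k * (2 * (k : ℝ) + 1) ^ (-s)) (𝓝[>] 1)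
      (𝓝 (Real.pi / 4)) := by
  set S : ℕ → ℝ → ℝ := fun n s => ∑ k ∈ Finset.range n, (-1) ^ k * (2 * (k : ℝ) + 1) ^ (-s)
    with hS
  have hcont : ∀ n, Tendsto (S n) (𝓝[>] 1) (𝓝 (S n 1)) := fun n => by
    have : Continuous (S n) := by
      refine continuous_finsetSum _ fun k _ => continuous_const.mul ?_
      exact continuous_const.rpow continuous_neg fun _ => Or.inl (by positivity)
    exact this.continuousAt.tendsto.mono_left nhdsWithin_le_nhds
  have hlim : Tendsto (fun n => S n 1) atTop (𝓝 (Real.pi / 4)) := by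
    refine Real.tendsto_sum_pi_div_four.congr fun n => ?_
    refine Finset.sum_congr rfl fun k _ => ?_
    rw [Real.rpow_neg_one, div_eq_mul_inv]
  have hlow : Tendsto (fun n => S (2 * n) 1) atTop (𝓝 (Real.pi / 4)) :=
    hlim.comp (tendsto_atTop_mono (fun n => by simp only [id]; omega) tendsto_id)
  have hhigh : Tendsto (fun n => S (2 * n + 1) 1) atTop (𝓝 (Real.pi / 4)) :=
    hlim.comp (tendsto_atTop_mono (fun n => by simp only [id]; omega) tendsto_id)
  refine tendsto_order.mpr ⟨fun a ha => ?_, fun a ha => ?_⟩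
  · obtain ⟨n, hn⟩ := (hlow.eventually_const_lt ha).exists
    filter_upwards [(hcont (2 * n)).eventually_const_lt hn, self_mem_nhdsWithin] with s hs hs1
    have hs1 : 1 < s := hs1
    exact hs.trans_le ((antitone_two_mul_add_one_rpow (by linarith)).alternating_series_le_tendsto
      (tendsto_sum_alternating_rpow hs1) n)
  · obtain ⟨n, hn⟩ := (hhigh.eventually_lt_const ha).exists
    filter_upwards [(hcont (2 * n + 1)).eventually_lt_const hn, self_mem_nhdsWithin] with s hs hs1
    have hs1 : 1 < s := hs1
    exact ((antitone_two_mul_add_one_rpow (by linarith)).tendsto_le_alternating_series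
      (tendsto_sum_alternating_rpow hs1) n).trans_lt hs

theorem hasSum_log_chiFourSummand (e : ℕ) {s : ℝ} (hs : 1 < s)
    (hpos : 0 < ∑' n, chiFourSummand e s n) :
    HasSum ({p : ℕ | p.Prime}.indicator fun p => -Real.log (1 - chiFourSummand e s p))
      (Real.log (∑' n, chiFourSummand e s n)) := by
  refine hasSum_subtype_iff_indicator.mp ?_
  have h := EulerProduct.eulerProduct_completely_multiplicative_hasProd
    (summable_norm_chiFourSummand e hs)
  have hlt : ∀ p : Nat.Primes, 0 < 1 - chiFourSummand e s p := fun p => by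
    have h1 := abs_chiFourSummand_le e s p
    have h2 : ((p : ℕ) : ℝ) ^ (-s) < 1 :=
      Real.rpow_lt_one_of_one_lt_of_neg (by exact_mod_cast p.2.one_lt) (by linarith)
    have h3 := le_abs_self (chiFourSummand e s p)
    rw [Real.norm_eq_abs] at h1
    linarith
  have := h.hasSum_log (fun p => inv_pos.mpr (hlt p)) hpos
  simp only [Real.log_inv] at this
  exact this

theorem tsum_chiFourSummand_one {s : ℝ} (hs : 1 < s) :
    ∑' n, chiFourSummand 1 s n = ∑' k : ℕ, (2 * (k : ℝ) + 1) ^ (-s) := by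
  rw [tsum_chiFourSummand 1 hs]
  refine tsum_congr fun k => ?_
  rw [← pow_mul, mul_comm k, pow_mul]
  norm_num

theorem tsum_two_mul_add_one_rpow_pos {s : ℝ} (hs : 1 < s) :
    0 < ∑' k : ℕ, (2 * (k : ℝ) + 1) ^ (-s) :=
  (summable_two_mul_add_one_rpow hs).tsum_pos (fun k => by positivity) 0 (by norm_num)

/-- The Euler product of `(1 - 2⁻ˢ) ζ(s) / L(s, χ₄)`, in logarithmic form. -/
theorem hasSum_log_primes_three_mod_four {s : ℝ} (hs : 1 < s) :
    HasSum (fun p : {p : ℕ // p.Prime ∧ p % 4 = 3} =>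
      Real.log (1 + ((p : ℕ) : ℝ) ^ (-s)) - Real.log (1 - ((p : ℕ) : ℝ) ^ (-s)))
      (Real.log (∑' k : ℕ, (2 * (k : ℝ) + 1) ^ (-s)) -
        Real.log (∑' k : ℕ, (-1) ^ k * (2 * (k : ℝ) + 1) ^ (-s))) := by
  have h0 : ∑' n, chiFourSummand 0 s n = ∑' k : ℕ, (-1) ^ k * (2 * (k : ℝ) + 1) ^ (-s) := by
    simpa using tsum_chiFourSummand 0 hs
  have h := (hasSum_log_chiFourSummand 1 hs
    (by rw [tsum_chiFourSummand_one hs]; exact tsum_two_mul_add_one_rpow_pos hs)).sub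
    (hasSum_log_chiFourSummand 0 hs (by rw [h0]; exact tsum_alternating_rpow_pos hs))
  rw [h0, tsum_chiFourSummand_one hs] at h
  refine (hasSum_subtype_iff_indicator (s := {p : ℕ | p.Prime ∧ p % 4 = 3})
    (f := fun p : ℕ => Real.log (1 + (p : ℝ) ^ (-s)) - Real.log (1 - (p : ℝ) ^ (-s)))).mpr ?_
  refine (congrArg (HasSum · _) (funext fun p => ?_)).mpr h
  by_cases hp : p.Prime
  · simp only [Set.indicator, Set.mem_ofPred_eq, hp, true_and, if_true, chiFourSummand_apply,
      ZMod.χ₄_nat_eq_if_mod_four]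
    have h4 : p % 4 = 3 ∨ p % 4 = 1 ∨ p % 2 = 0 := by omega
    rcases h4 with h4 | h4 | h4
    · have h2 : p % 2 ≠ 0 := by omega
      simp [h4, h2]
      ring
    · have h2 : p % 2 ≠ 0 := by omega
      simp [h4, h2]
    · have h3 : p % 4 ≠ 3 := by omega
      simp [h3, h4]
  · simp [Set.indicator, hp]

theorem tsum_two_mul_add_one_rpow_neg_two :
    ∑' k : ℕ, (2 * (k : ℝ) + 1) ^ (-2 : ℝ) = Real.pi ^ 2 / 8 := by
  rw [tsum_two_mul_add_one_rpow (by norm_num)]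
  have : ∑' n : ℕ, 1 / (n : ℝ) ^ (2 : ℝ) = Real.pi ^ 2 / 6 := by
    rw [← hasSum_zeta_two.tsum_eq]
    refine tsum_congr fun n => ?_
    norm_num
  rw [this, Real.rpow_neg (by norm_num)]
  norm_num
  ring

theorem abs_add_log_one_sub_le {u : ℝ} (h0 : 0 ≤ u) (h1 : u ≤ 1 / 2) :
    |u + Real.log (1 - u)| ≤ 2 * u ^ 2 := by
  have h := Real.abs_log_sub_add_sum_range_le (x := u) (by rw [abs_of_nonneg h0]; linarith) 1
  simp only [Finset.sum_range_one, abs_of_nonneg h0] at h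
  norm_num at h
  refine h.trans ?_
  rw [div_le_iff₀ (by linarith)]
  nlinarith [sq_nonneg u]

theorem abs_log_one_add_sub_le {u : ℝ} (h0 : 0 ≤ u) (h1 : u ≤ 1 / 2) :
    |Real.log (1 + u) - u| ≤ 2 * u ^ 2 := by
  have h := Real.abs_log_sub_add_sum_range_le (x := -u)
    (by rw [abs_neg, abs_of_nonneg h0]; linarith) 1
  simp only [Finset.sum_range_one, abs_neg, abs_of_nonneg h0] at h
  norm_num at h
  rw [neg_add_eq_sub] at h
  refine h.trans ?_
  rw [div_le_iff₀ (by linarith)]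
  nlinarith [sq_nonneg u]

theorem summable_log_one_sub_inv_sq (r : ℕ) :
    Summable fun p : {p : ℕ // p.Prime ∧ p % 4 = r} =>
      Real.log (1 - 1 / ((p : ℕ) : ℝ) ^ 2) := by
  have hsum : Summable fun p : {p : ℕ // p.Prime ∧ p % 4 = r} =>
      2 * (1 / ((p : ℕ) : ℝ) ^ 2) :=
    (((Real.summable_one_div_nat_pow (p := 2)).mpr (by norm_num)).comp_injective
      Subtype.val_injective).mul_left 2
  refine Summable.of_norm_bounded hsum fun p => ?_
  have hp : (2 : ℝ) ≤ ((p : ℕ) : ℝ) := by exact_mod_cast p.2.1.two_le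
  set u : ℝ := 1 / ((p : ℕ) : ℝ) ^ 2 with hu
  have hu0 : 0 ≤ u := by positivity
  have hu1 : u ≤ 1 / 4 := by
    rw [hu]
    refine one_div_le_one_div_of_le (by norm_num) ?_
    nlinarith
  have h := abs_le.mp (abs_add_log_one_sub_le hu0 (by linarith))
  rw [Real.norm_eq_abs, abs_le]
  constructor <;> nlinarith [h.1, h.2]

theorem one_sub_inv_sq_pos {p : ℕ} (hp : p.Prime) : (0 : ℝ) < 1 - 1 / (p : ℝ) ^ 2 := by
  have h2 : (2 : ℝ) ≤ (p : ℝ) := by exact_mod_cast hp.two_le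
  rw [sub_pos, div_lt_one (by positivity)]
  nlinarith

/-- `∏_{p odd} (1 - p⁻²) = 8 / π²`, split by residues modulo `4`, in logarithmic form. -/
theorem tsum_log_one_sub_inv_sq_add :
    ∑' p : {p : ℕ // p.Prime ∧ p % 4 = 1}, Real.log (1 - 1 / ((p : ℕ) : ℝ) ^ 2) +
      ∑' p : {p : ℕ // p.Prime ∧ p % 4 = 3}, Real.log (1 - 1 / ((p : ℕ) : ℝ) ^ 2) =
      -Real.log (Real.pi ^ 2 / 8) := by
  have hval : ∑' n, chiFourSummand 1 2 n = Real.pi ^ 2 / 8 := by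
    rw [tsum_chiFourSummand_one (by norm_num), tsum_two_mul_add_one_rpow_neg_two]
  have h := (hasSum_log_chiFourSummand 1 (s := 2) (by norm_num)
    (by rw [hval]; positivity)).neg
  rw [hval] at h
  have hind : ∀ r, HasSum ({p : ℕ | p.Prime ∧ p % 4 = r}.indicator
      fun p : ℕ => Real.log (1 - 1 / (p : ℝ) ^ 2)) (∑' p : {p : ℕ // p.Prime ∧ p % 4 = r},
        Real.log (1 - 1 / ((p : ℕ) : ℝ) ^ 2)) := fun r =>
    hasSum_subtype_iff_indicator.mp (summable_log_one_sub_inv_sq r).hasSum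
  refine ((hind 1).add (hind 3)).unique ?_
  refine (congrArg (HasSum · _) (funext fun p => ?_)).mpr h
  by_cases hp : p.Prime
  · simp only [Set.indicator, Set.mem_ofPred_eq, hp, true_and, if_true, chiFourSummand_apply,
      ZMod.χ₄_nat_eq_if_mod_four, Real.rpow_neg (Nat.cast_nonneg _), Real.rpow_two]
    have h4 : p % 4 = 3 ∨ p % 4 = 1 ∨ p % 2 = 0 := by omega
    rcases h4 with h4 | h4 | h4
    · have h2 : p % 2 ≠ 0 := by omega
      simp [h4, h2]
    · have h2 : p % 2 ≠ 0 := by omega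
      simp [h4, h2]
    · have h3 : p % 4 ≠ 3 := by omega
      have h1 : p % 4 ≠ 1 := by omega
      simp [h3, h4, h1]
  · simp [Set.indicator, hp]

/-- `log ((1 - 2⁻ˢ) ζ(s) / L(s, χ₄)) = -log (1 - e^{-σ}) + log (2 / π) + o(1)` at `s = 1 + σ`,
as `σ → 0⁺`. -/
theorem tendsto_log_odd_zeta_div_beta :
    Tendsto (fun σ : ℝ => Real.log (∑' k : ℕ, (2 * (k : ℝ) + 1) ^ (-(1 + σ))) -
        Real.log (∑' k : ℕ, (-1) ^ k * (2 * (k : ℝ) + 1) ^ (-(1 + σ))) +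
        Real.log (1 - Real.exp (-σ))) (𝓝[>] 0) (𝓝 (Real.log (2 / Real.pi))) := by
  have hshift : Tendsto (fun σ : ℝ => 1 + σ) (𝓝[>] 0) (𝓝[>] 1) := by
    refine tendsto_nhdsWithin_iff.mpr ⟨?_, ?_⟩
    · have : Tendsto (fun σ : ℝ => 1 + σ) (𝓝 0) (𝓝 (1 + 0)) := tendsto_const_nhds.add tendsto_id
      rw [add_zero] at this
      exact this.mono_left nhdsWithin_le_nhds
    · filter_upwards [self_mem_nhdsWithin] with σ hσ
      exact Set.mem_Ioi.mpr (by linarith [Set.mem_Ioi.mp hσ])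
  have hz := tendsto_sub_mul_tsum_nat_rpow.comp hshift
  have hb := tendsto_tsum_alternating_rpow.comp hshift
  have hexp : Tendsto (fun σ : ℝ => (1 - Real.exp (-σ)) / σ) (𝓝[>] 0) (𝓝 1) := by
    have hd : HasDerivAt (fun σ : ℝ => 1 - Real.exp (-σ)) 1 0 := by
      simpa using ((hasDerivAt_id (0 : ℝ)).neg.exp).const_sub 1
    have := (hasDerivAt_iff_tendsto_slope_zero.mp hd).mono_left
      (nhdsWithin_mono 0 (fun x (hx : 0 < x) => hx.ne'))
    refine this.congr fun σ => ?_
    simp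
    ring
  have htwo : Tendsto (fun σ : ℝ => 1 - (2 : ℝ) ^ (-(1 + σ))) (𝓝[>] 0) (𝓝 (1 / 2)) := by
    have hc : Continuous fun σ : ℝ => 1 - (2 : ℝ) ^ (-(1 + σ)) :=
      continuous_const.sub (continuous_const.rpow (by fun_prop) fun _ => Or.inl (by norm_num))
    have := hc.tendsto 0
    norm_num [Real.rpow_neg_one] at this
    refine Tendsto.mono_left ?_ nhdsWithin_le_nhds
    convert this using 2
    norm_num
  have hprod := ((htwo.mul hz).mul hexp).div hb (by positivity)
  have hval : 1 / 2 * 1 * 1 / (Real.pi / 4) = 2 / Real.pi := by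
    field_simp
    norm_num
  rw [hval] at hprod
  refine (hprod.log (by positivity)).congr' ?_
  filter_upwards [self_mem_nhdsWithin] with σ hσ
  have hσ : 0 < σ := hσ
  have hs : 1 < 1 + σ := by linarith
  have h1 := tsum_two_mul_add_one_rpow_pos hs
  have h2 := tsum_alternating_rpow_pos hs
  have h3 : 0 < 1 - Real.exp (-σ) := by simpa using hσ
  rw [← Real.log_div h1.ne' h2.ne', ← Real.log_mul (div_pos h1 h2).ne' h3.ne',
    tsum_two_mul_add_one_rpow hs]
  congr 1
  simp only [Pi.div_apply, Function.comp, add_sub_cancel_left]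
  field_simp

theorem abs_two_log_add_le {u v : ℝ} (hu0 : 0 ≤ u) (hu : u ≤ 1 / 2) (hv0 : 0 ≤ v) (hv : v ≤ 1) :
    |-2 * Real.log (1 - u) * v - (Real.log (1 + u * v) - Real.log (1 - u * v))| ≤
      8 * u ^ 2 := by
  have huv0 : 0 ≤ u * v := mul_nonneg hu0 hv0
  have huv : u * v ≤ u := mul_le_of_le_one_right hu0 hv
  have h1 := abs_le.mp (abs_add_log_one_sub_le hu0 hu)
  have h2 := abs_le.mp (abs_add_log_one_sub_le huv0 (huv.trans hu))
  have h3 := abs_le.mp (abs_log_one_add_sub_le huv0 (huv.trans hu))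
  have h4 : (u * v) ^ 2 ≤ u ^ 2 := pow_le_pow_left₀ huv0 huv 2
  have h5 : |v * (u + Real.log (1 - u))| ≤ 2 * u ^ 2 := by
    rw [abs_mul, abs_of_nonneg hv0]
    exact (mul_le_of_le_one_left (abs_nonneg _) hv).trans (abs_add_log_one_sub_le hu0 hu)
  have h5 := abs_le.mp h5
  rw [abs_le]
  constructor <;> nlinarith [h5.1, h5.2, h2.1, h2.2, h3.1, h3.2]

theorem exp_neg_mul_log_natCast {p : ℕ} (hp : p.Prime) (σ : ℝ) :
    Real.exp (-(σ * Real.log p)) = (p : ℝ) ^ (-σ) := by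
  rw [Real.rpow_def_of_pos (by exact_mod_cast hp.pos)]
  ring_nf

theorem one_div_mul_rpow_neg {p : ℕ} (hp : p.Prime) (σ : ℝ) :
    1 / (p : ℝ) * (p : ℝ) ^ (-σ) = (p : ℝ) ^ (-(1 + σ)) := by
  have hp0 : (0 : ℝ) < p := by exact_mod_cast hp.pos
  rw [neg_add, Real.rpow_add hp0, Real.rpow_neg_one, one_div]

theorem one_div_le_half {p : ℕ} (hp : p.Prime) : 1 / (p : ℝ) ≤ 1 / 2 :=
  one_div_le_one_div_of_le two_pos (by exact_mod_cast hp.two_le)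

theorem summable_log_mul_exp_primes_three_mod_four {σ : ℝ} (hσ : 0 < σ) :
    Summable fun p : {p : ℕ // p.Prime ∧ p % 4 = 3} =>
      -2 * Real.log (1 - 1 / ((p : ℕ) : ℝ)) * Real.exp (-(σ * Real.log (p : ℕ))) := by
  have hsum : Summable fun p : {p : ℕ // p.Prime ∧ p % 4 = 3} =>
      8 * (1 / ((p : ℕ) : ℝ) ^ 2) :=
    (((Real.summable_one_div_nat_pow (p := 2)).mpr (by norm_num)).comp_injective
      Subtype.val_injective).mul_left 8
  have h1 : Summable fun p : {p : ℕ // p.Prime ∧ p % 4 = 3} =>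
      -2 * Real.log (1 - 1 / ((p : ℕ) : ℝ)) * Real.exp (-(σ * Real.log (p : ℕ))) -
        (Real.log (1 + ((p : ℕ) : ℝ) ^ (-(1 + σ))) -
          Real.log (1 - ((p : ℕ) : ℝ) ^ (-(1 + σ)))) := by
    refine Summable.of_norm_bounded hsum fun p => ?_
    have hv : ((p : ℕ) : ℝ) ^ (-σ) ≤ 1 :=
      Real.rpow_le_one_of_one_le_of_nonpos (by exact_mod_cast p.2.1.one_le) (by linarith)
    have := abs_two_log_add_le (u := 1 / ((p : ℕ) : ℝ)) (by positivity) (one_div_le_half p.2.1)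
      (v := ((p : ℕ) : ℝ) ^ (-σ)) (by positivity) hv
    rw [one_div_mul_rpow_neg p.2.1, one_div_pow] at this
    rw [exp_neg_mul_log_natCast p.2.1]
    exact this
  refine (h1.add (hasSum_log_primes_three_mod_four (s := 1 + σ) (by linarith)).summable).congr
    fun p => ?_
  ring

theorem tendsto_tsum_log_primes_three_mod_four :
    Tendsto (fun σ : ℝ => ∑' p : {p : ℕ // p.Prime ∧ p % 4 = 3},
      -2 * Real.log (1 - 1 / ((p : ℕ) : ℝ)) * Real.exp (-(σ * Real.log (p : ℕ))) +
        Real.log (1 - Real.exp (-σ))) (𝓝[>] 0)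
      (𝓝 (Real.log (2 / Real.pi) - ∑' p : {p : ℕ // p.Prime ∧ p % 4 = 3},
        Real.log (1 - 1 / ((p : ℕ) : ℝ) ^ 2))) := by
  have hsum : Summable fun p : {p : ℕ // p.Prime ∧ p % 4 = 3} =>
      8 * (1 / ((p : ℕ) : ℝ) ^ 2) :=
    (((Real.summable_one_div_nat_pow (p := 2)).mpr (by norm_num)).comp_injective
      Subtype.val_injective).mul_left 8
  have hdom := tendsto_tsum_of_dominated_convergence (𝓕 := 𝓝[>] (0 : ℝ))
    (f := fun σ (p : {p : ℕ // p.Prime ∧ p % 4 = 3}) =>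
      -2 * Real.log (1 - 1 / ((p : ℕ) : ℝ)) * ((p : ℕ) : ℝ) ^ (-σ) -
        (Real.log (1 + 1 / ((p : ℕ) : ℝ) * ((p : ℕ) : ℝ) ^ (-σ)) -
          Real.log (1 - 1 / ((p : ℕ) : ℝ) * ((p : ℕ) : ℝ) ^ (-σ))))
    (g := fun p => -Real.log (1 - 1 / ((p : ℕ) : ℝ) ^ 2)) hsum ?_ ?_
  · rw [tsum_neg] at hdom
    rw [sub_eq_add_neg]
    refine (tendsto_log_odd_zeta_div_beta.add hdom).congr' ?_
    filter_upwards [self_mem_nhdsWithin] with σ hσ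
    have hs : 1 < 1 + σ := by linarith [Set.mem_Ioi.mp hσ]
    have h1 := hasSum_log_primes_three_mod_four hs
    have h2 := summable_log_mul_exp_primes_three_mod_four hσ
    rw [← h1.tsum_eq]
    have h3 := h2.tsum_sub h1.summable
    have h4 : ∀ p : {p : ℕ // p.Prime ∧ p % 4 = 3},
        -2 * Real.log (1 - 1 / ((p : ℕ) : ℝ)) * ((p : ℕ) : ℝ) ^ (-σ) -
        (Real.log (1 + 1 / ((p : ℕ) : ℝ) * ((p : ℕ) : ℝ) ^ (-σ)) -
          Real.log (1 - 1 / ((p : ℕ) : ℝ) * ((p : ℕ) : ℝ) ^ (-σ))) =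
        -2 * Real.log (1 - 1 / ((p : ℕ) : ℝ)) * Real.exp (-(σ * Real.log (p : ℕ))) -
        (Real.log (1 + ((p : ℕ) : ℝ) ^ (-(1 + σ))) -
          Real.log (1 - ((p : ℕ) : ℝ) ^ (-(1 + σ)))) := fun p => by
      rw [one_div_mul_rpow_neg p.2.1, exp_neg_mul_log_natCast p.2.1]
    rw [tsum_congr h4, h3]
    ring
  · intro p
    have hp0 : (0 : ℝ) < ((p : ℕ) : ℝ) := by exact_mod_cast p.2.1.pos
    have hp1 := one_div_le_half p.2.1
    have hp2 : 0 < 1 / ((p : ℕ) : ℝ) := by positivity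
    have hv : Tendsto (fun σ : ℝ => ((p : ℕ) : ℝ) ^ (-σ)) (𝓝[>] 0) (𝓝 1) := by
      have hc : Continuous fun σ : ℝ => ((p : ℕ) : ℝ) ^ (-σ) :=
        continuous_const.rpow continuous_neg fun _ => Or.inl hp0.ne'
      have := hc.tendsto 0
      rw [neg_zero, Real.rpow_zero] at this
      exact this.mono_left nhdsWithin_le_nhds
    have hu := hv.const_mul (1 / ((p : ℕ) : ℝ))
    have hlim := (hv.const_mul (-2 * Real.log (1 - 1 / ((p : ℕ) : ℝ)))).sub
      (((hu.const_add 1).log (by linarith)).sub ((hu.const_sub 1).log (by linarith)))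
    convert hlim using 2
    have hfac : 1 - 1 / ((p : ℕ) : ℝ) ^ 2 =
        (1 - 1 / ((p : ℕ) : ℝ)) * (1 + 1 / ((p : ℕ) : ℝ)) := by
      ring
    rw [hfac, Real.log_mul (by linarith) (by linarith)]
    ring_nf
  · filter_upwards [self_mem_nhdsWithin] with σ hσ p
    have hv : ((p : ℕ) : ℝ) ^ (-σ) ≤ 1 :=
      Real.rpow_le_one_of_one_le_of_nonpos (by exact_mod_cast p.2.1.one_le)
        (by linarith [Set.mem_Ioi.mp hσ])
    have := abs_two_log_add_le (u := 1 / ((p : ℕ) : ℝ)) (by positivity) (one_div_le_half p.2.1)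
      (v := ((p : ℕ) : ℝ) ^ (-σ)) (by positivity) hv
    rw [one_div_pow] at this
    exact this

theorem tendsto_harmonic_floor_sub_log :
    Tendsto (fun y : ℝ => (harmonic ⌊y⌋₊ : ℝ) - Real.log y) atTop
      (𝓝 Real.eulerMascheroniConstant) := by
  have h1 := Real.tendsto_harmonic_sub_log.comp (tendsto_nat_floor_atTop (α := ℝ))
  have h2 := (tendsto_nat_floor_div_atTop (R := ℝ)).log one_ne_zero
  have h3 := h1.add h2
  rw [Real.log_one, add_zero] at h3
  refine h3.congr' ?_
  filter_upwards [eventually_ge_atTop 1] with y hy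
  have hf : (⌊y⌋₊ : ℝ) ≠ 0 := by
    exact_mod_cast (Nat.floor_pos.mpr hy).ne'
  rw [Real.log_div hf (by linarith)]
  simp only [Function.comp]
  ring

theorem tsum_log_primes_three_mod_four_le {x : ℝ} (hx : 0 < x) :
    ∑' p : {p : ℕ // p.Prime ∧ p % 4 = 3}, -2 * Real.log (1 - 1 / ((p : ℕ) : ℝ)) *
        (if Real.log (p : ℕ) ≤ Real.log x then 1 else 0) =
      -2 * Real.log (∏ p ∈ (Nat.floor x + 1).primesBelow.filter (fun p => p % 4 = 3),
          (1 - 1 / (p : ℝ))) := by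
  have hpos : ∀ p : ℕ, p.Prime → 0 < 1 - 1 / (p : ℝ) := fun p hp => by
    linarith [one_div_le_half hp]
  set f : ℕ → ℝ := fun p => -2 * Real.log (1 - 1 / (p : ℝ)) *
        (if Real.log p ≤ Real.log x then 1 else 0) with hf
  have h := tsum_subtype {p : ℕ | p.Prime ∧ p % 4 = 3} f
  have hmem : ∀ p : ℕ, p.Prime → (Real.log p ≤ Real.log x ↔ p < ⌊x⌋₊ + 1) := fun p hp => by
    rw [Real.log_le_log_iff (by exact_mod_cast hp.pos) hx, Nat.lt_succ_iff,
      Nat.le_floor_iff hx.le]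
  refine h.trans ?_
  rw [tsum_eq_sum (s := (Nat.floor x + 1).primesBelow.filter (fun p => p % 4 = 3)),
    Real.log_prod, Finset.mul_sum]
  · refine Finset.sum_congr rfl fun p hp => ?_
    rw [Finset.mem_filter, Nat.mem_primesBelow] at hp
    rw [Set.indicator_of_mem (show p ∈ {p : ℕ | p.Prime ∧ p % 4 = 3} from ⟨hp.1.2, hp.2⟩)]
    simp only [hf, (hmem p hp.1.2).mpr hp.1.1, if_true, mul_one]
  · intro p hp
    rw [Finset.mem_filter, Nat.mem_primesBelow] at hp
    exact (hpos p hp.1.2).ne'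
  · intro p hp
    by_cases hpm : p.Prime ∧ p % 4 = 3
    · have : ¬ Real.log p ≤ Real.log x := fun hle => hp (by
        rw [Finset.mem_filter, Nat.mem_primesBelow]
        exact ⟨⟨(hmem p hpm.1).mp hle, hpm.1⟩, hpm.2⟩)
      simp [Set.indicator, hf, this]
    · simp [Set.indicator, hpm]

/-- **The companion formula for `C(4,3)`:**
`log x · (∏_{p ≤ x, p ≡ 3 (4)} (1 - 1/p))² → (4/π) e^{-γ} (∏_{p ≡ 1 (4)} (1 - 1/p²))⁻¹`,
the product over all primes `p ≡ 1 (mod 4)` being absolutely convergent. -/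
theorem uchiyama_C43 :
    Multipliable (fun p : {p : ℕ // p.Prime ∧ p % 4 = 1} =>
      1 - 1 / ((p : ℕ) : ℝ) ^ 2) ∧
    Tendsto (fun x : ℝ => Real.log x *
        (∏ p ∈ (Nat.floor x + 1).primesBelow.filter (fun p => p % 4 = 3),
          (1 - 1 / (p : ℝ))) ^ 2)
      atTop (𝓝 ((4 / Real.pi) * Real.exp (-Real.eulerMascheroniConstant) *
        (∏' p : {p : ℕ // p.Prime ∧ p % 4 = 1}, (1 - 1 / ((p : ℕ) : ℝ) ^ 2))⁻¹)) := by
  have hpos : ∀ p : {p : ℕ // p.Prime ∧ p % 4 = 1}, 0 < 1 - 1 / ((p : ℕ) : ℝ) ^ 2 :=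
    fun p => one_sub_inv_sq_pos p.2.1
  refine ⟨Real.multipliable_of_summable_log hpos (summable_log_one_sub_inv_sq 1), ?_⟩
  rw [← Real.rexp_tsum_eq_tprod hpos (summable_log_one_sub_inv_sq 1)]
  have hadd := tsum_log_one_sub_inv_sq_add
  set E₁ := ∑' p : {p : ℕ // p.Prime ∧ p % 4 = 1}, Real.log (1 - 1 / ((p : ℕ) : ℝ) ^ 2)
  set E₃ := ∑' p : {p : ℕ // p.Prime ∧ p % 4 = 3}, Real.log (1 - 1 / ((p : ℕ) : ℝ) ^ 2)
  have hw : ∀ p : {p : ℕ // p.Prime ∧ p % 4 = 3},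
      0 ≤ -2 * Real.log (1 - 1 / ((p : ℕ) : ℝ)) := fun p => by
    have h1 := one_div_le_half p.2.1
    have h2 : (0 : ℝ) ≤ 1 / ((p : ℕ) : ℝ) := by positivity
    have h3 := Real.log_nonpos (x := 1 - 1 / ((p : ℕ) : ℝ)) (by linarith) (by linarith)
    linarith
  have hmertens := tendsto_tsum_sub_harmonic hw (fun p => Real.log_natCast_nonneg _)
    (fun σ hσ => summable_log_mul_exp_primes_three_mod_four hσ)
    tendsto_tsum_log_primes_three_mod_four
  have hlim := ((hmertens.add tendsto_harmonic_floor_sub_log).comp Real.tendsto_log_atTop).neg.rexp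
  have hconst : Real.exp (-(Real.log (2 / Real.pi) - E₃ + Real.eulerMascheroniConstant)) =
      (4 / Real.pi) * Real.exp (-Real.eulerMascheroniConstant) * (Real.exp E₁)⁻¹ := by
    have hE : E₃ = -Real.log (Real.pi ^ 2 / 8) - E₁ := by linarith
    have hpi := Real.pi_pos
    rw [hE, ← Real.exp_neg, show -(Real.log (2 / Real.pi) - (-Real.log (Real.pi ^ 2 / 8) - E₁) +
      Real.eulerMascheroniConstant) = (-Real.log (2 / Real.pi) - Real.log (Real.pi ^ 2 / 8)) +
      -Real.eulerMascheroniConstant + -E₁ by ring, Real.exp_add, Real.exp_add, Real.exp_sub,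
      Real.exp_neg (Real.log _), Real.exp_log (by positivity), Real.exp_log (by positivity)]
    congr 2
    field_simp
    norm_num
  rw [hconst] at hlim
  refine hlim.congr' ?_
  filter_upwards [eventually_gt_atTop 1] with x hx
  have hlog : 0 < Real.log x := Real.log_pos hx
  have hprod : 0 < ∏ p ∈ (Nat.floor x + 1).primesBelow.filter (fun p => p % 4 = 3),
      (1 - 1 / (p : ℝ)) := Finset.prod_pos fun p hp => by
    rw [Finset.mem_filter, Nat.mem_primesBelow] at hp
    linarith [one_div_le_half hp.1.2]
  simp only [Function.comp]
  rw [tsum_log_primes_three_mod_four_le (by linarith)]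
  set B := ∏ p ∈ (Nat.floor x + 1).primesBelow.filter (fun p => p % 4 = 3), (1 - 1 / (p : ℝ))
  rw [show ∀ h : ℝ, -(-2 * Real.log B - h + (h - Real.log (Real.log x))) =
    Real.log (Real.log x) + 2 * Real.log B by intro h; ring, Real.exp_add, Real.exp_log hlog,
    two_mul, Real.exp_add, Real.exp_log hprod, sq]
end

section
/- As x → ∞, (log x) · ( ∏_{p ≤ x, p ≡ 1 (mod 6)} (1 − 1/p) )² tends to (2π√3/3) · e^{−γ} · ∏_{p ≡ 1 (mod 6)} (1 − 1/p²), where the last product over all primes p ≡ 1 (mod 6) is absolutely convergent. Equivalently, Grosswald's formula C(6,1)² = (2π√3/3) e^{−γ} ∏_{p ≡ 1 (mod 6)} (1 − 1/p²) holds. -/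
open Filter Topology Finset

open ArithmeticFunction in
/-- **Mertens' first theorem**, in terms of the von Mangoldt function. -/
lemma abs_sum_vonMangoldt_div_sub_log_le :
    ∃ C : ℝ, ∀ N : ℕ, 0 < N →
      |∑ n ∈ Ioc 0 N, vonMangoldt n / n - Real.log N| ≤ C := by
  refine ⟨Real.log 4 + 4, fun N hN => ?_⟩
  have hN' : (0 : ℝ) < N := by exact_mod_cast hN
  have hlog : Real.log N.factorial = ∑ n ∈ Ioc 0 N, vonMangoldt n * ((N / n : ℕ) : ℝ) := by
    rw [← sum_Ioc_mul_zeta_eq_sum, vonMangoldt_mul_zeta]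
    clear hN hN'
    induction N with
    | zero => simp
    | succ k ih =>
      rw [Nat.factorial_succ, ← insert_Ioc_right_eq_Ioc_add_one (by omega),
        sum_insert (by simp), ← ih]
      push_cast
      rw [Real.log_mul (by positivity) (by positivity)]
      simp
  have hup : Real.log N.factorial ≤ N * Real.log N := by
    rw [← Real.log_pow]
    exact Real.log_le_log (by positivity) (by exact_mod_cast Nat.factorial_le_pow N)
  have hlow : N * Real.log N - N ≤ Real.log N.factorial := by
    have h := Real.log_le_log (by positivity) (Real.pow_div_factorial_le_exp N hN'.le N)
    rw [Real.log_exp, Real.log_div (by positivity) (by positivity), Real.log_pow] at h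
    linarith
  have hle : Real.log N.factorial ≤ N * ∑ n ∈ Ioc 0 N, vonMangoldt n / n := by
    rw [hlog, mul_sum]
    refine sum_le_sum fun n hn => ?_
    calc vonMangoldt n * ((N / n : ℕ) : ℝ) ≤ vonMangoldt n * (N / n) :=
          mul_le_mul_of_nonneg_left Nat.cast_div_le vonMangoldt_nonneg
      _ = N * (vonMangoldt n / n) := by ring
  have hge : N * ∑ n ∈ Ioc 0 N, vonMangoldt n / n - Chebyshev.psi N
      ≤ Real.log N.factorial := by
    rw [hlog, mul_sum, Chebyshev.psi, Nat.floor_natCast, ← sum_sub_distrib]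
    refine sum_le_sum fun n hn => ?_
    have h1 : (N : ℝ) / n - 1 ≤ ((N / n : ℕ) : ℝ) := by
      rw [← Nat.floor_div_eq_div (K := ℝ)]
      exact (Nat.sub_one_lt_floor _).le
    calc N * (vonMangoldt n / n) - vonMangoldt n = vonMangoldt n * (N / n - 1) := by ring
      _ ≤ _ := mul_le_mul_of_nonneg_left h1 vonMangoldt_nonneg
  have hpsi := Chebyshev.psi_le_const_mul_self hN'.le
  have h4 : 0 < Real.log 4 := Real.log_pos (by norm_num)
  rw [abs_le]
  constructor
  · have : (N : ℝ) * (Real.log N - 1) ≤ N * ∑ n ∈ Ioc 0 N, vonMangoldt n / n := by linarith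
    have := le_of_mul_le_mul_left this hN'
    linarith
  · have : (N : ℝ) * ∑ n ∈ Ioc 0 N, vonMangoldt n / n
        ≤ N * (Real.log N + (Real.log 4 + 4)) := by linarith
    have := le_of_mul_le_mul_left this hN'
    linarith

/-- The real-valued nontrivial Dirichlet character modulo `3`, as a function on `ℕ`. -/
noncomputable def chiThree : ℕ →*₀ ℝ where
  toFun n := if n % 3 = 1 then 1 else if n % 3 = 2 then -1 else 0
  map_zero' := by simp
  map_one' := by simp
  map_mul' m n := by
    have hm : m % 3 < 3 := Nat.mod_lt _ (by norm_num)
    have hn : n % 3 < 3 := Nat.mod_lt _ (by norm_num)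
    simp only [Nat.mul_mod m n]
    interval_cases m % 3 <;> interval_cases n % 3 <;> norm_num

lemma chiThree_apply (n : ℕ) :
    chiThree n = if n % 3 = 1 then 1 else if n % 3 = 2 then -1 else 0 := rfl

lemma abs_chiThree_le_one (n : ℕ) : |chiThree n| ≤ 1 := by
  rw [chiThree_apply]; split_ifs <;> simp

lemma sum_range_chiThree (N : ℕ) :
    ∑ m ∈ range N, chiThree m = if N % 3 = 2 then 1 else 0 := by
  induction N with
  | zero => simp
  | succ k ih =>
    rw [sum_range_succ, ih, chiThree_apply]
    have hk : k % 3 < 3 := Nat.mod_lt _ (by norm_num)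
    rw [Nat.add_mod k 1 3]
    interval_cases k % 3 <;> norm_num

/-- Partial sums of `chiThree` against a nonnegative decreasing weight are bounded by the first
weight. -/
lemma abs_sum_Ico_chiThree_mul_le {g : ℕ → ℝ} {M N : ℕ} (hMN : M ≤ N)
    (hg : ∀ n, M ≤ n → g (n + 1) ≤ g n) (hg0 : ∀ n, 0 ≤ g n) :
    |∑ m ∈ Ico M N, chiThree m * g m| ≤ g M := by
  set X : ℕ → ℝ := fun N => ∑ m ∈ range N, chiThree m with hX
  have hX01 : ∀ n, 0 ≤ X n ∧ X n ≤ 1 := fun n => by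
    simp only [hX, sum_range_chiThree]; split_ifs <;> simp
  have key : ∀ N, M ≤ N →
      X N * g N - X M * g M ≤ ∑ m ∈ Ico M N, chiThree m * g m ∧
      ∑ m ∈ Ico M N, chiThree m * g m ≤ X N * g N - X M * g M + g M - g N := by
    intro N hN
    induction N, hN using Nat.le_induction with
    | base => simp
    | succ n hn ih =>
      rw [sum_Ico_succ_top hn]
      have h1 : X (n + 1) = X n + chiThree n := sum_range_succ _ _
      have h2 : chiThree n = X (n + 1) - X n := by rw [h1]; ring
      obtain ⟨h3, h4⟩ := hX01 (n + 1)
      have h5 := hg n hn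
      rw [h2]
      constructor <;> nlinarith [mul_nonneg h3 (sub_nonneg.2 h5),
        mul_nonneg (sub_nonneg.2 h4) (sub_nonneg.2 h5)]
  obtain ⟨h1, h2⟩ := key N hMN
  obtain ⟨h3, h4⟩ := hX01 N
  obtain ⟨h5, h6⟩ := hX01 M
  rw [abs_le]
  constructor <;> nlinarith [mul_nonneg h3 (hg0 N), mul_nonneg h5 (hg0 M),
    mul_nonneg (sub_nonneg.2 h4) (hg0 N), mul_nonneg (sub_nonneg.2 h6) (hg0 M)]

lemma Real.cot_pi_div_three : Real.cot (Real.pi / 3) = 1 / √3 := by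
  rw [Real.cot_eq_cos_div_sin, Real.cos_pi_div_three, Real.sin_pi_div_three]
  field_simp

/-- The value at `1` of the Dirichlet `L`-series of the nontrivial character modulo `3`. -/
lemma hasSum_one_div_sub_one_div_three_mul :
    HasSum (fun k : ℕ => 1 / (3 * k + 1 : ℝ) - 1 / (3 * k + 2)) (Real.pi / (3 * √3)) := by
  have hmem : ((1 / 3 : ℝ) : ℂ) ∈ Complex.integerComplement := by
    rintro ⟨n, hn⟩
    have h1 : ((n : ℝ) : ℂ) = ((1 / 3 : ℝ) : ℂ) := by exact_mod_cast hn
    have h2 : (n : ℝ) = 1 / 3 := by exact_mod_cast h1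
    have h3 : ((3 * n : ℤ) : ℝ) = ((1 : ℤ) : ℝ) := by push_cast; rw [h2]; norm_num
    have h4 : 3 * n = 1 := by exact_mod_cast h3
    omega
  have hcot := cot_series_rep' hmem
  have hsum : Summable fun n : ℕ =>
      1 / (((1 / 3 : ℝ) : ℂ) - (n + 1)) + 1 / (((1 / 3 : ℝ) : ℂ) + (n + 1)) :=
    summable_cotTerm hmem
  have h1 := hsum.hasSum
  rw [← hcot] at h1
  have h2 : HasSum (fun n : ℕ => 1 / ((1 / 3 : ℝ) - (n + 1)) + 1 / ((1 / 3 : ℝ) + (n + 1)))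
      (Real.pi * Real.cot (Real.pi * (1 / 3)) - 1 / (1 / 3)) := by
    rw [← Complex.hasSum_ofReal]
    push_cast at h1 ⊢
    exact h1
  have h3 : HasSum (fun n : ℕ => 1 / (3 * n + 1 : ℝ) - 1 / (3 * n + 4)) 1 := by
    rw [hasSum_iff_tendsto_nat_of_nonneg]
    · have hp : ∀ N : ℕ, ∑ n ∈ range N, (1 / (3 * n + 1 : ℝ) - 1 / (3 * n + 4))
          = 1 - 1 / (3 * N + 1) := by
        intro N
        induction N with
        | zero => simp
        | succ k ih => rw [sum_range_succ, ih]; push_cast; ring_nf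
      simp_rw [hp]
      have : Tendsto (fun N : ℕ => (3 * N + 1 : ℝ)) atTop atTop :=
        tendsto_atTop_add_const_right _ _
          (tendsto_natCast_atTop_atTop.const_mul_atTop (by norm_num))
      simpa using (this.inv_tendsto_atTop).const_sub 1
    · intro n
      rw [sub_nonneg]
      exact one_div_le_one_div_of_le (by positivity) (by linarith)
  convert! (h2.div_const 3).add h3 using 1
  · funext n
    have hn : (n : ℝ) ≥ 0 := n.cast_nonneg
    have ha : (1 / 3 : ℝ) - (n + 1) = -(3 * n + 2) / 3 := by ring
    have hb : (1 / 3 : ℝ) + (n + 1) = (3 * n + 4) / 3 := by ring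
    rw [ha, hb, one_div_div, one_div_div, div_neg]
    ring
  · rw [mul_one_div, Real.cot_pi_div_three]
    field_simp
    ring

lemma sum_range_three_mul_chiThree_mul (g : ℕ → ℝ) (K : ℕ) :
    ∑ m ∈ range (3 * K), chiThree m * g m
      = ∑ k ∈ range K, (g (3 * k + 1) - g (3 * k + 2)) := by
  induction K with
  | zero => simp
  | succ k ih =>
    rw [sum_range_succ, ← ih, show 3 * (k + 1) = 3 * k + 1 + 1 + 1 by ring, sum_range_succ,
      sum_range_succ, sum_range_succ]
    have h0 : chiThree (3 * k) = 0 := by simp [chiThree_apply]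
    have h1 : chiThree (3 * k + 1) = 1 := by simp [chiThree_apply, Nat.add_mod]
    have h2 : chiThree (3 * k + 1 + 1) = -1 := by simp [chiThree_apply, add_assoc, Nat.add_mod]
    rw [h0, h1, h2]
    ring

lemma abs_sum_Ioc_chiThree_div_sub_le (M : ℕ) :
    |∑ m ∈ Ioc 0 M, chiThree m / m - Real.pi / (3 * √3)| ≤ 1 / (M + 1) := by
  have hIoc : ∑ m ∈ Ioc 0 M, chiThree m / m = ∑ m ∈ range (M + 1), chiThree m * (1 / (m : ℝ)) := by
    rw [sum_range_succ', Nat.cast_zero, div_zero, mul_zero, add_zero, range_eq_Ico,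
      sum_Ico_add' (fun m : ℕ => chiThree m * (1 / (m : ℝ))) 0 M 1]
    refine sum_congr ?_ fun m _ => by ring
    ext m; simp; omega
  have hlim : Tendsto (fun K : ℕ => ∑ m ∈ range (3 * K), chiThree m * (1 / (m : ℝ))) atTop
      (𝓝 (Real.pi / (3 * √3))) := by
    have := hasSum_one_div_sub_one_div_three_mul.tendsto_sum_nat
    refine this.congr fun K => ?_
    rw [sum_range_three_mul_chiThree_mul]
    refine sum_congr rfl fun k _ => ?_
    push_cast; ring
  rw [hIoc, abs_sub_comm]
  refine le_of_tendsto ((hlim.sub_const _).abs) ?_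
  filter_upwards [eventually_ge_atTop (M + 1)] with K hK
  have hle : M + 1 ≤ 3 * K := by omega
  rw [← sum_Ico_eq_sub _ hle]
  have := abs_sum_Ico_chiThree_mul_le (g := fun m : ℕ => 1 / (m : ℝ)) hle
    (fun n hn => by
      have : (0 : ℝ) < n := by exact_mod_cast (by omega : 0 < n)
      exact one_div_le_one_div_of_le this (by push_cast; linarith))
    (fun n => by positivity)
  simpa using this

lemma abs_sum_Ioc_chiThree_mul_log_div_le (N : ℕ) :
    |∑ n ∈ Ioc 0 N, chiThree n * (Real.log n / n)| ≤ 2 := by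
  have hIoc : ∑ n ∈ Ioc 0 N, chiThree n * (Real.log n / n)
      = ∑ n ∈ range (N + 1), chiThree n * (Real.log n / n) := by
    rw [sum_range_succ', Nat.cast_zero, div_zero, mul_zero, add_zero, range_eq_Ico,
      sum_Ico_add' (fun m : ℕ => chiThree m * (Real.log m / (m : ℝ))) 0 N 1]
    refine sum_congr ?_ fun m _ => rfl
    ext m; simp; omega
  have hg1 : ∀ n : ℕ, 0 ≤ Real.log n / n ∧ Real.log n / n ≤ 1 := fun n =>
    ⟨div_nonneg (Real.log_natCast_nonneg n) n.cast_nonneg,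
      div_le_one_of_le₀ (Real.log_le_self n.cast_nonneg) n.cast_nonneg⟩
  rw [hIoc]
  rcases le_or_gt 3 (N + 1) with h3 | h3
  · rw [← sum_range_add_sum_Ico _ h3]
    refine (abs_add_le _ _).trans ?_
    have ha := abs_sum_Ico_chiThree_mul_le (g := fun n : ℕ => Real.log n / n) h3
      (fun n hn => by
        have hn' : (3 : ℝ) ≤ n := by exact_mod_cast hn
        have he := Real.exp_one_lt_three
        exact Real.log_div_self_antitoneOn (by simp; linarith) (by simp; linarith)
          (by push_cast; linarith)) (fun n => (hg1 n).1)
    have hb : |∑ n ∈ range 3, chiThree n * (Real.log n / n)| ≤ 1 := by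
      have h2 := hg1 2
      norm_num [sum_range_succ, chiThree_apply] at h2 ⊢
      rw [abs_of_nonneg h2.1]
      exact h2.2
    linarith [(hg1 3).2, show |∑ m ∈ Ico 3 (N + 1), chiThree m * (Real.log m / m)|
      ≤ Real.log (3 : ℕ) / (3 : ℕ) from ha]
  · have : N = 0 ∨ N = 1 := by omega
    rcases this with rfl | rfl <;> simp [sum_range_succ]

open ArithmeticFunction in
/-- The character analogue of Mertens' first theorem. -/
lemma abs_sum_chiThree_mul_vonMangoldt_div_le :
    ∃ C : ℝ, ∀ N : ℕ, 0 < N → |∑ n ∈ Ioc 0 N, chiThree n * vonMangoldt n / n| ≤ C := by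
  set L : ℝ := Real.pi / (3 * √3) with hL
  have hLpos : 0 < L := by positivity
  refine ⟨(2 + (Real.log 4 + 4)) / L, fun N hN => ?_⟩
  have hN' : (0 : ℝ) < N := by exact_mod_cast hN
  let f : ArithmeticFunction ℝ := ⟨fun n => chiThree n * vonMangoldt n / n, by simp⟩
  let g : ArithmeticFunction ℝ := ⟨fun n => chiThree n / n, by simp⟩
  have hfg : ∀ n, (f * g) n = chiThree n * (Real.log n / n) := by
    intro n
    rcases Nat.eq_zero_or_pos n with rfl | hn
    · simp
    rw [mul_apply, ← vonMangoldt_sum, ← Nat.sum_divisorsAntidiagonal (fun i _ => vonMangoldt i),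
      sum_div, mul_sum]
    refine sum_congr rfl fun x hx => ?_
    obtain ⟨hx1, -⟩ := Nat.mem_divisorsAntidiagonal.1 hx
    change chiThree x.1 * vonMangoldt x.1 / x.1 * (chiThree x.2 / x.2) = _
    rw [← hx1, map_mul]
    push_cast
    ring
  have hconv : ∑ n ∈ Ioc 0 N, chiThree n * (Real.log n / n)
      = ∑ n ∈ Ioc 0 N, chiThree n * vonMangoldt n / n * ∑ m ∈ Ioc 0 (N / n), chiThree m / m := by
    have := sum_Ioc_mul_eq_sum_sum f g N
    simp_rw [hfg] at this
    exact this
  have hdiff : |∑ n ∈ Ioc 0 N, chiThree n * (Real.log n / n)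
      - L * ∑ n ∈ Ioc 0 N, chiThree n * vonMangoldt n / n| ≤ Real.log 4 + 4 := by
    rw [hconv, mul_sum, ← sum_sub_distrib]
    refine (abs_sum_le_sum_abs _ _).trans ?_
    have hterm : ∀ n ∈ Ioc 0 N, |chiThree n * vonMangoldt n / n *
        ∑ m ∈ Ioc 0 (N / n), chiThree m / m - L * (chiThree n * vonMangoldt n / n)|
        ≤ vonMangoldt n / N := by
      intro n hn
      have hn0 : (0 : ℝ) < n := by exact_mod_cast (mem_Ioc.1 hn).1
      have h1 : ((N : ℝ) / n) ≤ ((N / n : ℕ) : ℝ) + 1 := by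
        rw [← Nat.floor_div_eq_div (K := ℝ)]
        exact (Nat.lt_floor_add_one _).le
      have h2 : 1 / (((N / n : ℕ) : ℝ) + 1) ≤ n / N := by
        rw [← one_div_div (N : ℝ) n]
        exact one_div_le_one_div_of_le (by positivity) h1
      rw [mul_comm L, ← mul_sub, abs_mul, abs_div, abs_mul, abs_of_pos hn0,
        abs_of_nonneg vonMangoldt_nonneg]
      calc |chiThree n| * vonMangoldt n / n * |∑ m ∈ Ioc 0 (N / n), chiThree m / m - L|
          ≤ 1 * vonMangoldt n / n * (n / N) := by
            have hΛ : 0 ≤ vonMangoldt n := vonMangoldt_nonneg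
            exact mul_le_mul (div_le_div_of_nonneg_right
              (mul_le_mul_of_nonneg_right (abs_chiThree_le_one n) hΛ) hn0.le)
              ((abs_sum_Ioc_chiThree_div_sub_le _).trans h2) (abs_nonneg _) (by positivity)
        _ = vonMangoldt n / N := by field_simp
    refine (sum_le_sum hterm).trans ?_
    rw [← sum_div, div_le_iff₀ hN']
    have := Chebyshev.psi_le_const_mul_self hN'.le
    rwa [Chebyshev.psi, Nat.floor_natCast] at this
  have hlog := abs_sum_Ioc_chiThree_mul_log_div_le N
  rw [le_div_iff₀ hLpos, mul_comm, ← abs_of_pos hLpos, ← abs_mul]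
  rw [abs_le] at *
  constructor <;> linarith [hdiff.1, hdiff.2, hlog.1, hlog.2]

lemma Nat.Prime.mod_six_eq_one_iff {p : ℕ} (hp : p.Prime) : p % 6 = 1 ↔ p % 3 = 1 := by
  rcases hp.eq_two_or_odd with rfl | h <;> omega

/-- The weight `2 / p` supported on the primes `p ≡ 1 (mod 6)`. -/
noncomputable def primeWeight (n : ℕ) : ℝ := if n.Prime ∧ n % 6 = 1 then 2 / n else 0

lemma primeWeight_nonneg (n : ℕ) : 0 ≤ primeWeight n := by
  unfold primeWeight; split_ifs <;> positivity

lemma primeWeight_zero : primeWeight 0 = 0 := by simp [primeWeight]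

lemma primeWeight_one : primeWeight 1 = 0 := by simp [primeWeight, Nat.not_prime_one]

open ArithmeticFunction in
/-- **Mertens' first theorem** for the primes congruent to `1` modulo `6`. -/
lemma abs_sum_primeWeight_mul_log_sub_log_le :
    ∃ C : ℝ, ∀ N : ℕ, 0 < N →
      |∑ n ∈ Ioc 0 N, primeWeight n * Real.log n - Real.log N| ≤ C := by
  obtain ⟨C₁, h₁⟩ := abs_sum_vonMangoldt_div_sub_log_le
  obtain ⟨C₂, h₂⟩ := abs_sum_chiThree_mul_vonMangoldt_div_le
  have hsum : Summable fun n : ℕ => (if n.Prime then 0 else vonMangoldt n) / (n : ℝ) := by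
    refine (vonMangoldt.summable_residueClass_non_primes_div (q := 1) 0).congr fun n => ?_
    have : ((n : ZMod 1) = 0) := Subsingleton.elim _ _
    simp [vonMangoldt.residueClass, this]
  let R : ℕ → ℝ := fun n => 2 * ((if n.Prime then 0 else vonMangoldt n) / (n : ℝ))
    + if n = 3 then Real.log 3 / 3 else 0
  have hR : Summable R := (hsum.mul_left 2).add <|
    summable_of_ne_finset_zero (s := {3}) fun n hn => if_neg (by simpa using hn)
  let r : ℕ → ℝ := fun n => vonMangoldt n / n + chiThree n * vonMangoldt n / n
    - primeWeight n * Real.log n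
  have hr : ∀ n, 0 ≤ r n ∧ r n ≤ R n := by
    intro n
    simp only [r, R, primeWeight]
    have hΛ : 0 ≤ vonMangoldt n / (n : ℝ) := div_nonneg vonMangoldt_nonneg n.cast_nonneg
    by_cases hp : n.Prime
    · have hlog : 0 ≤ Real.log n / (n : ℝ) :=
        div_nonneg (Real.log_natCast_nonneg n) n.cast_nonneg
      simp only [hp, hp.mod_six_eq_one_iff, vonMangoldt_apply_prime hp, chiThree_apply, true_and,
        if_true, zero_div, mul_zero, zero_add]
      have h3 : n % 3 < 3 := Nat.mod_lt _ (by norm_num)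
      by_cases h30 : n % 3 = 0
      · have : n = 3 := ((Nat.prime_dvd_prime_iff_eq Nat.prime_three hp).1
          (Nat.dvd_of_mod_eq_zero h30)).symm
        subst this
        norm_num
        positivity
      · have hne : n ≠ 3 := by rintro rfl; simp at h30
        rw [if_neg hne]
        have : n % 3 = 1 ∨ n % 3 = 2 := by omega
        rcases this with h | h
        · simp only [h, if_true]
          have : Real.log n / n + 1 * Real.log n / n - 2 / n * Real.log n = 0 := by ring
          rw [this]; simp
        · simp only [h]
          norm_num
          rw [neg_div, add_neg_cancel]
          simp
    · have hn3 : n ≠ 3 := by rintro rfl; exact hp Nat.prime_three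
      simp only [hp, hn3, false_and, if_false, zero_mul, sub_zero, add_zero]
      have hχ := abs_le.1 (abs_chiThree_le_one n)
      rw [mul_div_assoc]
      constructor <;> nlinarith [hχ.1, hχ.2]
  refine ⟨C₁ + C₂ + ∑' n, R n, fun N hN => ?_⟩
  have hdecomp : ∑ n ∈ Ioc 0 N, primeWeight n * Real.log n
      = ∑ n ∈ Ioc 0 N, vonMangoldt n / n + ∑ n ∈ Ioc 0 N, chiThree n * vonMangoldt n / n
        - ∑ n ∈ Ioc 0 N, r n := by
    rw [← sum_add_distrib, ← sum_sub_distrib]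
    refine sum_congr rfl fun n _ => ?_
    simp only [r]; ring
  have hr0 : 0 ≤ ∑ n ∈ Ioc 0 N, r n := sum_nonneg fun n _ => (hr n).1
  have hr1 : ∑ n ∈ Ioc 0 N, r n ≤ ∑' n, R n :=
    (sum_le_sum fun n _ => (hr n).2).trans
      (hR.sum_le_tsum _ fun n _ => (hr n).1.trans (hr n).2)
  have h3 := abs_le.1 (h₁ N hN)
  have h4 := abs_le.1 (h₂ N hN)
  rw [hdecomp, abs_le]
  constructor <;> linarith [h3.1, h3.2, h4.1, h4.2]

/-- The integer part of `exp k`. -/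
noncomputable def expFloor (k : ℕ) : ℕ := ⌊Real.exp k⌋₊

lemma expFloor_mono : Monotone expFloor := fun _ _ h =>
  Nat.floor_mono (Real.exp_le_exp.2 (by exact_mod_cast h))

lemma expFloor_zero : expFloor 0 = 1 := by simp [expFloor]

lemma le_expFloor (k : ℕ) : k ≤ expFloor k :=
  Nat.le_floor (by linarith [Real.add_one_le_exp (k : ℝ)])

lemma log_mem_of_mem_Ico_expFloor {k n : ℕ}
    (hn : n ∈ Ico (expFloor k + 1) (expFloor (k + 1) + 1)) :
    (k : ℝ) < Real.log n ∧ Real.log n ≤ k + 1 := by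
  obtain ⟨h1, h2⟩ := mem_Ico.1 hn
  have hn0 : (0 : ℝ) < n := by exact_mod_cast (by omega : 0 < n)
  constructor
  · rw [Real.lt_log_iff_exp_lt hn0]
    exact (Nat.floor_lt (Real.exp_pos _).le).1 (by simpa [expFloor] using h1)
  · rw [Real.log_le_iff_le_exp hn0]
    have := (Nat.le_floor_iff (Real.exp_pos _).le).1
      (show n ≤ ⌊Real.exp ((k + 1 : ℕ) : ℝ)⌋₊ from Nat.lt_succ_iff.1 h2)
    simpa using this

lemma abs_log_expFloor_sub_le (k : ℕ) : |Real.log (expFloor k) - k| ≤ 1 := by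
  have h1 : (1 : ℝ) ≤ expFloor k := by
    exact_mod_cast (by simpa [expFloor_zero] using expFloor_mono (Nat.zero_le k))
  have h2 : (expFloor k : ℝ) ≤ Real.exp k := Nat.floor_le (Real.exp_pos _).le
  have h3 : Real.exp k < expFloor k + 1 := Nat.lt_floor_add_one _
  have hup : Real.log (expFloor k) ≤ k := (Real.log_le_iff_le_exp (by linarith)).2 h2
  have hlow : (k : ℝ) - 1 ≤ Real.log (expFloor k) := by
    rw [Real.le_log_iff_exp_le (by linarith), Real.exp_sub, div_le_iff₀ (Real.exp_pos _)]
    nlinarith [Real.add_one_le_exp (1 : ℝ)]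
  rw [abs_le]; constructor <;> linarith

/-- The sum of `w` over the integers in the block `(exp k, exp (k + 1)]`. -/
noncomputable def blockSum (w : ℕ → ℝ) (k : ℕ) : ℝ :=
  ∑ n ∈ Ico (expFloor k + 1) (expFloor (k + 1) + 1), w n

lemma sum_range_blockSum {w : ℕ → ℝ} (h0 : w 0 = 0) (h1 : w 1 = 0) (K : ℕ) :
    ∑ k ∈ range K, blockSum w k = ∑ n ∈ range (expFloor K + 1), w n := by
  induction K with
  | zero => simp [expFloor_zero, sum_range_succ, h0, h1]
  | succ k ih =>
    rw [sum_range_succ, ih, blockSum,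
      sum_range_add_sum_Ico _ (Nat.succ_le_succ (expFloor_mono k.le_succ))]

lemma blockSum_nonneg {w : ℕ → ℝ} (hw : ∀ n, 0 ≤ w n) (k : ℕ) : 0 ≤ blockSum w k :=
  sum_nonneg fun n _ => hw n

lemma blockSum_mul_log_bounds {w : ℕ → ℝ} (hw : ∀ n, 0 ≤ w n) (k : ℕ) :
    k * blockSum w k ≤ blockSum (fun n => w n * Real.log n) k ∧
    blockSum (fun n => w n * Real.log n) k ≤ (k + 1) * blockSum w k := by
  simp only [blockSum, mul_sum]
  constructor <;> refine sum_le_sum fun n hn => ?_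
  · rw [mul_comm]
    exact mul_le_mul_of_nonneg_left (log_mem_of_mem_Ico_expFloor hn).1.le (hw n)
  · rw [mul_comm]
    exact mul_le_mul_of_nonneg_right (log_mem_of_mem_Ico_expFloor hn).2 (hw n)

section Tauberian

variable {w : ℕ → ℝ}

/-- If `∑_{n ≤ N} w n * log n = log N + O(1)`, then the block sums of `w` are `O(1 / k)` and their
partial sums differ from the harmonic numbers by a convergent sequence. -/
lemma exists_tendsto_sum_blockSum_sub_harmonic (hw : ∀ n, 0 ≤ w n)
    {C : ℝ} (hC : ∀ N : ℕ, 0 < N →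
      |∑ n ∈ range (N + 1), w n * Real.log n - Real.log N| ≤ C) :
    (∃ B : ℝ, ∀ k, blockSum w k ≤ B / (k + 1)) ∧
    ∃ l : ℝ, Tendsto (fun K : ℕ => ∑ k ∈ range K, (blockSum w k - 1 / ((k : ℝ) + 1)))
      atTop (𝓝 l) := by
  set s : ℕ → ℝ := blockSum (fun n => w n * Real.log n) with hs
  have hS : ∀ K : ℕ, |∑ k ∈ range K, (s k - 1)| ≤ C + 1 := by
    intro K
    rw [sum_sub_distrib, hs, sum_range_blockSum (by simp) (by simp)]
    have hpos : 0 < expFloor K := by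
      have := expFloor_mono (Nat.zero_le K)
      rw [expFloor_zero] at this; omega
    have ha := abs_le.1 (hC (expFloor K) hpos)
    have hb := abs_le.1 (abs_log_expFloor_sub_le K)
    simp only [sum_const, card_range, nsmul_eq_mul, mul_one]
    rw [abs_le]
    constructor <;> linarith [ha.1, ha.2, hb.1, hb.2]
  have hs_le : ∀ k, s k ≤ 2 * C + 3 := by
    intro k
    have ha := abs_le.1 (hS (k + 1))
    have hb := abs_le.1 (hS k)
    rw [sum_range_succ] at ha
    linarith [ha.1, ha.2, hb.1, hb.2]
  have hC0 : 0 ≤ C := (abs_nonneg _).trans (hC 1 one_pos)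
  have hu0 := blockSum_nonneg hw
  have hB : ∀ k, blockSum w k ≤ (2 * (2 * C + 3) + blockSum w 0) / (k + 1) := by
    intro k
    rw [le_div_iff₀ (by positivity)]
    rcases Nat.eq_zero_or_pos k with rfl | hk
    · simp; linarith
    · have hk1 : (1 : ℝ) ≤ k := by exact_mod_cast hk
      have ha := (blockSum_mul_log_bounds hw k).1
      have hb := hs_le k
      nlinarith [hu0 k, hu0 0]
  set B : ℝ := 2 * (2 * C + 3) + blockSum w 0 with hBdef
  refine ⟨⟨B, hB⟩, ?_⟩
  have hdiff : ∀ k : ℕ, 0 ≤ blockSum w k - s k / (k + 1) ∧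
      blockSum w k - s k / (k + 1) ≤ B * (1 / ((k : ℝ) + 1) ^ 2) := by
    intro k
    obtain ⟨ha, hb⟩ := blockSum_mul_log_bounds hw k
    have hk : (0 : ℝ) < k + 1 := by positivity
    constructor
    · rw [sub_nonneg, div_le_iff₀ hk, mul_comm]; exact hb
    · have : blockSum w k - s k / (k + 1) ≤ blockSum w k / (k + 1) := by
        rw [sub_le_iff_le_add, ← add_div, le_div_iff₀ hk]
        linarith
      refine this.trans ?_
      rw [div_le_iff₀ hk]
      refine (hB k).trans (le_of_eq ?_)
      field_simp
  have hsummable : Summable fun k : ℕ => blockSum w k - s k / (k + 1) := by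
    refine Summable.of_nonneg_of_le (fun k => (hdiff k).1) (fun k => (hdiff k).2) ?_
    refine Summable.mul_left _ ?_
    have := (summable_nat_add_iff 1).2 (Real.summable_one_div_nat_pow.2 one_lt_two)
    simpa using this
  have hanti : Antitone fun k : ℕ => 1 / ((k : ℝ) + 1) := fun a b hab =>
    one_div_le_one_div_of_le (by positivity) (by
      have : (a : ℝ) ≤ b := by exact_mod_cast hab
      linarith)
  obtain ⟨l, hl⟩ := cauchySeq_tendsto_of_complete
    (hanti.cauchySeq_series_mul_of_tendsto_zero_of_bounded
      tendsto_one_div_add_atTop_nhds_zero_nat (z := fun k => s k - 1) (b := C + 1) hS)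
  refine ⟨_, (hsummable.hasSum.tendsto_sum_nat.add hl).congr fun K => ?_⟩
  rw [← sum_add_distrib]
  refine sum_congr rfl fun k _ => ?_
  simp only [smul_eq_mul]
  ring

lemma tendsto_sum_floor_sub_log_log (hw : ∀ n, 0 ≤ w n) (h0 : w 0 = 0) (h1 : w 1 = 0)
    {l : ℝ} (hl : Tendsto (fun K : ℕ => ∑ k ∈ range K, (blockSum w k - 1 / ((k : ℝ) + 1)))
      atTop (𝓝 l)) :
    Tendsto (fun x : ℝ => ∑ n ∈ range (⌊x⌋₊ + 1), w n - Real.log (Real.log x)) atTop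
      (𝓝 (l + Real.eulerMascheroniConstant)) := by
  set W : ℕ → ℝ := fun K => ∑ n ∈ range (expFloor K + 1), w n with hW
  have hWlog : Tendsto (fun K : ℕ => W K - Real.log K) atTop
      (𝓝 (l + Real.eulerMascheroniConstant)) := by
    refine (hl.add Real.tendsto_harmonic_sub_log).congr fun K => ?_
    rw [sum_sub_distrib, sum_range_blockSum h0 h1, harmonic]
    push_cast
    simp only [one_div]
    ring
  have hlog : Tendsto (fun K : ℕ => Real.log ((K : ℝ) + 1) - Real.log K) atTop (𝓝 0) :=
    (Real.tendsto_log_comp_add_sub_log 1).comp tendsto_natCast_atTop_atTop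
  have hlow : Tendsto (fun K : ℕ => W K - Real.log ((K : ℝ) + 1)) atTop
      (𝓝 (l + Real.eulerMascheroniConstant)) := by
    simpa using (hWlog.sub hlog).congr fun K => by ring
  have hup : Tendsto (fun K : ℕ => W (K + 1) - Real.log K) atTop
      (𝓝 (l + Real.eulerMascheroniConstant)) := by
    have h := ((tendsto_add_atTop_iff_nat 1).2 hWlog).add hlog
    rw [add_zero] at h
    refine h.congr fun K => ?_
    push_cast; ring
  have hfloor : Tendsto (fun x : ℝ => ⌊Real.log x⌋₊) atTop atTop :=
    tendsto_nat_floor_atTop.comp Real.tendsto_log_atTop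
  refine tendsto_of_tendsto_of_tendsto_of_le_of_le' (hlow.comp hfloor) (hup.comp hfloor) ?_ ?_
  all_goals
    filter_upwards [eventually_ge_atTop (Real.exp 1)] with x hx
    have hx0 : 0 < x := (Real.exp_pos 1).trans_le hx
    have hlx : 1 ≤ Real.log x := (Real.le_log_iff_exp_le hx0).2 hx
    have hK1 : 1 ≤ ⌊Real.log x⌋₊ := Nat.le_floor (by simpa using hlx)
    have hKle : (⌊Real.log x⌋₊ : ℝ) ≤ Real.log x := Nat.floor_le (by linarith)
    have hKlt : Real.log x < ⌊Real.log x⌋₊ + 1 := Nat.lt_floor_add_one _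
    simp only [Function.comp]
  · have h2 : expFloor ⌊Real.log x⌋₊ ≤ ⌊x⌋₊ :=
      Nat.floor_mono ((Real.le_log_iff_exp_le hx0).1 hKle)
    have h3 : W ⌊Real.log x⌋₊ ≤ ∑ n ∈ range (⌊x⌋₊ + 1), w n :=
      sum_le_sum_of_subset_of_nonneg (range_mono (Nat.succ_le_succ h2)) fun n _ _ => hw n
    have h4 := Real.log_le_log (by linarith) hKlt.le
    linarith
  · have h2 : ⌊x⌋₊ ≤ expFloor (⌊Real.log x⌋₊ + 1) :=
      Nat.floor_mono (by
        rw [← Real.log_le_iff_le_exp hx0]; push_cast; exact hKlt.le)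
    have h3 : ∑ n ∈ range (⌊x⌋₊ + 1), w n ≤ W (⌊Real.log x⌋₊ + 1) :=
      sum_le_sum_of_subset_of_nonneg (range_mono (Nat.succ_le_succ h2)) fun n _ _ => hw n
    have h4 := Real.log_le_log (by exact_mod_cast hK1) hKle
    linarith

/-- The Dirichlet series of `w` is comparable to the power series of its block sums. -/
lemma summable_and_tsum_rpow_bounds (hw : ∀ n, 0 ≤ w n) (h0 : w 0 = 0) (h1 : w 1 = 0)
    {B : ℝ} (hB : ∀ k, blockSum w k ≤ B / (k + 1)) {δ : ℝ} (hδ : 0 < δ) :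
    Summable (fun k => blockSum w k * Real.exp (-δ) ^ k) ∧
    Summable (fun n : ℕ => w n * (n : ℝ) ^ (-δ)) ∧
    Real.exp (-δ) * ∑' k, blockSum w k * Real.exp (-δ) ^ k ≤ ∑' n : ℕ, w n * (n : ℝ) ^ (-δ) ∧
    ∑' n : ℕ, w n * (n : ℝ) ^ (-δ) ≤ ∑' k, blockSum w k * Real.exp (-δ) ^ k := by
  set z := Real.exp (-δ) with hz
  have hz0 : 0 < z := Real.exp_pos _
  have hz1 : z < 1 := Real.exp_lt_one_iff.2 (by linarith)
  have hu0 := blockSum_nonneg hw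
  have hB0 : 0 ≤ B := by simpa using (hu0 0).trans (hB 0)
  have hsu : Summable (fun k => blockSum w k * z ^ k) := by
    refine Summable.of_nonneg_of_le (fun k => mul_nonneg (hu0 k) (by positivity)) (fun k => ?_)
      ((summable_geometric_of_lt_one hz0.le hz1).mul_left B)
    refine mul_le_mul_of_nonneg_right ((hB k).trans ?_) (by positivity)
    exact div_le_self hB0 (by linarith [(k.cast_nonneg : (0 : ℝ) ≤ k)])
  set v : ℕ → ℝ := fun n => w n * (n : ℝ) ^ (-δ) with hv
  have hv0 : ∀ n, 0 ≤ v n := fun n => mul_nonneg (hw n) (by positivity)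
  have hblock : ∀ k, z * (blockSum w k * z ^ k) ≤ blockSum v k ∧
      blockSum v k ≤ blockSum w k * z ^ k := by
    intro k
    have hterm : ∀ n ∈ Ico (expFloor k + 1) (expFloor (k + 1) + 1),
        z ^ (k + 1) ≤ (n : ℝ) ^ (-δ) ∧ (n : ℝ) ^ (-δ) ≤ z ^ k := by
      intro n hn
      have hn0 : (0 : ℝ) < n := by
        have := (mem_Ico.1 hn).1
        exact_mod_cast (by omega : 0 < n)
      obtain ⟨ha, hb⟩ := log_mem_of_mem_Ico_expFloor hn
      rw [Real.rpow_def_of_pos hn0, hz, ← Real.exp_nat_mul, ← Real.exp_nat_mul,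
        Real.exp_le_exp, Real.exp_le_exp]
      push_cast
      constructor <;> nlinarith
    simp only [blockSum, sum_mul, mul_sum, hv]
    constructor <;> refine sum_le_sum fun n hn => ?_
    · calc z * (w n * z ^ k) = w n * z ^ (k + 1) := by ring
        _ ≤ _ := mul_le_mul_of_nonneg_left (hterm n hn).1 (hw n)
    · exact mul_le_mul_of_nonneg_left (hterm n hn).2 (hw n)
  have hpart : ∀ K, ∑ k ∈ range K, blockSum v k = ∑ n ∈ range (expFloor K + 1), v n :=
    sum_range_blockSum (by simp [hv, h0]) (by simp [hv, h1])
  have hpart_le : ∀ K, ∑ n ∈ range (expFloor K + 1), v n ≤ ∑' k, blockSum w k * z ^ k := by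
    intro K
    rw [← hpart]
    exact (sum_le_sum fun k _ => (hblock k).2).trans
      (hsu.sum_le_tsum _ fun k _ => mul_nonneg (hu0 k) (by positivity))
  have hsv : Summable v := by
    refine summable_of_sum_range_le hv0 fun n => le_trans ?_ (hpart_le n)
    exact sum_le_sum_of_subset_of_nonneg
      (range_mono ((le_expFloor n).trans (Nat.le_succ _))) fun n _ _ => hv0 n
  have htop : Tendsto (fun K => expFloor K + 1) atTop atTop :=
    tendsto_atTop_mono (fun K => (le_expFloor K).trans (Nat.le_succ _)) tendsto_id
  have hlim := hsv.hasSum.tendsto_sum_nat.comp htop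
  refine ⟨hsu, hsv, ?_, le_of_tendsto' hlim hpart_le⟩
  refine le_of_tendsto_of_tendsto' ((hsu.hasSum.tendsto_sum_nat).const_mul z) hlim fun K => ?_
  simp only [Function.comp]
  rw [← hpart, mul_sum]
  exact sum_le_sum fun k _ => (hblock k).1

lemma tendsto_tsum_rpow_add_log (hw : ∀ n, 0 ≤ w n) (h0 : w 0 = 0) (h1 : w 1 = 0)
    {B : ℝ} (hB : ∀ k, blockSum w k ≤ B / (k + 1))
    {l : ℝ} (hl : Tendsto (fun K : ℕ => ∑ k ∈ range K, (blockSum w k - 1 / ((k : ℝ) + 1)))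
      atTop (𝓝 l)) :
    Tendsto (fun δ : ℝ => ∑' n : ℕ, w n * (n : ℝ) ^ (-δ) + Real.log δ) (𝓝[>] 0) (𝓝 l) := by
  set z : ℝ → ℝ := fun δ => Real.exp (-δ) with hz
  set A : ℝ → ℝ := fun y => ∑' k : ℕ, (blockSum w k - 1 / ((k : ℝ) + 1)) * y ^ k with hA
  set H : ℝ → ℝ := fun δ => ∑' k, blockSum w k * z δ ^ k with hH
  have hzlim : Tendsto z (𝓝[>] 0) (𝓝 1) := by
    have : Continuous z := by fun_prop
    simpa [hz] using (this.tendsto 0).mono_left (nhdsWithin_le_nhds (s := Set.Ioi 0))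
  have hzlim' : Tendsto z (𝓝[>] 0) (𝓝[<] 1) := by
    refine tendsto_nhdsWithin_iff.2 ⟨hzlim, ?_⟩
    filter_upwards [self_mem_nhdsWithin] with δ hδ
    exact Real.exp_lt_one_iff.2 (by simpa using hδ)
  have hAlim : Tendsto (fun δ => A (z δ)) (𝓝[>] 0) (𝓝 l) :=
    (Real.tendsto_tsum_powerSeries_nhdsWithin_lt hl).comp hzlim'
  have hzH : ∀ δ : ℝ, 0 < δ → z δ * H δ = -Real.log (1 - z δ) + z δ * A (z δ) := by
    intro δ hδ
    have hz0 : 0 < z δ := Real.exp_pos _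
    have hz1 : z δ < 1 := Real.exp_lt_one_iff.2 (by linarith)
    have hlogsum := Real.hasSum_pow_div_log_of_abs_lt_one (abs_lt.2 ⟨by linarith, hz1⟩)
    have hsu := (summable_and_tsum_rpow_bounds hw h0 h1 hB hδ).1
    have hs1 : HasSum (fun k : ℕ => z δ * (1 / ((k : ℝ) + 1) * z δ ^ k))
        (-Real.log (1 - z δ)) := by
      refine hlogsum.congr_fun fun k => ?_
      ring
    have hs2 : Summable (fun k : ℕ => 1 / ((k : ℝ) + 1) * z δ ^ k) :=
      (summable_mul_left_iff hz0.ne').1 hs1.summable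
    have : A (z δ) = H δ - ∑' k : ℕ, 1 / ((k : ℝ) + 1) * z δ ^ k := by
      rw [hA, hH, ← hsu.tsum_sub hs2]
      simp only [sub_mul]; rfl
    rw [this, mul_sub, ← tsum_mul_left (f := fun k : ℕ => 1 / ((k : ℝ) + 1) * z δ ^ k), hs1.tsum_eq]
    ring
  have hone : Tendsto (fun δ : ℝ => (1 - z δ) / δ) (𝓝[>] 0) (𝓝 1) := by
    have hd : HasDerivAt (fun δ : ℝ => 1 - Real.exp (-δ)) 1 0 := by
      have := ((hasDerivAt_neg (0 : ℝ)).exp).const_sub 1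
      simpa using this
    have := (hasDerivAt_iff_tendsto_slope.1 hd).mono_left
      (nhdsWithin_mono 0 (fun x (hx : x ∈ Set.Ioi (0 : ℝ)) => ne_of_gt hx))
    refine this.congr fun δ => ?_
    simp [slope_def_field, hz]
  have hlow : Tendsto (fun δ : ℝ => z δ * H δ + Real.log δ) (𝓝[>] 0) (𝓝 l) := by
    have hlog := (hone.log one_ne_zero).neg.add (hzlim.mul hAlim)
    rw [Real.log_one, neg_zero, zero_add, one_mul] at hlog
    refine hlog.congr' ?_
    filter_upwards [self_mem_nhdsWithin] with δ hδ
    have hδ' : (0 : ℝ) < δ := hδ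
    have hz1 : z δ < 1 := Real.exp_lt_one_iff.2 (by linarith)
    rw [hzH δ hδ', Real.log_div (by linarith) hδ'.ne']
    ring
  have hgap : Tendsto (fun δ : ℝ => (1 - z δ) * H δ) (𝓝[>] 0) (𝓝 0) := by
    have h1z : Tendsto (fun δ : ℝ => 1 - z δ) (𝓝[>] 0) (𝓝 0) := by
      simpa using hzlim.const_sub 1
    have hmul : Tendsto (fun δ : ℝ => (1 - z δ) * Real.log (1 - z δ)) (𝓝[>] 0) (𝓝 0) := by
      simpa [Function.comp_def] using (Real.continuous_mul_log.tendsto 0).comp h1z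
    have := (hmul.neg.div hzlim one_ne_zero).add (h1z.mul hAlim)
    simp only [neg_zero, zero_div, zero_mul, add_zero] at this
    refine this.congr' ?_
    filter_upwards [self_mem_nhdsWithin] with δ hδ
    have hz0 : 0 < z δ := Real.exp_pos _
    have hH' : H δ = (-Real.log (1 - z δ) + z δ * A (z δ)) / z δ := by
      rw [← hzH δ hδ]; field_simp
    simp only [Pi.div_apply, hH']
    field_simp
  have hup : Tendsto (fun δ : ℝ => H δ + Real.log δ) (𝓝[>] 0) (𝓝 l) := by
    have := hlow.add hgap
    rw [add_zero] at this
    exact this.congr fun δ => by ring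
  refine tendsto_of_tendsto_of_tendsto_of_le_of_le' hlow hup ?_ ?_ <;>
    filter_upwards [self_mem_nhdsWithin] with δ hδ
  · have := (summable_and_tsum_rpow_bounds hw h0 h1 hB hδ).2.2.1
    simp only [hH, hz]; linarith
  · have := (summable_and_tsum_rpow_bounds hw h0 h1 hB hδ).2.2.2
    simp only [hH, hz]; linarith

end Tauberian

/-- The function `n ↦ n ^ (-s)` as a completely multiplicative function. -/
noncomputable def negRpowHom (s : ℝ) (hs : s ≠ 0) : ℕ →*₀ ℝ where
  toFun n := (n : ℝ) ^ (-s)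
  map_zero' := by simp [Real.zero_rpow (neg_ne_zero.2 hs)]
  map_one' := by simp
  map_mul' m n := by
    push_cast
    exact Real.mul_rpow m.cast_nonneg n.cast_nonneg

lemma summable_natCast_rpow_neg {s : ℝ} (hs : 1 < s) : Summable fun n : ℕ => (n : ℝ) ^ (-s) :=
  Real.summable_nat_rpow.2 (by linarith)

lemma summable_chiThree_mul_rpow_neg {s : ℝ} (hs : 1 < s) :
    Summable fun n : ℕ => ‖chiThree n * (n : ℝ) ^ (-s)‖ := by
  refine Summable.of_nonneg_of_le (fun n => norm_nonneg _) (fun n => ?_)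
    (summable_natCast_rpow_neg hs)
  rw [norm_mul, Real.norm_of_nonneg (by positivity : (0 : ℝ) ≤ (n : ℝ) ^ (-s))]
  exact mul_le_of_le_one_left (by positivity) (abs_chiThree_le_one n)

lemma hasProd_primes_one_sub_rpow_neg {s : ℝ} (hs : 1 < s) :
    HasProd (fun p : Nat.Primes => (1 - (p : ℝ) ^ (-s))⁻¹) (∑' n : ℕ, (n : ℝ) ^ (-s)) := by
  have hs0 : s ≠ 0 := by linarith
  refine EulerProduct.eulerProduct_completely_multiplicative_hasProd (f := negRpowHom s hs0) ?_
  exact (summable_natCast_rpow_neg hs).norm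

lemma hasProd_primes_one_sub_chiThree_mul_rpow_neg {s : ℝ} (hs : 1 < s) :
    HasProd (fun p : Nat.Primes => (1 - chiThree p * (p : ℝ) ^ (-s))⁻¹)
      (∑' n : ℕ, chiThree n * (n : ℝ) ^ (-s)) := by
  have hs0 : s ≠ 0 := by linarith
  exact EulerProduct.eulerProduct_completely_multiplicative_hasProd
    (f := chiThree * negRpowHom s hs0) (summable_chiThree_mul_rpow_neg hs)

/-- For a prime `n ≡ 1 (mod 6)`, the error in `log ((1 + n ^ (-s)) / (1 - n ^ (-s))) ≈ 2 n ^ (-s)`;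
zero otherwise. -/
noncomputable def logError (s : ℝ) (n : ℕ) : ℝ :=
  if n.Prime ∧ n % 6 = 1 then
    Real.log (1 + (n : ℝ) ^ (-s)) - Real.log (1 - (n : ℝ) ^ (-s)) - 2 * (n : ℝ) ^ (-s)
  else 0

lemma rpow_neg_le_inv {n : ℕ} (hn : 1 ≤ n) {s : ℝ} (hs : 1 ≤ s) : (n : ℝ) ^ (-s) ≤ 1 / n := by
  have h1 : (1 : ℝ) ≤ n := by exact_mod_cast hn
  rw [one_div, ← Real.rpow_neg_one]
  exact Real.rpow_le_rpow_of_exponent_le h1 (by linarith)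

lemma rpow_neg_mem_of_two_le {n : ℕ} (hn : 2 ≤ n) {s : ℝ} (hs : 1 ≤ s) :
    0 < (n : ℝ) ^ (-s) ∧ (n : ℝ) ^ (-s) ≤ 1 / 2 := by
  have h2 : (2 : ℝ) ≤ n := by exact_mod_cast hn
  exact ⟨by positivity, (rpow_neg_le_inv (by omega) hs).trans
    (one_div_le_one_div_of_le (by norm_num) h2)⟩

lemma abs_logError_le {s : ℝ} (hs : 1 ≤ s) (n : ℕ) : |logError s n| ≤ 4 * (1 / (n : ℝ) ^ 2) := by
  unfold logError
  split_ifs with h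
  · obtain ⟨hy0, hy2⟩ := rpow_neg_mem_of_two_le h.1.two_le hs
    have hyn := rpow_neg_le_inv h.1.one_le hs
    set y := (n : ℝ) ^ (-s)
    have hbound : y ^ 2 / (1 - y) ≤ 2 * y ^ 2 := by
      rw [div_le_iff₀ (by linarith)]; nlinarith [sq_nonneg y]
    have ha := Real.abs_log_sub_add_sum_range_le (x := y)
      (by rw [abs_of_pos hy0]; linarith) 1
    have hb := Real.abs_log_sub_add_sum_range_le (x := -y)
      (by rw [abs_neg, abs_of_pos hy0]; linarith) 1
    simp only [sum_range_one, zero_add, pow_one, Nat.cast_zero, div_one, one_add_one_eq_two,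
      abs_neg, abs_of_pos hy0, sub_neg_eq_add] at ha hb
    have hsq : y ^ 2 ≤ 1 / (n : ℝ) ^ 2 := by
      rw [← one_div_pow]; exact pow_le_pow_left₀ hy0.le hyn 2
    have ha' := abs_le.1 (ha.trans hbound)
    have hb' := abs_le.1 (hb.trans hbound)
    rw [abs_le]
    constructor <;> linarith [ha'.1, ha'.2, hb'.1, hb'.2]
  · rw [abs_zero]; positivity

lemma summable_logError_bound : Summable fun n : ℕ => 4 * (1 / (n : ℝ) ^ 2) :=
  (Real.summable_one_div_nat_pow.2 one_lt_two).mul_left 4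

lemma summable_logError {s : ℝ} (hs : 1 ≤ s) : Summable (logError s) :=
  Summable.of_norm_bounded summable_logError_bound (abs_logError_le hs)

lemma tendsto_tsum_logError :
    Tendsto (fun s : ℝ => ∑' n, logError s n) (𝓝[>] 1) (𝓝 (∑' n, logError 1 n)) := by
  refine tendsto_tsum_of_dominated_convergence summable_logError_bound (fun n => ?_) ?_
  · unfold logError
    split_ifs with h
    · obtain ⟨hy0, hy2⟩ := rpow_neg_mem_of_two_le h.1.two_le le_rfl
      have hn : (n : ℝ) ≠ 0 := by exact_mod_cast h.1.ne_zero
      have hy : Tendsto (fun s : ℝ => (n : ℝ) ^ (-s)) (𝓝[>] 1) (𝓝 ((n : ℝ) ^ (-1 : ℝ))) :=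
        (((Real.continuous_const_rpow hn).comp continuous_neg).tendsto 1).mono_left
          nhdsWithin_le_nhds
      exact (((hy.const_add 1).log (by linarith)).sub ((hy.const_sub 1).log (by linarith))).sub
        (hy.const_mul 2)
    · exact tendsto_const_nhds
  · filter_upwards [self_mem_nhdsWithin] with s hs n
    exact abs_logError_le (le_of_lt hs) n

lemma tendsto_tsum_rpow_neg_two_mul :
    Tendsto (fun s : ℝ => ∑' n : ℕ, (n : ℝ) ^ (-(2 * s))) (𝓝[>] 1) (𝓝 (Real.pi ^ 2 / 6)) := by
  rw [← hasSum_zeta_two.tsum_eq]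
  refine tendsto_tsum_of_dominated_convergence
    (Real.summable_one_div_nat_pow.2 one_lt_two) (fun n => ?_) ?_
  · rcases Nat.eq_zero_or_pos n with rfl | hn
    · refine tendsto_const_nhds.congr' ?_
      filter_upwards [self_mem_nhdsWithin] with s hs
      have hs' : (1 : ℝ) < s := hs
      rw [Nat.cast_zero, Real.zero_rpow (by linarith)]
      norm_num
    · have hn0 : (n : ℝ) ≠ 0 := by exact_mod_cast hn.ne'
      have h1 : Continuous fun s : ℝ => (n : ℝ) ^ (-(2 * s)) :=
        (Real.continuous_const_rpow hn0).comp (by fun_prop)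
      have h2 : 1 / (n : ℝ) ^ 2 = (n : ℝ) ^ (-(2 * (1 : ℝ))) := by
        rw [mul_one, Real.rpow_neg n.cast_nonneg, one_div]; norm_cast
      rw [h2]
      exact (h1.tendsto 1).mono_left nhdsWithin_le_nhds
  · filter_upwards [self_mem_nhdsWithin] with s hs n
    have hs' : (1 : ℝ) < s := hs
    rw [Real.norm_of_nonneg (by positivity)]
    rcases Nat.eq_zero_or_pos n with rfl | hn
    · rw [Nat.cast_zero, Real.zero_rpow (by linarith)]
      norm_num
    · rw [show -(2 * s) = -s * (2 : ℕ) by push_cast; ring, Real.rpow_mul_natCast n.cast_nonneg,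
        ← one_div_pow]
      exact pow_le_pow_left₀ (by positivity) (rpow_neg_le_inv hn hs'.le) 2

lemma rpow_neg_sub_rpow_neg_add_one_bounds {a s : ℝ} (ha : 1 ≤ a) (hs1 : 1 ≤ s) (hs2 : s ≤ 2) :
    0 ≤ a ^ (-s) - (a + 1) ^ (-s) ∧ a ^ (-s) - (a + 1) ^ (-s) ≤ 2 * (1 / a ^ 2) := by
  have ha0 : 0 < a := by linarith
  constructor
  · rw [sub_nonneg]
    exact Real.rpow_le_rpow_of_nonpos ha0 (by linarith) (by linarith)
  · have hr0 : 0 < a / (a + 1) := by positivity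
    have hr1 : a / (a + 1) ≤ 1 := (div_le_one (by linarith)).2 (by linarith)
    have hfac : (a + 1) ^ (-s) = a ^ (-s) * (a / (a + 1)) ^ s := by
      rw [Real.div_rpow ha0.le (by linarith), Real.rpow_neg ha0.le, Real.rpow_neg (by linarith)]
      field_simp
    have hsq : (a / (a + 1)) ^ 2 ≤ (a / (a + 1)) ^ s := by
      rw [← Real.rpow_two]
      exact Real.rpow_le_rpow_of_exponent_ge hr0 hr1 hs2
    have hinv : a ^ (-s) ≤ 1 / a := by
      rw [one_div, ← Real.rpow_neg_one]
      exact Real.rpow_le_rpow_of_exponent_le ha (by linarith)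
    have hpos : 0 < a ^ (-s) := by positivity
    have hone : 1 - (a / (a + 1)) ^ 2 ≤ 2 / a := by
      have : 1 - a / (a + 1) ≤ 1 / a := by
        rw [one_sub_div (by positivity), div_le_div_iff₀ (by positivity) ha0]
        nlinarith
      have : 1 - (a / (a + 1)) ^ 2 = (1 - a / (a + 1)) * (1 + a / (a + 1)) := by ring
      rw [this, show 2 / a = 1 / a * 2 by ring]
      exact mul_le_mul ‹_› (by linarith) (by linarith) (by positivity)
    calc a ^ (-s) - (a + 1) ^ (-s) = a ^ (-s) * (1 - (a / (a + 1)) ^ s) := by rw [hfac]; ring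
      _ ≤ 1 / a * (2 / a) := by
        refine mul_le_mul hinv (by linarith) ?_ (by positivity)
        rw [sub_nonneg]
        exact Real.rpow_le_one hr0.le hr1 (by linarith)
      _ = 2 * (1 / a ^ 2) := by ring

lemma tendsto_tsum_chiThree_mul_rpow_neg :
    Tendsto (fun s : ℝ => ∑' n : ℕ, chiThree n * (n : ℝ) ^ (-s)) (𝓝[>] 1)
      (𝓝 (Real.pi / (3 * √3))) := by
  have hbounds : ∀ s : ℝ, 1 < s → s ≤ 2 → ∀ k : ℕ,
      0 ≤ (3 * k + 1 : ℝ) ^ (-s) - (3 * k + 2 : ℝ) ^ (-s) ∧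
      (3 * k + 1 : ℝ) ^ (-s) - (3 * k + 2 : ℝ) ^ (-s) ≤ 2 * (1 / ((k : ℝ) + 1) ^ 2) := by
    intro s hs1 hs2 k
    have hk : (0 : ℝ) ≤ k := k.cast_nonneg
    have h := rpow_neg_sub_rpow_neg_add_one_bounds (a := 3 * k + 1) (by linarith) hs1.le hs2
    rw [show (3 * k + 1 + 1 : ℝ) = 3 * k + 2 by ring] at h
    refine ⟨h.1, h.2.trans ?_⟩
    gcongr
    linarith
  have hgroup : ∀ s : ℝ, 1 < s → s ≤ 2 → ∑' n : ℕ, chiThree n * (n : ℝ) ^ (-s)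
      = ∑' k : ℕ, ((3 * k + 1 : ℝ) ^ (-s) - (3 * k + 2 : ℝ) ^ (-s)) := by
    intro s hs1 hs2
    symm
    refine HasSum.tsum_eq ?_
    rw [hasSum_iff_tendsto_nat_of_nonneg fun k => (hbounds s hs1 hs2 k).1]
    have h3 : Tendsto (fun K : ℕ => 3 * K) atTop atTop :=
      tendsto_id.const_mul_atTop' (by norm_num)
    refine ((summable_chiThree_mul_rpow_neg hs1).of_norm.hasSum.tendsto_sum_nat.comp h3).congr
      fun K => ?_
    simp only [Function.comp]
    rw [sum_range_three_mul_chiThree_mul]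
    push_cast
    rfl
  have hlim : Tendsto (fun s : ℝ =>
      ∑' k : ℕ, ((3 * k + 1 : ℝ) ^ (-s) - (3 * k + 2 : ℝ) ^ (-s))) (𝓝[>] 1)
      (𝓝 (∑' k : ℕ, (1 / (3 * k + 1 : ℝ) - 1 / (3 * k + 2)))) := by
    have hsum : Summable fun k : ℕ => 2 * (1 / ((k : ℝ) + 1) ^ 2) := by
      have := (summable_nat_add_iff 1).2 (Real.summable_one_div_nat_pow.2 one_lt_two)
      exact Summable.mul_left 2 (by simpa using this)
    refine tendsto_tsum_of_dominated_convergence hsum (fun k => ?_) ?_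
    · have hc : ∀ a : ℝ, 0 < a → Tendsto (fun s : ℝ => a ^ (-s)) (𝓝[>] 1) (𝓝 (1 / a)) := by
        intro a ha
        have := (((Real.continuous_const_rpow ha.ne').comp continuous_neg).tendsto 1).mono_left
          (nhdsWithin_le_nhds (s := Set.Ioi 1))
        simpa [Function.comp_def, Real.rpow_neg_one] using this
      exact (hc _ (by positivity)).sub (hc _ (by positivity))
    · filter_upwards [Ioc_mem_nhdsGT (show (1 : ℝ) < 2 by norm_num)] with s hs k
      have := hbounds s hs.1 hs.2 k
      rw [Real.norm_of_nonneg this.1]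
      exact this.2
  rw [hasSum_one_div_sub_one_div_three_mul.tsum_eq] at hlim
  refine hlim.congr' ?_
  filter_upwards [Ioc_mem_nhdsGT (show (1 : ℝ) < 2 by norm_num)] with s hs
  exact (hgroup s hs.1 hs.2).symm


lemma exp_primeWeight_mul_rpow_add_logError {s : ℝ} (hs : 1 ≤ s) (n : ℕ) :
    Real.exp (primeWeight n * (n : ℝ) ^ (-(s - 1)) + logError s n) =
      if n.Prime ∧ n % 6 = 1 then (1 + (n : ℝ) ^ (-s)) / (1 - (n : ℝ) ^ (-s)) else 1 := by
  unfold primeWeight logError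
  split_ifs with h
  · obtain ⟨hy0, hy2⟩ := rpow_neg_mem_of_two_le h.1.two_le hs
    have hn : (0 : ℝ) < n := by exact_mod_cast h.1.pos
    have hpow : 2 / (n : ℝ) * (n : ℝ) ^ (-(s - 1)) = 2 * (n : ℝ) ^ (-s) := by
      rw [show -(s - 1) = -s + 1 by ring, Real.rpow_add_one hn.ne']
      field_simp
    rw [hpow, add_sub_cancel, Real.exp_sub, Real.exp_log (by linarith), Real.exp_log (by linarith)]
  · simp

/-- Comparison of Euler products: `ζ(s) L(s, χ₃) = (1 + 3 ^ (-s)) ζ(2s) ∏ (1 + p⁻ˢ) / (1 - p⁻ˢ)`,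
the product ranging over the primes `p ≡ 1 (mod 6)`. -/
lemma tsum_rpow_neg_mul_tsum_chiThree_mul_rpow_neg {s : ℝ} (hs : 1 < s)
    (hw : Summable fun n : ℕ => primeWeight n * (n : ℝ) ^ (-(s - 1))) :
    (∑' n : ℕ, (n : ℝ) ^ (-s)) * ∑' n : ℕ, chiThree n * (n : ℝ) ^ (-s) =
      Real.exp (∑' n : ℕ, primeWeight n * (n : ℝ) ^ (-(s - 1)) + ∑' n, logError s n) *
        (1 + (3 : ℝ) ^ (-s)) * ∑' n : ℕ, (n : ℝ) ^ (-(2 * s)) := by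
  have hG : HasSum ((fun n : ℕ => primeWeight n * (n : ℝ) ^ (-(s - 1)) + logError s n) ∘
      ((↑) : {p : ℕ | p.Prime} → ℕ)) (∑' n : ℕ, primeWeight n * (n : ℝ) ^ (-(s - 1)) +
        ∑' n, logError s n) := by
    rw [hasSum_subtype_iff_of_support_subset]
    · exact hw.hasSum.add (summable_logError hs.le).hasSum
    · intro n hn
      by_contra hp
      refine hn ?_
      have hp' : ¬ n.Prime := hp
      simp [primeWeight, logError, hp']
  have hthree : HasProd (fun p : Nat.Primes => if (p : ℕ) = 3 then 1 + (3 : ℝ) ^ (-s) else 1)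
      (1 + (3 : ℝ) ^ (-s)) := by
    have := hasProd_single
      (f := fun p : Nat.Primes => if (p : ℕ) = 3 then 1 + (3 : ℝ) ^ (-s) else 1)
      ⟨3, Nat.prime_three⟩ fun p hp => if_neg fun h => hp (Subtype.ext h)
    simpa using this
  have hleft := (hasProd_primes_one_sub_rpow_neg hs).mul
    (hasProd_primes_one_sub_chiThree_mul_rpow_neg hs)
  have hright := (hG.rexp.mul hthree).mul
    (hasProd_primes_one_sub_rpow_neg (s := 2 * s) (by linarith))
  refine hleft.unique ?_
  convert! hright using 1
  funext ⟨p, hp⟩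
  obtain ⟨hy0, hy2⟩ := rpow_neg_mem_of_two_le hp.two_le hs.le
  have hsq : (p : ℝ) ^ (-(2 * s)) = ((p : ℝ) ^ (-s)) ^ 2 := by
    rw [← Real.rpow_mul_natCast p.cast_nonneg]; congr 1; push_cast; ring
  simp only [Function.comp, exp_primeWeight_mul_rpow_add_logError hs.le, hsq, hp, true_and,
    hp.mod_six_eq_one_iff, chiThree_apply]
  by_cases h3 : p = 3
  · subst h3
    norm_num at hy0 hy2 ⊢
    set y := (3 : ℝ) ^ (-s)
    have h1 : 1 - y ≠ 0 := by linarith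
    have h2 : 1 + y ≠ 0 := by linarith
    rw [show 1 - y ^ 2 = (1 - y) * (1 + y) by ring]
    field_simp
  · set y := (p : ℝ) ^ (-s)
    have h1 : 1 - y ≠ 0 := by linarith
    have h2 : 1 + y ≠ 0 := by linarith
    have h30 : p % 3 ≠ 0 := fun h => h3
      ((Nat.prime_dvd_prime_iff_eq Nat.prime_three hp).1 (Nat.dvd_of_mod_eq_zero h)).symm
    have h12 : p % 3 = 1 ∨ p % 3 = 2 := by omega
    rw [show 1 - y ^ 2 = (1 - y) * (1 + y) by ring]
    rcases h12 with h | h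
    · simp only [h, h3, if_true, if_false]
      field_simp
    · simp only [h, h3, if_true, if_false, OfNat.ofNat_ne_one]
      rw [neg_one_mul, sub_neg_eq_add]
      field_simp

lemma tendsto_rpow_neg_three : Tendsto (fun s : ℝ => (3 : ℝ) ^ (-s)) (𝓝[>] 1) (𝓝 (1 / 3)) := by
  have := (((Real.continuous_const_rpow (show (3 : ℝ) ≠ 0 by norm_num)).comp
    continuous_neg).tendsto 1).mono_left (nhdsWithin_le_nhds (s := Set.Ioi 1))
  simpa [Function.comp_def, Real.rpow_neg_one] using this

lemma exp_neg_add_tsum_logError {B l : ℝ}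
    (hB : ∀ k, blockSum primeWeight k ≤ B / (k + 1))
    (hl : Tendsto (fun K => ∑ k ∈ range K, (blockSum primeWeight k - 1 / ((k : ℝ) + 1)))
      atTop (𝓝 l)) :
    Real.exp (-(l + ∑' n, logError 1 n)) = 2 * Real.pi * √3 / 3 := by
  have hshift : Tendsto (fun s : ℝ => s - 1) (𝓝[>] 1) (𝓝[>] 0) := by
    refine tendsto_nhdsWithin_iff.2 ⟨?_, ?_⟩
    · have : Tendsto (fun s : ℝ => s - 1) (𝓝 1) (𝓝 (1 - 1)) := tendsto_id.sub_const 1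
      rw [sub_self] at this
      exact this.mono_left nhdsWithin_le_nhds
    · filter_upwards [self_mem_nhdsWithin] with s hs
      exact sub_pos.2 (Set.mem_Ioi.1 hs)
  have hG := ((tendsto_tsum_rpow_add_log primeWeight_nonneg primeWeight_zero primeWeight_one
    hB hl).comp hshift).add tendsto_tsum_logError
  have hexp := hG.neg.rexp
  have hzeta : Tendsto (fun s : ℝ => (s - 1) * ∑' n : ℕ, (n : ℝ) ^ (-s)) (𝓝[>] 1) (𝓝 1) := by
    refine tendsto_sub_mul_tsum_nat_rpow.congr fun s => ?_
    congr 2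
    funext n
    rw [Real.rpow_neg n.cast_nonneg, one_div]
  have hL := tendsto_tsum_chiThree_mul_rpow_neg
  have hLne : Real.pi / (3 * √3) ≠ 0 := by positivity
  have hquot := ((tendsto_rpow_neg_three.const_add 1).mul tendsto_tsum_rpow_neg_two_mul).div
    (hzeta.mul hL) (by rwa [one_mul])
  have hval : (1 + 1 / 3) * (Real.pi ^ 2 / 6) / (1 * (Real.pi / (3 * √3)))
      = 2 * Real.pi * √3 / 3 := by
    have := Real.pi_ne_zero
    field_simp
    norm_num
  rw [← hval]
  refine tendsto_nhds_unique hexp (hquot.congr' ?_)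
  filter_upwards [self_mem_nhdsWithin, hL.eventually_ne hLne] with s hs hLs
  have hs1 : (1 : ℝ) < s := hs
  have hδ : 0 < s - 1 := by linarith
  have hprod := tsum_rpow_neg_mul_tsum_chiThree_mul_rpow_neg hs1
    (summable_and_tsum_rpow_bounds primeWeight_nonneg primeWeight_zero primeWeight_one hB hδ).2.1
  have hZ : 0 < ∑' n : ℕ, (n : ℝ) ^ (-s) :=
    (summable_natCast_rpow_neg hs1).tsum_pos (fun n => by positivity) 1 (by simp)
  simp only [Function.comp, Pi.div_apply]
  rw [show ∀ a b c : ℝ, -(a + b + c) = -(a + c) + -b by intros; ring, Real.exp_add,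
    Real.exp_neg (Real.log _), Real.exp_log hδ, Real.exp_neg]
  have hE := Real.exp_ne_zero (∑' n : ℕ, primeWeight n * (n : ℝ) ^ (-(s - 1)) +
    ∑' n, logError s n)
  rw [div_eq_iff (mul_ne_zero (mul_ne_zero hδ.ne' hZ.ne') hLs) |>.2]
  rw [mul_assoc (s - 1), hprod]
  field_simp

/-- **Mertens' theorem** for the quotients `(1 - 1/p) / (1 + 1/p)`, `p ≡ 1 (mod 6)`. -/
lemma tendsto_log_mul_prod_primes :
    Tendsto (fun x : ℝ => Real.log x *
        ∏ p ∈ (Nat.floor x + 1).primesBelow.filter (fun p => p % 6 = 1),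
          (1 - 1 / (p : ℝ)) / (1 + 1 / (p : ℝ)))
      atTop (𝓝 (2 * Real.pi * √3 / 3 * Real.exp (-Real.eulerMascheroniConstant))) := by
  obtain ⟨C, hC⟩ := abs_sum_primeWeight_mul_log_sub_log_le
  have hC' : ∀ N : ℕ, 0 < N →
      |∑ n ∈ range (N + 1), primeWeight n * Real.log n - Real.log N| ≤ C := by
    intro N hN
    rw [range_eq_Ico, sum_eq_sum_Ico_succ_bot N.succ_pos, primeWeight_zero, zero_mul, zero_add]
    exact hC N hN
  obtain ⟨⟨B, hB⟩, l, hl⟩ := exists_tendsto_sum_blockSum_sub_harmonic primeWeight_nonneg hC'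
  have hfloor : Tendsto (fun x : ℝ => ⌊x⌋₊ + 1) atTop atTop :=
    (tendsto_add_atTop_nat 1).comp tendsto_nat_floor_atTop
  have hlim := ((tendsto_sum_floor_sub_log_log primeWeight_nonneg primeWeight_zero
    primeWeight_one hl).add ((summable_logError le_rfl).hasSum.tendsto_sum_nat.comp hfloor)).neg.rexp
  rw [show -(l + Real.eulerMascheroniConstant + ∑' n, logError 1 n) =
    -(l + ∑' n, logError 1 n) + -Real.eulerMascheroniConstant by ring, Real.exp_add,
    exp_neg_add_tsum_logError hB hl] at hlim
  refine hlim.congr' ?_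
  filter_upwards [eventually_gt_atTop 1] with x hx
  rw [Nat.primesBelow, filter_filter, prod_filter]
  simp only [Function.comp]
  rw [show ∀ a b c : ℝ, -(a - b + c) = b + -(a + c) by intros; ring, Real.exp_add,
    Real.exp_log (Real.log_pos hx), ← sum_add_distrib, Real.exp_neg, Real.exp_sum,
    ← prod_inv_distrib]
  congr 1
  refine prod_congr rfl fun n _ => ?_
  have := exp_primeWeight_mul_rpow_add_logError le_rfl n
  rw [sub_self, neg_zero, Real.rpow_zero, mul_one, Real.rpow_neg_one, ← one_div] at this
  rw [this]
  split_ifs <;> simp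

/-- **Grosswald's formula for `C(6,1)`:**
`log x · (∏_{p ≤ x, p ≡ 1 (6)} (1 - 1/p))² → (2π√3/3) e^{-γ} ∏_{p ≡ 1 (6)} (1 - 1/p²)`,
the last product (over all primes `p ≡ 1 (mod 6)`) being absolutely convergent. -/
theorem grosswald_C61 :
    Multipliable (fun p : {p : ℕ // p.Prime ∧ p % 6 = 1} =>
      1 - 1 / ((p : ℕ) : ℝ) ^ 2) ∧
    Tendsto (fun x : ℝ => Real.log x *
        (∏ p ∈ (Nat.floor x + 1).primesBelow.filter (fun p => p % 6 = 1),
          (1 - 1 / (p : ℝ))) ^ 2)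
      atTop (𝓝 (2 * Real.pi * Real.sqrt 3 / 3 * Real.exp (-Real.eulerMascheroniConstant) *
        ∏' p : {p : ℕ // p.Prime ∧ p % 6 = 1}, (1 - 1 / ((p : ℕ) : ℝ) ^ 2))) := by
  have hmult : Multipliable (fun p : {p : ℕ // p.Prime ∧ p % 6 = 1} =>
      1 - 1 / ((p : ℕ) : ℝ) ^ 2) := by
    have hsum := ((Real.summable_one_div_nat_pow.2 one_lt_two).neg).comp_injective
      (Subtype.val_injective (p := fun p : ℕ => p.Prime ∧ p % 6 = 1))
    simpa [sub_eq_add_neg] using Real.multipliable_one_add_of_summable hsum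
  refine ⟨hmult, ?_⟩
  have hfloor : Tendsto (fun x : ℝ => ⌊x⌋₊ + 1) atTop atTop :=
    (tendsto_add_atTop_nat 1).comp tendsto_nat_floor_atTop
  have hprod := (hasProd_subtype_iff_mulIndicator (s := {p : ℕ | p.Prime ∧ p % 6 = 1})
    (f := fun p : ℕ => 1 - 1 / (p : ℝ) ^ 2)).1 hmult.hasProd
  refine (tendsto_log_mul_prod_primes.mul (hprod.tendsto_prod_nat.comp hfloor)).congr fun x => ?_
  simp only [Function.comp]
  rw [mul_assoc, Nat.primesBelow, filter_filter, prod_filter, prod_filter, ← prod_mul_distrib,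
    ← prod_pow]
  congr 1
  refine prod_congr rfl fun p _ => ?_
  simp only [Set.mulIndicator_apply, Set.mem_ofPred_eq]
  split_ifs
  · have : (1 + 1 / (p : ℝ)) ≠ 0 := by positivity
    rw [show 1 - 1 / (p : ℝ) ^ 2 = (1 + 1 / (p : ℝ)) * (1 - 1 / (p : ℝ)) by ring, ← mul_assoc,
      div_mul_cancel₀ _ this, sq]
  · simp
end

section
/- As x → ∞, (log x) · ( ∏_{p ≤ x, p ≡ 5 (mod 6)} (1 − 1/p) )² tends to (9√3/(2π)) · e^{−γ} · ( ∏_{p ≡ 1 (mod 6)} (1 − 1/p²) )^{−1}, where the product over all primes p ≡ 1 (mod 6) is absolutely convergent. Equivalently, C(6,5)² = (3√3/(2π))·3·e^{−γ} ∏_{p ≡ 1 (mod 6)} (1 − 1/p²)^{−1}, which together with Grosswald's formula for C(6,1) expresses the relation C(6,1)·C(6,5) = 3 e^{−γ}. -/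
open Filter Topology Finset

open MeasureTheory in
/-- A weighted exponential sum as a Laplace transform of its counting function. -/
theorem hasSum_laplace_countingFunction {ι : Type*} [Countable ι] {ℓ a : ι → ℝ}
    (hℓ : ∀ i, 0 ≤ ℓ i) {ε : ℝ} (hε : 0 < ε)
    (hs : Summable fun i => |a i| * Real.exp (-ε * ℓ i)) :
    HasSum (fun i => a i * Real.exp (-ε * ℓ i))
      (∫ v in Set.Ici (0 : ℝ), Real.exp (-v) * ∑' i, if ℓ i ≤ v / ε then a i else 0) := by
  have hexp : IntegrableOn (fun v : ℝ => Real.exp (-v)) (Set.Ici 0) :=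
    (integrableOn_Ici_iff_integrableOn_Ioi (by simp)).2 (integrableOn_exp_neg_Ioi 0)
  set F : ι → ℝ → ℝ := fun i => (Set.Ici (ε * ℓ i)).indicator fun v => Real.exp (-v) * a i with hF
  have hint (c : ℝ) (i : ι) :
      ∫ v in Set.Ici (0 : ℝ), (Set.Ici (ε * ℓ i)).indicator (fun v => Real.exp (-v) * c) v =
        c * Real.exp (-ε * ℓ i) := by
    have h0 : 0 ≤ ε * ℓ i := mul_nonneg hε.le (hℓ i)
    rw [integral_indicator measurableSet_Ici, Measure.restrict_restrict measurableSet_Ici,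
      Set.Ici_inter_Ici, sup_eq_left.2 h0, integral_Ici_eq_integral_Ioi, integral_mul_const,
      integral_exp_neg_Ioi, mul_comm, neg_mul]
  have hFi (i : ι) : Integrable (F i) (volume.restrict (Set.Ici 0)) :=
    (hexp.mul_const (a i)).indicator measurableSet_Ici
  have hnorm (i : ι) : ∫ v in Set.Ici (0 : ℝ), ‖F i v‖ = |a i| * Real.exp (-ε * ℓ i) := by
    rw [← hint]
    congr 1
    ext v
    simp [hF, Set.indicator_apply, apply_ite abs]
  have hsumF : Summable fun i => ∫ v in Set.Ici (0 : ℝ), ‖F i v‖ := by simpa only [hnorm] using hs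
  convert! hasSum_integral_of_summable_integral_norm hFi hsumF using 1
  · ext i
    exact (hint (a i) i).symm
  · congr 1
    ext v
    rw [← tsum_mul_left]
    congr 1
    ext i
    simp [hF, Set.indicator_apply, le_div_iff₀ hε, mul_comm]

open MeasureTheory in
/-- An Abelian theorem for general Dirichlet series: if the partial sums over `ℓ i ≤ u` tend to
`c`, then so do the regularized sums `∑ a i e^{-ε ℓ i}` as `ε → 0⁺`. -/
theorem tendsto_tsum_mul_exp_neg {ι : Type*} [Countable ι] {ℓ a : ι → ℝ} (hℓ : ∀ i, 0 ≤ ℓ i)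
    (hs : ∀ ε > 0, Summable fun i => |a i| * Real.exp (-ε * ℓ i)) {c : ℝ}
    (hc : Tendsto (fun u : ℝ => ∑' i, if ℓ i ≤ u then a i else 0) atTop (𝓝 c)) :
    Tendsto (fun ε : ℝ => ∑' i, a i * Real.exp (-ε * ℓ i)) (𝓝[>] 0) (𝓝 c) := by
  set D : ℝ → ℝ := fun u => ∑' i, if ℓ i ≤ u then a i else 0 with hD
  have hle (U : ℝ) (i : ι) : |if ℓ i ≤ U then a i else 0| ≤
      Real.exp U * (|a i| * Real.exp (-1 * ℓ i)) := by
    split_ifs with h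
    · rw [mul_left_comm, ← Real.exp_add]
      exact le_mul_of_one_le_right (abs_nonneg _) (Real.one_le_exp (by linarith))
    · rw [abs_zero]; positivity
  have hsum1 (U : ℝ) : Summable fun i => Real.exp U * (|a i| * Real.exp (-1 * ℓ i)) :=
    (hs 1 one_pos).mul_left _
  have hsum (U : ℝ) : Summable fun i => if ℓ i ≤ U then a i else 0 :=
    Summable.of_norm_bounded (hsum1 U) (hle U)
  have hbound (U : ℝ) : |D U| ≤ Real.exp U * ∑' i, |a i| * Real.exp (-1 * ℓ i) := by
    rw [← tsum_mul_left]
    exact tsum_of_norm_bounded (f := fun i => if ℓ i ≤ U then a i else 0) (hsum1 U).hasSum (hle U)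
  obtain ⟨M, hM⟩ : ∃ M, ∀ u, |D u| ≤ M := by
    obtain ⟨U, hU⟩ := eventually_atTop.1 (hc.abs.eventually (eventually_le_nhds (lt_add_one |c|)))
    set T := ∑' i, |a i| * Real.exp (-1 * ℓ i)
    have hT : 0 ≤ T := tsum_nonneg fun i => by positivity
    refine ⟨max (|c| + 1) (Real.exp U * T), fun u => ?_⟩
    rcases le_total U u with h | h
    · exact (hU u h).trans (le_max_left _ _)
    · exact (hbound u).trans (le_trans (by gcongr) (le_max_right _ _))
  have hmeas : Measurable D := by
    refine measurable_of_tendsto_metrizable' (f := fun (s : Finset ι) (u : ℝ) =>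
      ∑ i ∈ s, if ℓ i ≤ u then a i else 0) atTop (fun s => ?_) ?_
    · exact Finset.measurable_fun_sum s fun i _ =>
        Measurable.ite measurableSet_Ici measurable_const measurable_const
    · exact tendsto_pi_nhds.2 fun u => (hsum u).hasSum
  have hexp : IntegrableOn (fun v : ℝ => Real.exp (-v)) (Set.Ici 0) :=
    (integrableOn_Ici_iff_integrableOn_Ioi (by simp)).2 (integrableOn_exp_neg_Ioi 0)
  have key : Tendsto (fun ε : ℝ => ∫ v in Set.Ici (0 : ℝ), Real.exp (-v) * D (v / ε)) (𝓝[>] 0)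
      (𝓝 (∫ v in Set.Ici (0 : ℝ), Real.exp (-v) * c)) := by
    refine tendsto_integral_filter_of_dominated_convergence (fun v => Real.exp (-v) * M)
      (.of_forall fun ε => ?_) (.of_forall fun ε => .of_forall fun v => ?_) (hexp.mul_const M) ?_
    · exact ((Real.measurable_exp.comp measurable_neg).mul
        (hmeas.comp (measurable_id.div_const ε))).aestronglyMeasurable
    · rw [norm_mul, Real.norm_eq_abs, Real.abs_exp, Real.norm_eq_abs]
      gcongr
      exact hM _
    · rw [← restrict_Ioi_eq_restrict_Ici]
      filter_upwards [ae_restrict_mem measurableSet_Ioi] with v hv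
      refine (hc.comp ?_).const_mul _
      exact tendsto_inv_nhdsGT_zero.const_mul_atTop hv
  rw [integral_mul_const, integral_Ici_eq_integral_Ioi, integral_exp_neg_Ioi, neg_zero,
    Real.exp_zero, one_mul] at key
  refine key.congr' ?_
  filter_upwards [self_mem_nhdsWithin] with ε hε
  exact (hasSum_laplace_countingFunction hℓ hε (hs ε hε)).tsum_eq.symm

/-- The contribution of the `k ≥ 2` terms to `-log (1 - y)`, `y = χ(n) n^{-1-ε}`, at primes. -/
noncomputable def eulerLogTail (χ : ℕ → ℝ) (ε : ℝ) (n : ℕ) : ℝ :=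
  if n.Prime then -Real.log (1 - χ n / n * Real.exp (-ε * Real.log n)) -
    χ n / n * Real.exp (-ε * Real.log n) else 0

/-- The function `χ(n) / n` restricted to primes. -/
noncomputable def primeTerm (χ : ℕ → ℝ) (n : ℕ) : ℝ := if n.Prime then χ n / n else 0

theorem abs_div_mul_exp_le {χ : ℕ → ℝ} (hχ : ∀ n, |χ n| ≤ 1) {ε : ℝ} (hε : 0 ≤ ε) (n : ℕ) :
    |χ n / n * Real.exp (-ε * Real.log n)| ≤ 1 / n := by
  rw [abs_mul, abs_div, Nat.abs_cast, Real.abs_exp]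
  calc |χ n| / n * Real.exp (-ε * Real.log n) ≤ 1 / n * 1 := by
        gcongr
        · exact hχ n
        · rw [Real.exp_le_one_iff]
          have := mul_nonneg hε (Real.log_natCast_nonneg n)
          linarith
    _ = 1 / n := mul_one _

theorem one_div_natCast_le_half {n : ℕ} (hn : n.Prime) : (1 : ℝ) / n ≤ 1 / 2 := by
  have : (2 : ℝ) ≤ n := mod_cast hn.two_le
  gcongr

theorem abs_eulerLogTail_le {χ : ℕ → ℝ} (hχ : ∀ n, |χ n| ≤ 1) {ε : ℝ} (hε : 0 ≤ ε) (n : ℕ) :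
    |eulerLogTail χ ε n| ≤ 2 * (1 / (n : ℝ) ^ 2) := by
  unfold eulerLogTail
  split_ifs with hn
  · have hy := abs_div_mul_exp_le hχ hε n
    have h2 := one_div_natCast_le_half hn
    set y := χ n / n * Real.exp (-ε * Real.log n)
    have := Real.abs_log_sub_add_sum_range_le (x := y) (by linarith) 1
    simp only [range_one, sum_singleton, zero_add, pow_one, Nat.cast_zero, div_one] at this
    rw [show -Real.log (1 - y) - y = -(y + Real.log (1 - y)) by ring, abs_neg]
    refine this.trans ?_
    calc |y| ^ (1 + 1) / (1 - |y|) ≤ (1 / (n : ℝ)) ^ 2 / (1 / 2) := by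
          gcongr
          linarith
      _ = _ := by rw [one_div_pow]; ring
  · rw [abs_zero]; positivity

theorem summable_two_mul_one_div_sq : Summable fun n : ℕ => 2 * (1 / (n : ℝ) ^ 2) :=
  (Real.summable_one_div_nat_pow.2 one_lt_two).mul_left 2

theorem summable_eulerLogTail {χ : ℕ → ℝ} (hχ : ∀ n, |χ n| ≤ 1) {ε : ℝ} (hε : 0 ≤ ε) :
    Summable (eulerLogTail χ ε) :=
  Summable.of_norm_bounded summable_two_mul_one_div_sq (abs_eulerLogTail_le hχ hε)

theorem tendsto_tsum_eulerLogTail {χ : ℕ → ℝ} (hχ : ∀ n, |χ n| ≤ 1) :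
    Tendsto (fun ε : ℝ => ∑' n, eulerLogTail χ ε n) (𝓝[>] 0) (𝓝 (∑' n, eulerLogTail χ 0 n)) := by
  refine tendsto_tsum_of_dominated_convergence summable_two_mul_one_div_sq (fun n => ?_) ?_
  · refine Tendsto.mono_left (ContinuousAt.tendsto ?_) nhdsWithin_le_nhds
    unfold eulerLogTail
    split_ifs with hn
    · have hy := abs_div_mul_exp_le hχ le_rfl n
      have h2 := one_div_natCast_le_half hn
      have h3 : 1 - χ n / n * Real.exp (-0 * Real.log n) ≠ 0 := by
        have := (abs_le.1 (hy.trans h2)).2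
        intro h
        linarith
      fun_prop (disch := assumption)
    · exact continuousAt_const
  · filter_upwards [self_mem_nhdsWithin] with ε hε n
    exact abs_eulerLogTail_le hχ (le_of_lt hε) n

theorem prod_primesBelow_eq_exp {χ : ℕ → ℝ} (hχ : ∀ n, |χ n| ≤ 1) {ε : ℝ} (hε : 0 ≤ ε) (N : ℕ) :
    ∏ p ∈ N.primesBelow, (1 - χ p / p * Real.exp (-ε * Real.log p)) =
      Real.exp (-(∑ n ∈ range N, primeTerm χ n * Real.exp (-ε * Real.log n) +
        ∑ n ∈ range N, eulerLogTail χ ε n)) := by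
  rw [← sum_add_distrib, ← sum_neg_distrib, Real.exp_sum, Nat.primesBelow, prod_filter]
  refine prod_congr rfl fun n _ => ?_
  unfold primeTerm eulerLogTail
  split_ifs with hn
  · have hy := abs_div_mul_exp_le hχ hε n
    have := (abs_le.1 (hy.trans (one_div_natCast_le_half hn))).2
    rw [add_sub_cancel, neg_neg, Real.exp_log (by linarith)]
  · simp

theorem summable_abs_div_mul_exp {χ : ℕ → ℝ} (hχ : ∀ n, |χ n| ≤ 1) {ε : ℝ} (hε : 0 < ε) :
    Summable fun n : ℕ => |χ n / n| * Real.exp (-ε * Real.log n) := by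
  refine Summable.of_nonneg_of_le (fun n => by positivity) (fun n => ?_)
    (Real.summable_one_div_nat_rpow.2 (by linarith : 1 < 1 + ε))
  rcases Nat.eq_zero_or_pos n with rfl | hn
  · simp; positivity
  · have hn' : (0 : ℝ) < n := mod_cast hn
    rw [Real.rpow_add hn', Real.rpow_one, Real.rpow_def_of_pos hn', abs_div, Nat.abs_cast,
      ← one_div_mul_one_div, neg_mul, Real.exp_neg, mul_comm ε, one_div (Real.exp _)]
    gcongr
    exact hχ n

theorem abs_primeTerm_le (χ : ℕ → ℝ) (n : ℕ) : |primeTerm χ n| ≤ |χ n / n| := by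
  unfold primeTerm
  split_ifs
  · rfl
  · rw [abs_zero]; positivity

theorem summable_abs_primeTerm_mul_exp {χ : ℕ → ℝ} (hχ : ∀ n, |χ n| ≤ 1) {ε : ℝ} (hε : 0 < ε) :
    Summable fun n : ℕ => |primeTerm χ n| * Real.exp (-ε * Real.log n) := by
  refine Summable.of_nonneg_of_le (fun n => by positivity) (fun n => ?_)
    (summable_abs_div_mul_exp hχ hε)
  exact mul_le_mul_of_nonneg_right (abs_primeTerm_le χ n) (Real.exp_pos _).le

theorem Summable.of_abs_mul_exp {ι : Type*} {a b : ι → ℝ}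
    (h : Summable fun i => |a i| * Real.exp (b i)) : Summable fun i => a i * Real.exp (b i) :=
  Summable.of_norm (by simpa using h)

/-- The Euler product of a completely multiplicative bounded function in logarithmic form. -/
theorem exp_tsum_primeTerm_add_tsum_eulerLogTail (χ : ℕ →*₀ ℝ) (hχ : ∀ n, |χ n| ≤ 1) {ε : ℝ}
    (hε : 0 < ε) :
    Real.exp (∑' n, primeTerm χ n * Real.exp (-ε * Real.log n) + ∑' n, eulerLogTail χ ε n) =
      ∑' n : ℕ, χ n / n * Real.exp (-ε * Real.log n) := by
  let f : ℕ →*₀ ℝ :=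
    { toFun := fun n => χ n / n * Real.exp (-ε * Real.log n)
      map_zero' := by simp
      map_one' := by simp
      map_mul' := fun m n => by
        rcases eq_or_ne m 0 with rfl | hm
        · simp
        rcases eq_or_ne n 0 with rfl | hn
        · simp
        rw [map_mul, Nat.cast_mul, Real.log_mul (by positivity) (by positivity), mul_add,
          Real.exp_add]
        ring }
  have hf : Summable (‖f ·‖) := by
    simpa [f, abs_div] using summable_abs_div_mul_exp hχ hε
  have h1 := EulerProduct.eulerProduct_completely_multiplicative hf
  have h2 : Tendsto (fun N : ℕ => Real.exp (∑ n ∈ range N, primeTerm χ n *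
      Real.exp (-ε * Real.log n) + ∑ n ∈ range N, eulerLogTail χ ε n)) atTop
      (𝓝 (Real.exp (∑' n, primeTerm χ n * Real.exp (-ε * Real.log n) +
        ∑' n, eulerLogTail χ ε n))) :=
    (Real.continuous_exp.tendsto _).comp
      ((summable_abs_primeTerm_mul_exp hχ hε).of_abs_mul_exp.hasSum.tendsto_sum_nat.add
        (summable_eulerLogTail hχ hε.le).hasSum.tendsto_sum_nat)
  refine tendsto_nhds_unique (h2.congr fun N => ?_) h1
  rw [prod_inv_distrib]
  change _ = (∏ p ∈ N.primesBelow, (1 - χ p / p * Real.exp (-ε * Real.log p)))⁻¹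
  rw [prod_primesBelow_eq_exp hχ hε.le, Real.exp_neg, inv_inv]

theorem tsum_ite_log_le (a : ℕ → ℝ) {u : ℝ} (hu : 0 ≤ u) :
    ∑' n : ℕ, (if Real.log n ≤ u then a n else 0) = ∑ n ∈ range (⌊Real.exp u⌋₊ + 1), a n := by
  have hmem (n : ℕ) : n ∈ range (⌊Real.exp u⌋₊ + 1) ↔ Real.log n ≤ u := by
    rw [mem_range, Nat.lt_succ_iff, Nat.le_floor_iff (Real.exp_pos u).le]
    rcases Nat.eq_zero_or_pos n with rfl | hn
    · simp [hu, (Real.exp_pos u).le]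
    · exact (Real.log_le_iff_le_exp (by positivity)).symm
  rw [tsum_eq_sum (s := range (⌊Real.exp u⌋₊ + 1)) fun n hn => if_neg ((hmem n).not.1 hn)]
  exact sum_congr rfl fun n hn => if_pos ((hmem n).1 hn)

theorem tendsto_floor_exp_add_one : Tendsto (fun u : ℝ => ⌊Real.exp u⌋₊ + 1) atTop atTop :=
  (tendsto_add_atTop_nat 1).comp (tendsto_nat_floor_atTop.comp Real.tendsto_exp_atTop)

/-- Abel's theorem for ordinary Dirichlet series along the real axis. -/
theorem tendsto_tsum_mul_exp_neg_log {a : ℕ → ℝ}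
    (hs : ∀ ε > 0, Summable fun n : ℕ => |a n| * Real.exp (-ε * Real.log n)) {c : ℝ}
    (hc : Tendsto (fun N : ℕ => ∑ n ∈ range N, a n) atTop (𝓝 c)) :
    Tendsto (fun ε : ℝ => ∑' n : ℕ, a n * Real.exp (-ε * Real.log n)) (𝓝[>] 0) (𝓝 c) := by
  refine tendsto_tsum_mul_exp_neg (fun n => Real.log_natCast_nonneg n) hs
    ((hc.comp tendsto_floor_exp_add_one).congr' ?_)
  filter_upwards [eventually_ge_atTop 0] with u hu
  exact (tsum_ite_log_le a hu).symm

/-- If `∑ χ(p)/p` and `∑ χ(n)/n` both converge, the Euler product of `χ` converges at `s = 1`. -/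
theorem tendsto_prod_primesBelow_one_sub_div (χ : ℕ →*₀ ℝ) (hχ : ∀ n, |χ n| ≤ 1) {d L : ℝ}
    (hd : Tendsto (fun N : ℕ => ∑ n ∈ range N, primeTerm χ n) atTop (𝓝 d))
    (hL : Tendsto (fun N : ℕ => ∑ n ∈ range N, χ n / n) atTop (𝓝 L)) :
    Tendsto (fun N : ℕ => ∏ p ∈ N.primesBelow, (1 - χ p / p)) atTop (𝓝 L⁻¹) := by
  have h1 := tendsto_tsum_mul_exp_neg_log (fun ε hε => summable_abs_primeTerm_mul_exp hχ hε) hd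
  have h2 := tendsto_tsum_mul_exp_neg_log (fun ε hε => summable_abs_div_mul_exp hχ hε) hL
  have h3 : Real.exp (d + ∑' n, eulerLogTail χ 0 n) = L := by
    refine tendsto_nhds_unique ((Real.continuous_exp.tendsto _).comp
      (h1.add (tendsto_tsum_eulerLogTail hχ))) (h2.congr' ?_)
    filter_upwards [self_mem_nhdsWithin] with ε hε
    exact (exp_tsum_primeTerm_add_tsum_eulerLogTail χ hχ hε).symm
  rw [← h3, ← Real.exp_neg]
  refine ((Real.continuous_exp.tendsto _).comp
    (hd.add (summable_eulerLogTail hχ le_rfl).hasSum.tendsto_sum_nat).neg).congr fun N => ?_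
  have := prod_primesBelow_eq_exp hχ le_rfl N
  simp only [neg_zero, zero_mul, Real.exp_zero, mul_one] at this
  exact this.symm

theorem sum_Ioc_zero_eq_sum_range {f : ℕ → ℝ} (h : f 0 = 0) (N : ℕ) :
    ∑ n ∈ Ioc 0 N, f n = ∑ n ∈ range (N + 1), f n := by
  refine sum_subset (fun n hn => by simp at hn ⊢; omega) fun n hn hn' => ?_
  have : n = 0 := by simp at hn hn'; omega
  rw [this, h]

open ArithmeticFunction in
/-- The hyperbola identity coming from `log = Λ * 1`, twisted by a completely multiplicative
function. -/
theorem sum_mul_log_eq_sum_mul_vonMangoldt (h : ℕ →*₀ ℝ) (N : ℕ) :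
    ∑ n ∈ Ioc 0 N, h n * Real.log n =
      ∑ d ∈ Ioc 0 N, h d * vonMangoldt d * ∑ m ∈ Ioc 0 (N / d), h m := by
  let f : ArithmeticFunction ℝ := ⟨fun n => h n * vonMangoldt n, by simp⟩
  let g : ArithmeticFunction ℝ := ⟨fun n => h n, by simp⟩
  have := sum_Ioc_mul_eq_sum_sum f g N
  refine Eq.trans (sum_congr rfl fun n hn => ?_) this
  rw [mul_apply, ← vonMangoldt_sum, Nat.sum_divisorsAntidiagonal (fun d m => f d * g m), mul_sum]
  refine sum_congr rfl fun d hd => ?_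
  have hd' := Nat.mul_div_cancel' (Nat.dvd_of_mem_divisors hd)
  change _ = h d * vonMangoldt d * h (n / d)
  nth_rw 1 [← hd']
  rw [map_mul]
  ring

theorem exists_bound_of_forall_ge {s : ℕ → ℝ} {C : ℝ} (M : ℕ) (h : ∀ N ≥ M, |s N| ≤ C) :
    ∃ C, ∀ N, |s N| ≤ C := by
  refine ⟨max C (∑ n ∈ range M, |s n|), fun N => ?_⟩
  rcases lt_or_ge N M with hN | hN
  · exact le_max_of_le_right
      (single_le_sum (f := fun n => |s n|) (fun _ _ => abs_nonneg _) (mem_range.2 hN))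
  · exact le_max_of_le_left (h N hN)

/-- Partial summation against `1 / log`. -/
theorem exists_tendsto_sum_div_log {b : ℕ → ℝ} {C : ℝ} (h : ∀ N, |∑ n ∈ range N, b n| ≤ C) :
    ∃ d, Tendsto (fun N : ℕ => ∑ n ∈ range N, b n / Real.log n) atTop (𝓝 d) := by
  have hanti : Antitone fun n : ℕ => (Real.log ((n + 2 : ℕ) : ℝ))⁻¹ := fun m n hmn => by
    have : 0 < Real.log ((m + 2 : ℕ) : ℝ) := Real.log_pos (by push_cast; linarith)
    dsimp only
    gcongr
  have hzero : Tendsto (fun n : ℕ => (Real.log ((n + 2 : ℕ) : ℝ))⁻¹) atTop (𝓝 0) :=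
    (Real.tendsto_log_atTop.comp (tendsto_natCast_atTop_atTop.comp
      (tendsto_add_atTop_nat 2))).inv_tendsto_atTop
  have hb (n : ℕ) : ‖∑ i ∈ range n, b (i + 2)‖ ≤ C + |∑ i ∈ range 2, b i| := by
    have h1 := sum_range_add_sub_sum_range b 2 n
    simp only [add_comm _ 2]
    rw [Real.norm_eq_abs, ← h1]
    exact (abs_sub _ _).trans (add_le_add (h _) le_rfl)
  obtain ⟨d, hd⟩ := cauchySeq_tendsto_of_complete
    (hanti.cauchySeq_series_mul_of_tendsto_zero_of_bounded hzero hb)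
  refine ⟨d, (tendsto_add_atTop_iff_nat 2).1 (hd.congr fun N => ?_)⟩
  rw [add_comm N 2, sum_range_add]
  simp [sum_range_succ, div_eq_inv_mul, add_comm]

/-- The constant function `1` on positive integers, as a completely multiplicative function. -/
noncomputable def onePos : ℕ →*₀ ℝ where
  toFun n := if n = 0 then 0 else 1
  map_zero' := by simp
  map_one' := by simp
  map_mul' m n := by by_cases hm : m = 0 <;> by_cases hn : n = 0 <;> simp [hm, hn]

theorem onePos_of_ne_zero {n : ℕ} (hn : n ≠ 0) : onePos n = 1 := if_neg hn

theorem abs_onePos_le (n : ℕ) : |onePos n| ≤ 1 := by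
  rcases eq_or_ne n 0 with rfl | hn
  · simp
  · simp [onePos_of_ne_zero hn]

theorem sum_vonMangoldt_le (N : ℕ) :
    ∑ d ∈ Ioc 0 N, ArithmeticFunction.vonMangoldt d ≤ (Real.log 4 + 4) * N := by
  simpa [Chebyshev.psi] using Chebyshev.psi_le_const_mul_self (Nat.cast_nonneg N)

theorem sum_log_eq_log_factorial (N : ℕ) :
    ∑ n ∈ Ioc 0 N, Real.log n = Real.log N.factorial := by
  induction N with
  | zero => simp
  | succ N ih =>
    rw [sum_Ioc_succ_top N.zero_le, ih, Nat.factorial_succ, Nat.cast_mul,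
      Real.log_mul (by positivity) (by positivity), add_comm]

/-- Mertens' first theorem. -/
theorem exists_abs_sum_vonMangoldt_div_sub_log_le :
    ∃ C, ∀ N : ℕ, 1 ≤ N →
      |∑ d ∈ Ioc 0 N, ArithmeticFunction.vonMangoldt d / d - Real.log N| ≤ C := by
  refine ⟨Real.log 4 + 4 + 1, fun N hN => ?_⟩
  have hN' : (0 : ℝ) < N := by exact_mod_cast hN
  have h1 : Real.log N.factorial =
      ∑ d ∈ Ioc 0 N, ArithmeticFunction.vonMangoldt d * ((N / d : ℕ) : ℝ) := by
    have := sum_mul_log_eq_sum_mul_vonMangoldt onePos N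
    rw [← sum_log_eq_log_factorial]
    convert this using 1
    · exact sum_congr rfl fun n hn => by
        rw [onePos_of_ne_zero (by simp at hn; omega), one_mul]
    · refine sum_congr rfl fun n hn => ?_
      rw [onePos_of_ne_zero (by simp at hn; omega), one_mul,
        sum_congr rfl fun m hm => onePos_of_ne_zero (by simp at hm; omega)]
      simp
  have hup : Real.log N.factorial ≤ N * Real.log N := by
    rw [← Real.log_pow]
    exact Real.log_le_log (by positivity) (by exact_mod_cast Nat.factorial_le_pow N)
  have hlow : N * Real.log N - N ≤ Real.log N.factorial := by
    have := Real.log_le_log (by positivity) (Real.pow_div_factorial_le_exp (N : ℝ) N.cast_nonneg N)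
    rw [Real.log_exp, Real.log_div (by positivity) (by positivity), Real.log_pow] at this
    linarith
  set S := ∑ d ∈ Ioc 0 N, ArithmeticFunction.vonMangoldt d / d with hS
  have h2 : Real.log N.factorial ≤ N * S := by
    rw [h1, hS, mul_sum]
    refine sum_le_sum fun d _ => ?_
    rw [mul_div_left_comm]
    exact mul_le_mul_of_nonneg_left Nat.cast_div_le ArithmeticFunction.vonMangoldt_nonneg
  have h3 : N * S ≤ Real.log N.factorial + (Real.log 4 + 4) * N := by
    refine le_trans ?_ (add_le_add_right (sum_vonMangoldt_le N) _)
    rw [h1, hS, mul_sum, ← sum_add_distrib]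
    refine sum_le_sum fun d hd => ?_
    have hd' : 0 < d := by simp at hd; omega
    rw [mul_div_left_comm, ← mul_add_one]
    refine mul_le_mul_of_nonneg_left ?_ ArithmeticFunction.vonMangoldt_nonneg
    rw [div_le_iff₀ (by exact_mod_cast hd')]
    exact_mod_cast (Nat.lt_div_mul_add hd' (a := N)).le.trans (by ring_nf; rfl)
  rw [abs_le]
  constructor
  · refine le_of_mul_le_mul_left ?_ hN'
    have : 0 ≤ Real.log 4 * N := mul_nonneg (Real.log_nonneg (by norm_num)) hN'.le
    nlinarith
  · refine le_of_mul_le_mul_left ?_ hN'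
    nlinarith

/-- Partial sums against `Λ(n)/n` and against `log p / p` differ by a bounded amount. -/
theorem exists_abs_sum_primeTerm_mul_log_sub_le {χ : ℕ → ℝ} (hχ : ∀ n, |χ n| ≤ 1) :
    ∃ C, ∀ N : ℕ, |∑ n ∈ range N, primeTerm χ n * Real.log n -
      ∑ n ∈ range N, χ n * ArithmeticFunction.vonMangoldt n / n| ≤ C := by
  have hs := ArithmeticFunction.vonMangoldt.summable_residueClass_non_primes_div (1 : ZMod 1)
  have heq (n : ℕ) : ArithmeticFunction.vonMangoldt.residueClass (1 : ZMod 1) n =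
      ArithmeticFunction.vonMangoldt n :=
    Set.indicator_of_mem (s := {n : ℕ | (n : ZMod 1) = 1}) (Subsingleton.elim _ _) _
  simp only [heq] at hs
  refine ⟨∑' n : ℕ, (if n.Prime then 0 else ArithmeticFunction.vonMangoldt n) / n, fun N => ?_⟩
  rw [← sum_sub_distrib]
  refine (abs_sum_le_sum_abs _ _).trans ((sum_le_sum fun n _ => ?_).trans
    (hs.sum_le_tsum (range N) fun n _ => ?_))
  · unfold primeTerm
    split_ifs with hn
    · rw [ArithmeticFunction.vonMangoldt_apply_prime hn, div_mul_eq_mul_div, sub_self]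
      simp
    · rw [zero_mul, zero_sub, abs_neg, abs_div, abs_mul, Nat.abs_cast,
        abs_of_nonneg ArithmeticFunction.vonMangoldt_nonneg]
      gcongr
      exact mul_le_of_le_one_left ArithmeticFunction.vonMangoldt_nonneg (hχ n)
  · split_ifs
    · simp
    · exact div_nonneg ArithmeticFunction.vonMangoldt_nonneg n.cast_nonneg

theorem log_log_succ_sub_le {x : ℝ} (hx : 1 < x) :
    Real.log (Real.log (x + 1)) - Real.log (Real.log x) ≤ 1 / (x * Real.log x) := by
  have h0 : 0 < Real.log x := Real.log_pos hx
  have h1 : 0 < Real.log (x + 1) := Real.log_pos (by linarith)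
  rw [← Real.log_div h1.ne' h0.ne']
  have h2 := Real.log_le_sub_one_of_pos (show 0 < (x + 1) / x by positivity)
  rw [Real.log_div (by positivity) (by positivity)] at h2
  calc _ ≤ Real.log (x + 1) / Real.log x - 1 := Real.log_le_sub_one_of_pos (by positivity)
    _ = (Real.log (x + 1) - Real.log x) / Real.log x := by field_simp
    _ ≤ ((x + 1) / x - 1) / Real.log x := by gcongr
    _ = _ := by field_simp; ring

theorem le_log_log_succ_sub {x : ℝ} (hx : 1 < x) :
    1 / ((x + 1) * Real.log (x + 1)) ≤ Real.log (Real.log (x + 1)) - Real.log (Real.log x) := by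
  have h0 : 0 < Real.log x := Real.log_pos hx
  have h1 : 0 < Real.log (x + 1) := Real.log_pos (by linarith)
  rw [← Real.log_div h1.ne' h0.ne']
  have h2 := Real.one_sub_inv_le_log_of_pos (show 0 < (x + 1) / x by positivity)
  rw [Real.log_div (by positivity) (by positivity)] at h2
  calc _ = (1 - ((x + 1) / x)⁻¹) / Real.log (x + 1) := by field_simp; ring
    _ ≤ (Real.log (x + 1) - Real.log x) / Real.log (x + 1) := by gcongr
    _ = 1 - (Real.log (x + 1) / Real.log x)⁻¹ := by field_simp
    _ ≤ _ := Real.one_sub_inv_le_log_of_pos (by positivity)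

theorem exists_tendsto_sum_one_div_mul_log_sub :
    ∃ c, Tendsto (fun N : ℕ => ∑ n ∈ range N, 1 / (n * Real.log n) - Real.log (Real.log N))
      atTop (𝓝 c) := by
  set s : ℕ → ℝ := fun N =>
    ∑ n ∈ range (N + 2), 1 / (n * Real.log n) - Real.log (Real.log ((N + 2 : ℕ) : ℝ)) with hs
  set t : ℕ → ℝ := fun N => s N + 1 / (((N + 2 : ℕ) : ℝ) * Real.log ((N + 2 : ℕ) : ℝ)) with ht
  have hcast (N : ℕ) : ((N + 1 + 2 : ℕ) : ℝ) = ((N + 2 : ℕ) : ℝ) + 1 := by push_cast; ring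
  have hgt (N : ℕ) : (1 : ℝ) < ((N + 2 : ℕ) : ℝ) := by push_cast; linarith
  have hsucc (N : ℕ) : s (N + 1) = t N + Real.log (Real.log ((N + 2 : ℕ) : ℝ)) -
      Real.log (Real.log (((N + 2 : ℕ) : ℝ) + 1)) := by
    simp only [hs, ht, hcast]
    rw [show N + 1 + 2 = N + 2 + 1 by ring, sum_range_succ]
    ring
  have hmono : Monotone s := monotone_nat_of_le_succ fun N => by
    have := log_log_succ_sub_le (hgt N)
    rw [hsucc]
    simp only [ht]
    linarith
  have hanti : Antitone t := antitone_nat_of_succ_le fun N => by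
    have := le_log_log_succ_sub (hgt N)
    have h2 := hsucc N
    change s (N + 1) + 1 / (((N + 1 + 2 : ℕ) : ℝ) * Real.log ((N + 1 + 2 : ℕ) : ℝ)) ≤ t N
    rw [hcast]
    linarith
  have hbdd : BddAbove (Set.range s) := by
    refine ⟨t 0, ?_⟩
    rintro _ ⟨N, rfl⟩
    refine le_trans ?_ (hanti N.zero_le)
    have := Real.log_pos (hgt N)
    have h3 : 0 ≤ 1 / (((N + 2 : ℕ) : ℝ) * Real.log ((N + 2 : ℕ) : ℝ)) := by positivity
    simp only [ht]
    linarith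
  exact ⟨_, (tendsto_add_atTop_iff_nat 2).1 (tendsto_atTop_ciSup hmono hbdd)⟩

theorem sum_range_succ_one_div (N : ℕ) : ∑ n ∈ range (N + 1), (1 : ℝ) / n = harmonic N := by
  rw [sum_range_succ', harmonic]
  simp

/-- Mertens' second theorem. -/
theorem exists_tendsto_sum_primeTerm_onePos_sub :
    ∃ c, Tendsto (fun N : ℕ => ∑ n ∈ range N, primeTerm onePos n - Real.log (Real.log N))
      atTop (𝓝 c) := by
  obtain ⟨C₁, h₁⟩ := exists_abs_sum_primeTerm_mul_log_sub_le abs_onePos_le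
  obtain ⟨C₂, h₂⟩ := exists_abs_sum_vonMangoldt_div_sub_log_le
  have hbound : ∀ N ≥ 2, |∑ n ∈ range N, (primeTerm onePos n * Real.log n - 1 / n)| ≤
      C₁ + C₂ + 1 := fun N hN => by
    obtain ⟨M, rfl⟩ : ∃ M, N = M + 1 := ⟨N - 1, by omega⟩
    have hM : 1 ≤ M := by omega
    have h₃ : |(harmonic M : ℝ) - Real.log M| ≤ 1 := by
      have h4 := log_add_one_le_harmonic M
      have h5 := harmonic_le_one_add_log M
      have h6 : Real.log M ≤ Real.log (M + 1 : ℕ) :=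
        Real.log_le_log (by exact_mod_cast hM) (by push_cast; linarith)
      rw [abs_le]
      constructor <;> linarith
    have h₄ : ∑ n ∈ range (M + 1), onePos n * ArithmeticFunction.vonMangoldt n / n =
        ∑ d ∈ Ioc 0 M, ArithmeticFunction.vonMangoldt d / d := by
      rw [← sum_Ioc_zero_eq_sum_range (by simp)]
      exact sum_congr rfl fun n hn => by
        rw [onePos_of_ne_zero (by simp at hn; omega), one_mul]
    have h₅ := h₁ (M + 1)
    rw [h₄] at h₅
    have h₆ := h₂ M hM
    rw [sum_sub_distrib, sum_range_succ_one_div]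
    rw [abs_le] at *
    constructor <;> linarith [h₃.1, h₃.2, h₅.1, h₅.2, h₆.1, h₆.2]
  obtain ⟨C, hC⟩ := exists_bound_of_forall_ge 2 hbound
  obtain ⟨d, hd⟩ := exists_tendsto_sum_div_log hC
  obtain ⟨c, hc⟩ := exists_tendsto_sum_one_div_mul_log_sub
  refine ⟨d + c, (hd.add hc).congr fun N => ?_⟩
  rw [← add_sub_assoc, ← sum_add_distrib]
  congr 1
  refine sum_congr rfl fun n _ => ?_
  unfold primeTerm
  split_ifs with hn
  · have : Real.log n ≠ 0 := (Real.log_pos (by exact_mod_cast hn.one_lt)).ne'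
    field_simp
    ring
  · rw [zero_mul, zero_sub, neg_div, div_div, neg_add_cancel]

theorem tsum_ite_succ_le {u : ℝ} (hu : 0 ≤ u) :
    ∑' n : ℕ, (if ((n + 1 : ℕ) : ℝ) ≤ u then -(1 / ((n + 1 : ℕ) : ℝ)) else 0) =
      -(harmonic ⌊u⌋₊ : ℝ) := by
  have hmem (n : ℕ) : n ∈ range ⌊u⌋₊ ↔ ((n + 1 : ℕ) : ℝ) ≤ u := by
    rw [mem_range, ← Nat.succ_le_iff, Nat.le_floor_iff hu]
  rw [tsum_eq_sum (s := range ⌊u⌋₊) fun n hn => if_neg ((hmem n).not.1 hn),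
    sum_congr rfl fun n hn => if_pos ((hmem n).1 hn), sum_neg_distrib, harmonic]
  simp

theorem tendsto_log_log_floor_exp_sub_log_floor :
    Tendsto (fun u : ℝ => Real.log (Real.log ((⌊Real.exp u⌋₊ + 1 : ℕ) : ℝ)) -
      Real.log (⌊u⌋₊ : ℝ)) atTop (𝓝 0) := by
  have h1 : Tendsto (fun u : ℝ => Real.log ((⌊Real.exp u⌋₊ + 1 : ℕ) : ℝ) / u) atTop (𝓝 1) := by
    have hlim : Tendsto (fun u : ℝ => 1 + 1 / u) atTop (𝓝 1) := by
      simpa using (tendsto_inv_atTop_zero (𝕜 := ℝ)).const_add 1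
    refine tendsto_of_tendsto_of_tendsto_of_le_of_le' tendsto_const_nhds hlim ?_ ?_
    · filter_upwards [eventually_gt_atTop 0] with u hu
      rw [le_div_iff₀ hu, one_mul, Real.le_log_iff_exp_le (by positivity)]
      push_cast
      exact (Nat.lt_floor_add_one _).le
    · filter_upwards [eventually_gt_atTop 0] with u hu
      rw [div_le_iff₀ hu, add_mul, one_mul, one_div_mul_cancel hu.ne',
        Real.log_le_iff_le_exp (by positivity), Real.exp_add]
      push_cast
      have h2 := Nat.floor_le (Real.exp_pos u).le
      have h3 := Real.one_le_exp hu.le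
      have h4 : (2 : ℝ) ≤ Real.exp 1 := by linarith [Real.add_one_le_exp (1 : ℝ)]
      nlinarith
  have h2 : Tendsto (fun u : ℝ => (⌊u⌋₊ : ℝ) / u) atTop (𝓝 1) := tendsto_nat_floor_div_atTop
  have h3 := ((Real.continuousAt_log one_ne_zero).tendsto.comp h1).sub
    ((Real.continuousAt_log one_ne_zero).tendsto.comp h2)
  rw [sub_self] at h3
  refine h3.congr' ?_
  filter_upwards [eventually_ge_atTop 1] with u hu
  have h4 : 0 < Real.log ((⌊Real.exp u⌋₊ + 1 : ℕ) : ℝ) := Real.log_pos (by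
    have : 1 ≤ ⌊Real.exp u⌋₊ := Nat.le_floor (by simpa using Real.one_le_exp (by linarith))
    exact_mod_cast Nat.lt_succ_of_le this)
  have h5 : (0 : ℝ) < ⌊u⌋₊ := by exact_mod_cast Nat.floor_pos.2 hu
  simp only [Function.comp_apply]
  rw [Real.log_div h4.ne' (by positivity), Real.log_div h5.ne' (by positivity)]
  ring

theorem hasSum_neg_one_div_mul_exp {ε : ℝ} (hε : 0 < ε) :
    HasSum (fun n : ℕ => -(1 / ((n + 1 : ℕ) : ℝ)) * Real.exp (-ε * ((n + 1 : ℕ) : ℝ)))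
      (Real.log (1 - Real.exp (-ε))) := by
  have hlt : |Real.exp (-ε)| < 1 := by
    rw [Real.abs_exp, Real.exp_lt_one_iff]; linarith
  have := (Real.hasSum_pow_div_log_of_abs_lt_one hlt).neg
  rw [neg_neg] at this
  refine this.congr_fun fun n => ?_
  rw [← Real.exp_nat_mul, mul_comm _ (-ε)]
  push_cast
  ring

theorem tendsto_one_sub_exp_mul_tsum :
    Tendsto (fun ε : ℝ => (1 - Real.exp (-ε)) *
      ∑' n : ℕ, onePos n / n * Real.exp (-ε * Real.log n)) (𝓝[>] 0) (𝓝 1) := by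
  have h1 : Tendsto (fun ε : ℝ => 1 + ε) (𝓝[>] 0) (𝓝[>] 1) := by
    refine tendsto_nhdsWithin_iff.2 ⟨?_, ?_⟩
    · have : Tendsto (fun ε : ℝ => 1 + ε) (𝓝 0) (𝓝 (1 + 0)) := (continuous_const_add 1).tendsto 0
      rw [add_zero] at this
      exact this.mono_left nhdsWithin_le_nhds
    · filter_upwards [self_mem_nhdsWithin] with ε hε
      simpa using hε
  have h2 := tendsto_sub_mul_tsum_nat_rpow.comp h1
  have h3 : Tendsto (fun ε : ℝ => (1 - Real.exp (-ε)) / ε) (𝓝[>] 0) (𝓝 1) := by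
    have hd : HasDerivAt (fun ε : ℝ => -Real.exp (-ε)) 1 0 := by
      simpa using ((hasDerivAt_neg (0 : ℝ)).exp).fun_neg
    have := hd.tendsto_slope_zero_right
    refine this.congr fun ε => ?_
    simp only [zero_add, neg_zero, Real.exp_zero, smul_eq_mul]
    ring
  have h4 := h3.mul h2
  rw [one_mul] at h4
  refine h4.congr' ?_
  filter_upwards [self_mem_nhdsWithin] with ε hε
  have hε' : (0 : ℝ) < ε := hε
  simp only [Function.comp_apply]
  rw [add_sub_cancel_left, ← mul_assoc, div_mul_cancel₀ _ hε'.ne']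
  congr 2
  ext n
  rcases eq_or_ne n 0 with rfl | hn
  · simp [Real.zero_rpow (by positivity : 1 + ε ≠ 0)]
  · have hn' : (0 : ℝ) < n := by positivity
    rw [onePos_of_ne_zero hn, Real.rpow_add hn', Real.rpow_one, Real.rpow_def_of_pos hn',
      ← one_div_mul_one_div, neg_mul, Real.exp_neg, mul_comm ε, one_div (Real.exp _)]

/-- Mertens' third theorem. -/
theorem tendsto_log_mul_prod_primesBelow :
    Tendsto (fun N : ℕ => Real.log N * ∏ p ∈ N.primesBelow, (1 - 1 / (p : ℝ))) atTop
      (𝓝 (Real.exp (-Real.eulerMascheroniConstant))) := by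
  obtain ⟨c, hc⟩ := exists_tendsto_sum_primeTerm_onePos_sub
  set ℓ : ℕ ⊕ ℕ → ℝ := Sum.elim (fun n => Real.log n) (fun n => ((n + 1 : ℕ) : ℝ)) with hℓ
  set a : ℕ ⊕ ℕ → ℝ := Sum.elim (primeTerm onePos) (fun n => -(1 / ((n + 1 : ℕ) : ℝ))) with ha
  have hℓ0 (i) : 0 ≤ ℓ i := by
    rcases i with n | n
    · exact Real.log_natCast_nonneg n
    · exact Nat.cast_nonneg _
  have hsl (ε : ℝ) (hε : 0 < ε) := summable_abs_primeTerm_mul_exp abs_onePos_le hε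
  have hs (ε : ℝ) (hε : 0 < ε) : Summable fun i => |a i| * Real.exp (-ε * ℓ i) :=
    ((hsl ε hε).hasSum.sum (f := fun i => |a i| * Real.exp (-ε * ℓ i))
      ((hasSum_neg_one_div_mul_exp hε).summable.abs.congr fun n => by
        simp [ha, hℓ, abs_mul]).hasSum).summable
  have hlim : Tendsto (fun u : ℝ => ∑' i, if ℓ i ≤ u then a i else 0) atTop
      (𝓝 (c - Real.eulerMascheroniConstant)) := by
    have h1 := ((hc.comp tendsto_floor_exp_add_one).sub
      (Real.tendsto_harmonic_sub_log.comp (tendsto_nat_floor_atTop (α := ℝ)))).add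
        tendsto_log_log_floor_exp_sub_log_floor
    rw [add_zero] at h1
    refine h1.congr' ?_
    filter_upwards [eventually_ge_atTop 0] with u hu
    have hsum : Summable fun i => if ℓ i ≤ u then a i else 0 := by
      refine Summable.of_norm_bounded ((hs 1 one_pos).mul_right (Real.exp u)) fun i => ?_
      split_ifs with hi
      · rw [mul_assoc, ← Real.exp_add, Real.norm_eq_abs]
        exact le_mul_of_one_le_right (abs_nonneg _) (Real.one_le_exp (by linarith))
      · rw [norm_zero]; positivity
    have hl := tsum_ite_log_le (primeTerm onePos) hu
    have hr := tsum_ite_succ_le hu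
    rw [Summable.tsum_sum (hsum.comp_injective Sum.inl_injective)
      (hsum.comp_injective Sum.inr_injective)]
    simp only [ha, hℓ, Sum.elim_inl, Sum.elim_inr, Function.comp_apply]
    rw [hl, hr]
    ring
  have habel := tendsto_tsum_mul_exp_neg hℓ0 hs hlim
  have hsplit (ε : ℝ) (hε : 0 < ε) : ∑' i, a i * Real.exp (-ε * ℓ i) =
      ∑' n, primeTerm onePos n * Real.exp (-ε * Real.log n) + Real.log (1 - Real.exp (-ε)) := by
    rw [← (hasSum_neg_one_div_mul_exp hε).tsum_eq]
    exact Summable.tsum_sum (f := fun i => a i * Real.exp (-ε * ℓ i))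
      (hsl ε hε).of_abs_mul_exp (hasSum_neg_one_div_mul_exp hε).summable
  have hG := tendsto_tsum_eulerLogTail abs_onePos_le
  set G := ∑' n, eulerLogTail onePos 0 n with hGdef
  have hzero : Real.exp (c - Real.eulerMascheroniConstant + G) = 1 := by
    refine tendsto_nhds_unique ((Real.continuous_exp.tendsto _).comp (habel.add hG))
      (tendsto_one_sub_exp_mul_tsum.congr' ?_)
    filter_upwards [self_mem_nhdsWithin] with ε hε
    have hpos : 0 < 1 - Real.exp (-ε) := by
      have : Real.exp (-ε) < 1 := by
        rw [Real.exp_lt_one_iff]; simpa using hε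
      linarith
    simp only [Function.comp_apply]
    rw [hsplit ε hε, ← exp_tsum_primeTerm_add_tsum_eulerLogTail onePos abs_onePos_le hε,
      add_right_comm, Real.exp_add _ (Real.log _), Real.exp_log hpos, mul_comm]
  have hcG : -Real.eulerMascheroniConstant = -(c + G) := by
    have := Real.exp_eq_one_iff _ |>.1 hzero
    linarith
  rw [hcG]
  refine ((Real.continuous_exp.tendsto _).comp
    (hc.add (summable_eulerLogTail abs_onePos_le le_rfl).hasSum.tendsto_sum_nat).neg).congr' ?_
  filter_upwards [eventually_ge_atTop 2] with N hN
  have hlog : 0 < Real.log N := Real.log_pos (by exact_mod_cast hN)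
  have h := prod_primesBelow_eq_exp abs_onePos_le le_rfl N
  simp only [neg_zero, zero_mul, Real.exp_zero, mul_one] at h
  rw [prod_congr rfl fun p hp => by
    rw [onePos_of_ne_zero (Nat.prime_of_mem_primesBelow hp).ne_zero]] at h
  simp only [Function.comp_apply]
  rw [h]
  nth_rw 2 [← Real.exp_log hlog]
  rw [← Real.exp_add]
  congr 1
  ring

/-- The nontrivial character modulo `6`. -/
noncomputable def chiSix : ℕ →*₀ ℝ where
  toFun n := if n % 6 = 1 then 1 else if n % 6 = 5 then -1 else 0
  map_zero' := by norm_num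
  map_one' := by norm_num
  map_mul' a b := by
    have ha : a % 6 < 6 := Nat.mod_lt _ (by norm_num)
    have hb : b % 6 < 6 := Nat.mod_lt _ (by norm_num)
    simp only [Nat.mul_mod a b 6]
    generalize a % 6 = r at *
    generalize b % 6 = s at *
    interval_cases r <;> interval_cases s <;> norm_num

theorem chiSix_apply (n : ℕ) :
    chiSix n = if n % 6 = 1 then 1 else if n % 6 = 5 then -1 else 0 := rfl

theorem abs_chiSix_le (n : ℕ) : |chiSix n| ≤ 1 := by
  rw [chiSix_apply]
  split_ifs <;> norm_num

theorem sum_range_chiSix (N : ℕ) :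
    ∑ n ∈ range N, chiSix n = if 2 ≤ N % 6 then 1 else 0 := by
  induction N with
  | zero => simp
  | succ N ih =>
    rw [sum_range_succ, ih, chiSix_apply, Nat.add_mod]
    have hN : N % 6 < 6 := Nat.mod_lt _ (by norm_num)
    generalize N % 6 = r at *
    interval_cases r <;> norm_num

theorem abs_sum_range_chiSix_le (N : ℕ) : |∑ n ∈ range N, chiSix n| ≤ 1 := by
  rw [sum_range_chiSix]
  split_ifs <;> norm_num

/-- Abel's inequality for the tails of `∑ f n * g n`, with `f` decreasing and nonnegative and `g`
having bounded partial sums. -/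
theorem abs_sum_Ico_mul_le {f g : ℕ → ℝ} {M : ℕ} (hf : ∀ n ≥ M, f (n + 1) ≤ f n)
    (hf0 : ∀ n ≥ M, 0 ≤ f n) {B : ℝ} (hB : ∀ n, |∑ k ∈ range n, g k| ≤ B) {N : ℕ} (hN : M ≤ N) :
    |∑ n ∈ Ico M N, f n * g n| ≤ 2 * B * f M := by
  have key : |∑ n ∈ Ico M N, f n * g n - f N * ∑ k ∈ range N, g k + f M * ∑ k ∈ range M, g k| ≤
      B * (f M - f N) := by
    induction N, hN using Nat.le_induction with
    | base => simp
    | succ N hN ih =>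
      have h1 : |(f N - f (N + 1)) * ∑ k ∈ range (N + 1), g k| ≤ (f N - f (N + 1)) * B := by
        rw [abs_mul, abs_of_nonneg (by linarith [hf N hN])]
        exact mul_le_mul_of_nonneg_left (hB _) (by linarith [hf N hN])
      rw [sum_Ico_succ_top hN]
      calc _ = |(∑ n ∈ Ico M N, f n * g n - f N * ∑ k ∈ range N, g k +
              f M * ∑ k ∈ range M, g k) + (f N - f (N + 1)) * ∑ k ∈ range (N + 1), g k| := by
            rw [sum_range_succ g N]; ring_nf
        _ ≤ _ := (abs_add_le _ _).trans (by linarith)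
  have h1 : |f N * ∑ k ∈ range N, g k| ≤ f N * B := by
    rw [abs_mul, abs_of_nonneg (hf0 N hN)]
    exact mul_le_mul_of_nonneg_left (hB _) (hf0 N hN)
  have h2 : |f M * ∑ k ∈ range M, g k| ≤ f M * B := by
    rw [abs_mul, abs_of_nonneg (hf0 M le_rfl)]
    exact mul_le_mul_of_nonneg_left (hB _) (hf0 M le_rfl)
  rw [abs_le] at *
  constructor <;> linarith [key.1, key.2, h1.1, h1.2, h2.1, h2.2]

theorem abs_sum_range_chiSix_div_sub_le {M N : ℕ} (hM : 1 ≤ M) (hN : M ≤ N) :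
    |∑ n ∈ range N, chiSix n / n - ∑ n ∈ range M, chiSix n / n| ≤ 2 / M := by
  have h := abs_sum_Ico_mul_le (f := fun n : ℕ => 1 / (n : ℝ)) (g := chiSix) (M := M)
    (fun n hn => one_div_le_one_div_of_le (by exact_mod_cast hM.trans hn) (by simp))
    (fun n _ => by positivity) abs_sum_range_chiSix_le hN
  rw [← sum_Ico_eq_sub _ hN]
  refine (le_of_eq ?_).trans (h.trans_eq (by ring))
  congr 1
  exact sum_congr rfl fun n _ => by ring

theorem sum_range_chiSix_div (K : ℕ) : ∑ n ∈ range (6 * K + 2), chiSix n / n =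
    1 - ∑ k ∈ range K, (1 / (6 * k + 5 : ℝ) - 1 / (6 * k + 7)) := by
  induction K with
  | zero => simp [sum_range_succ, chiSix_apply]
  | succ K ih =>
    rw [sum_range_succ _ K, show 6 * (K + 1) + 2 = 6 * K + 2 + 1 + 1 + 1 + 1 + 1 + 1 by ring]
    have h2 : chiSix (6 * K + 2) = 0 := by rw [chiSix_apply]; simp [Nat.add_mod]
    have h3 : chiSix (6 * K + 2 + 1) = 0 := by rw [chiSix_apply]; simp [Nat.add_mod]
    have h4 : chiSix (6 * K + 2 + 1 + 1) = 0 := by rw [chiSix_apply]; simp [Nat.add_mod]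
    have h5 : chiSix (6 * K + 2 + 1 + 1 + 1) = -1 := by rw [chiSix_apply]; simp [Nat.add_mod]
    have h6 : chiSix (6 * K + 2 + 1 + 1 + 1 + 1) = 0 := by rw [chiSix_apply]; simp [Nat.add_mod]
    have h7 : chiSix (6 * K + 2 + 1 + 1 + 1 + 1 + 1) = 1 := by
      rw [chiSix_apply]; simp [Nat.add_mod]
    iterate 6 rw [sum_range_succ]
    rw [ih, h2, h3, h4, h5, h6, h7]
    push_cast
    ring

theorem hasSum_cot_pi_div_six :
    HasSum (fun k : ℕ => 1 / (6 * k + 5 : ℝ) - 1 / (6 * k + 7)) (1 - Real.pi * √3 / 6) := by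
  have hz : (1 / 6 : ℂ) ∈ Complex.integerComplement := by
    rintro ⟨n, hn⟩
    have h : ((6 * n : ℤ) : ℂ) = (1 : ℤ) := by
      push_cast
      rw [hn]
      norm_num
    have : 6 * n = 1 := by exact_mod_cast h
    omega
  have hcot : Real.cot (Real.pi / 6) = √3 := by
    rw [Real.cot_eq_cos_div_sin, Real.cos_pi_div_six, Real.sin_pi_div_six]
    ring
  have h1 := (summable_cotTerm hz).hasSum.mul_left (-1 / 6)
  rw [← cot_series_rep' hz] at h1
  rw [← Complex.hasSum_ofReal]
  convert! h1 using 1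
  · ext k
    have h5 : (6 * k + 5 : ℂ) ≠ 0 := by exact_mod_cast (by positivity : (6 * k + 5 : ℕ) ≠ 0)
    have h7 : (6 * k + 7 : ℂ) ≠ 0 := by exact_mod_cast (by positivity : (6 * k + 7 : ℕ) ≠ 0)
    rw [cotTerm, show (1 / 6 - (k + 1) : ℂ) = -(6 * k + 5) / 6 by ring,
      show (1 / 6 + (k + 1) : ℂ) = (6 * k + 7) / 6 by ring]
    push_cast
    field_simp
    ring
  · rw [show (Real.pi * (1 / 6) : ℂ) = ((Real.pi / 6 : ℝ) : ℂ) by push_cast; ring,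
      ← Complex.ofReal_cot, hcot]
    push_cast
    ring

/-- The value `L(1, χ) = π √3 / 6` of the `L`-series of the nontrivial character modulo `6`. -/
theorem tendsto_sum_range_chiSix_div :
    Tendsto (fun N => ∑ n ∈ range N, chiSix n / n) atTop (𝓝 (Real.pi * √3 / 6)) := by
  obtain ⟨L, hL⟩ : ∃ L, Tendsto (fun N => ∑ n ∈ range N, chiSix n / n) atTop (𝓝 L) := by
    have hc : CauchySeq fun N => ∑ n ∈ range (N + 1), chiSix n / n := by
      refine cauchySeq_of_le_tendsto_0' (fun N : ℕ => 2 / ((N + 1 : ℕ) : ℝ)) (fun m n hmn => ?_) ?_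
      · rw [dist_comm, Real.dist_eq]
        exact abs_sum_range_chiSix_div_sub_le (by omega) (by omega)
      · exact (tendsto_const_div_atTop_nhds_zero_nat 2).comp (tendsto_add_atTop_nat 1)
    obtain ⟨L, hL⟩ := cauchySeq_tendsto_of_complete hc
    exact ⟨L, (tendsto_add_atTop_iff_nat 1).1 hL⟩
  have h1 : Tendsto (fun K : ℕ => 6 * K + 2) atTop atTop :=
    tendsto_atTop_mono (fun K => by simp only [id]; omega) tendsto_id
  have h2 := hasSum_cot_pi_div_six.tendsto_sum_nat.const_sub 1
  have h3 := hL.comp h1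
  simp only [Function.comp_def, sum_range_chiSix_div] at h3
  rw [sub_sub_cancel] at h2
  rwa [tendsto_nhds_unique h3 h2] at hL

theorem abs_sum_range_chiSix_div_sub_limit_le {M : ℕ} (hM : 1 ≤ M) :
    |∑ n ∈ range M, chiSix n / n - Real.pi * √3 / 6| ≤ 2 / M := by
  refine le_of_tendsto (tendsto_sum_range_chiSix_div.const_sub _).abs ?_
  filter_upwards [eventually_ge_atTop M] with N hN
  rw [abs_sub_comm]
  exact abs_sum_range_chiSix_div_sub_le hM hN

theorem exists_abs_sum_range_chiSix_div_mul_log_le :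
    ∃ C, ∀ N, |∑ n ∈ range N, chiSix n / n * Real.log n| ≤ C := by
  have hmem (n : ℕ) (hn : n ≥ 3) : (n : ℝ) ∈ Set.Ici (Real.exp 1) := by
    have h3 : (3 : ℝ) ≤ n := by exact_mod_cast hn
    exact (Real.exp_one_lt_d9.le.trans (by norm_num)).trans h3
  refine exists_bound_of_forall_ge 3 (C := |∑ n ∈ range 3, chiSix n / n * Real.log n| +
    2 * 1 * (Real.log (3 : ℕ) / (3 : ℕ))) fun N hN => ?_
  have h := abs_sum_Ico_mul_le (f := fun n : ℕ => Real.log n / n) (g := chiSix) (M := 3)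
    (fun n hn => Real.log_div_self_antitoneOn (hmem n hn) (hmem (n + 1) (by omega)) (by simp))
    (fun n _ => div_nonneg (Real.log_natCast_nonneg n) n.cast_nonneg) abs_sum_range_chiSix_le hN
  rw [← sum_range_add_sum_Ico _ hN]
  refine (abs_add_le _ _).trans (add_le_add le_rfl ?_)
  refine le_trans (le_of_eq ?_) h
  congr 1
  exact sum_congr rfl fun n _ => by ring

/-- The completely multiplicative function `n ↦ χ n / n`. -/
noncomputable def chiSixDiv : ℕ →*₀ ℝ where
  toFun n := chiSix n / n
  map_zero' := by simp
  map_one' := by simp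
  map_mul' a b := by simp [mul_div_mul_comm]

theorem exists_abs_sum_range_chiSix_mul_vonMangoldt_div_le :
    ∃ C, ∀ N, |∑ n ∈ range N, chiSix n * ArithmeticFunction.vonMangoldt n / n| ≤ C := by
  set L := Real.pi * √3 / 6 with hL
  have hLpos : 0 < L := by positivity
  obtain ⟨C, hC⟩ := exists_abs_sum_range_chiSix_div_mul_log_le
  refine exists_bound_of_forall_ge 1 (C := (C + 2 * (Real.log 4 + 4)) / L) fun N hN => ?_
  obtain ⟨N, rfl⟩ : ∃ M, N = M + 1 := ⟨N - 1, by omega⟩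
  have h1 := sum_mul_log_eq_sum_mul_vonMangoldt chiSixDiv N
  have h2 : ∑ n ∈ Ioc 0 N, chiSixDiv n * Real.log n =
      ∑ n ∈ range (N + 1), chiSix n / n * Real.log n :=
    sum_Ioc_zero_eq_sum_range (by simp) N
  have h3 (d : ℕ) : ∑ m ∈ Ioc 0 d, chiSixDiv m = ∑ m ∈ range (d + 1), chiSix m / m :=
    sum_Ioc_zero_eq_sum_range (by simp) d
  have h4 : ∑ n ∈ range (N + 1), chiSix n * ArithmeticFunction.vonMangoldt n / n =
      ∑ d ∈ Ioc 0 N, chiSix d * ArithmeticFunction.vonMangoldt d / d :=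
    (sum_Ioc_zero_eq_sum_range (by simp) N).symm
  have herr : |∑ d ∈ Ioc 0 N, chiSixDiv d * ArithmeticFunction.vonMangoldt d *
      (∑ m ∈ range (N / d + 1), chiSix m / m - L)| ≤ 2 * (Real.log 4 + 4) := by
    rcases Nat.eq_zero_or_pos N with rfl | hN0
    · simp; positivity
    have hN' : (0 : ℝ) < N := by exact_mod_cast hN0
    calc _ ≤ ∑ d ∈ Ioc 0 N, ArithmeticFunction.vonMangoldt d * (2 / N) := by
          refine (abs_sum_le_sum_abs _ _).trans (sum_le_sum fun d hd => ?_)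
          have hd0 : (0 : ℝ) < d := by exact_mod_cast (mem_Ioc.1 hd).1
          have ha : |chiSixDiv d| ≤ 1 / d := by
            change |chiSix d / d| ≤ _
            rw [abs_div, abs_of_pos hd0]
            exact div_le_div_of_nonneg_right (abs_chiSix_le d) hd0.le
          have hb : |∑ m ∈ range (N / d + 1), chiSix m / m - L| ≤ 2 * d / N := by
            refine (abs_sum_range_chiSix_div_sub_limit_le (Nat.le_add_left 1 _)).trans ?_
            have : (N : ℝ) / d ≤ (N / d + 1 : ℕ) := by
              rw [div_le_iff₀ hd0]
              exact_mod_cast (Nat.lt_mul_of_div_lt (Nat.lt_succ_self _) (mem_Ioc.1 hd).1).le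
            calc (2 : ℝ) / (N / d + 1 : ℕ) ≤ 2 / (N / d) :=
                  div_le_div_of_nonneg_left (by norm_num) (by positivity) this
              _ = _ := by field_simp
          have hΛ : 0 ≤ ArithmeticFunction.vonMangoldt d :=
            ArithmeticFunction.vonMangoldt_nonneg
          rw [abs_mul, abs_mul, abs_of_nonneg hΛ]
          calc _ ≤ 1 / (d : ℝ) * ArithmeticFunction.vonMangoldt d * (2 * d / N) := by gcongr
            _ = _ := by field_simp
      _ ≤ (Real.log 4 + 4) * N * (2 / N) := by
          rw [← sum_mul]
          exact mul_le_mul_of_nonneg_right (sum_vonMangoldt_le N) (by positivity)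
      _ = _ := by field_simp
  have hid : (∑ d ∈ Ioc 0 N, chiSix d * ArithmeticFunction.vonMangoldt d / d) * L =
      ∑ n ∈ range (N + 1), chiSix n / n * Real.log n -
      ∑ d ∈ Ioc 0 N, chiSixDiv d * ArithmeticFunction.vonMangoldt d *
      (∑ m ∈ range (N / d + 1), chiSix m / m - L) := by
    rw [← h2, h1, ← sum_sub_distrib, sum_mul]
    refine sum_congr rfl fun d _ => ?_
    rw [h3, show chiSixDiv d = chiSix d / d from rfl]
    ring
  have habs (y : ℝ) : |y| * L = |y * L| := by rw [abs_mul, abs_of_pos hLpos]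
  rw [h4, le_div_iff₀ hLpos, habs, hid]
  exact (abs_sub _ _).trans (add_le_add (hC _) herr)

theorem tendsto_prod_primesBelow_one_sub_chiSix_div :
    Tendsto (fun N : ℕ => ∏ p ∈ N.primesBelow, (1 - chiSix p / p)) atTop
      (𝓝 (Real.pi * √3 / 6)⁻¹) := by
  obtain ⟨C₁, h₁⟩ := exists_abs_sum_primeTerm_mul_log_sub_le abs_chiSix_le
  obtain ⟨C₂, h₂⟩ := exists_abs_sum_range_chiSix_mul_vonMangoldt_div_le
  obtain ⟨d, hd⟩ := exists_tendsto_sum_div_log (b := fun n => primeTerm chiSix n * Real.log n)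
    (C := C₁ + C₂) fun N => by
      have h3 := abs_sub_abs_le_abs_sub (∑ n ∈ range N, primeTerm chiSix n * Real.log n)
        (∑ n ∈ range N, chiSix n * ArithmeticFunction.vonMangoldt n / n)
      linarith [h₁ N, h₂ N]
  refine tendsto_prod_primesBelow_one_sub_div chiSix abs_chiSix_le (d := d)
    (hd.congr fun N => sum_congr rfl fun n _ => ?_) tendsto_sum_range_chiSix_div
  unfold primeTerm
  split_ifs with hn
  · exact mul_div_cancel_right₀ _ (Real.log_pos (by exact_mod_cast hn.one_lt)).ne'
  · simp

theorem Nat.Prime.eq_two_or_eq_three_of_mod_six {p : ℕ} (hp : p.Prime) (h1 : p % 6 ≠ 1)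
    (h5 : p % 6 ≠ 5) : p = 2 ∨ p = 3 := by
  have h : 2 ∣ p ∨ 3 ∣ p := by omega
  exact h.imp (fun h => ((Nat.prime_dvd_prime_iff_eq Nat.prime_two hp).1 h).symm)
    fun h => ((Nat.prime_dvd_prime_iff_eq Nat.prime_three hp).1 h).symm

theorem prod_primesBelow_eq_mul_prod_mod_six (f : ℕ → ℝ) {N : ℕ} (hN : 4 ≤ N) :
    ∏ p ∈ N.primesBelow, f p = f 2 * f 3 * (∏ p ∈ N.primesBelow with p % 6 = 1, f p) *
      ∏ p ∈ N.primesBelow with p % 6 = 5, f p := by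
  have hfive : {p ∈ {p ∈ N.primesBelow | ¬ p % 6 = 1} | p % 6 = 5} =
      {p ∈ N.primesBelow | p % 6 = 5} := by
    ext p
    simp only [mem_filter, and_assoc, and_congr_right_iff]
    omega
  have hrest : {p ∈ {p ∈ N.primesBelow | ¬ p % 6 = 1} | ¬ p % 6 = 5} = {2, 3} := by
    ext p
    simp only [mem_filter, mem_insert, mem_singleton, Nat.mem_primesBelow]
    constructor
    · rintro ⟨⟨⟨-, hp⟩, h1⟩, h5⟩
      exact hp.eq_two_or_eq_three_of_mod_six h1 h5
    · rintro (rfl | rfl)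
      · exact ⟨⟨⟨by omega, Nat.prime_two⟩, by norm_num⟩, by norm_num⟩
      · exact ⟨⟨⟨by omega, Nat.prime_three⟩, by norm_num⟩, by norm_num⟩
  rw [← prod_filter_mul_prod_filter_not N.primesBelow (fun p => p % 6 = 1),
    ← prod_filter_mul_prod_filter_not {p ∈ N.primesBelow | ¬ p % 6 = 1} (fun p => p % 6 = 5),
    hfive, hrest, prod_pair (by norm_num)]
  ring

theorem tendsto_prod_primesBelow_one_sub_one_div_sq :
    Tendsto (fun N : ℕ => ∏ p ∈ N.primesBelow, (1 - 1 / (p : ℝ) ^ 2)) atTop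
      (𝓝 (Real.pi ^ 2 / 6)⁻¹) := by
  let f : ℕ →*₀ ℝ :=
    { toFun n := 1 / (n : ℝ) ^ 2
      map_zero' := by simp
      map_one' := by simp
      map_mul' a b := by push_cast; rw [mul_pow, one_div_mul_one_div] }
  have hf (n : ℕ) : f n = 1 / (n : ℝ) ^ 2 := rfl
  have h := EulerProduct.eulerProduct_completely_multiplicative (f := f) (by
    simpa only [hf] using hasSum_zeta_two.summable.norm)
  simp only [hf, hasSum_zeta_two.tsum_eq] at h
  refine (h.inv₀ (by positivity)).congr fun N => ?_
  rw [← prod_inv_distrib]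
  simp only [inv_inv]

theorem one_sub_one_div_sq_pos {p : ℕ} (hp : 1 < p) : 0 < 1 - 1 / (p : ℝ) ^ 2 := by
  have h : (1 : ℝ) < (p : ℝ) ^ 2 := by exact_mod_cast Nat.one_lt_pow two_ne_zero hp
  rw [sub_pos, div_lt_one (by positivity)]
  exact h

theorem summable_norm_neg_one_div_sq (s : Set ℕ) :
    Summable fun p : s => ‖-(1 / ((p : ℕ) : ℝ) ^ 2)‖ := by
  simp only [norm_neg]
  exact hasSum_zeta_two.summable.norm.subtype (· ∈ s)

theorem multipliable_one_sub_one_div_sq (s : Set ℕ) :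
    Multipliable fun p : s => 1 - 1 / ((p : ℕ) : ℝ) ^ 2 := by
  simpa only [← sub_eq_add_neg] using
    multipliable_one_add_of_summable (summable_norm_neg_one_div_sq s)

theorem tprod_one_sub_one_div_sq_ne_zero {s : Set ℕ} (hs : ∀ p ∈ s, 1 < p) :
    ∏' p : s, (1 - 1 / ((p : ℕ) : ℝ) ^ 2) ≠ 0 := by
  simpa only [← sub_eq_add_neg] using tprod_one_add_ne_zero_of_summable
    (fun p : s => by
      rw [← sub_eq_add_neg]
      exact (one_sub_one_div_sq_pos (hs p p.2)).ne')
    (summable_norm_neg_one_div_sq s)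

theorem tendsto_prod_filter_primesBelow_one_sub_one_div_sq (q a : ℕ) :
    Tendsto (fun N : ℕ => ∏ p ∈ N.primesBelow with p % q = a, (1 - 1 / (p : ℝ) ^ 2)) atTop
      (𝓝 (∏' p : {p : ℕ // p.Prime ∧ p % q = a}, (1 - 1 / ((p : ℕ) : ℝ) ^ 2))) := by
  have h := (hasProd_subtype_iff_mulIndicator (f := fun p : ℕ => 1 - 1 / (p : ℝ) ^ 2)).1
    (multipliable_one_sub_one_div_sq {p : ℕ | p.Prime ∧ p % q = a}).hasProd
  refine h.tendsto_prod_nat.congr fun N => ?_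
  rw [Nat.primesBelow, filter_filter, prod_filter]
  refine prod_congr rfl fun p _ => ?_
  simp only [Set.mulIndicator_apply, Set.mem_ofPred_eq]

theorem sq_prod_primesBelow_mod_six_eq {N : ℕ} (hN : 4 ≤ N) :
    (∏ p ∈ N.primesBelow with p % 6 = 5, (1 - 1 / (p : ℝ))) ^ 2 =
      9 / 2 * (∏ p ∈ N.primesBelow, (1 - 1 / (p : ℝ))) *
        (∏ p ∈ N.primesBelow, (1 - 1 / (p : ℝ) ^ 2)) *
        (∏ p ∈ N.primesBelow with p % 6 = 1, (1 - 1 / (p : ℝ) ^ 2))⁻¹ *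
        (∏ p ∈ N.primesBelow, (1 - chiSix p / p))⁻¹ := by
  have hone (p) (hp : p ∈ N.primesBelow) : (1 : ℝ) < p := by
    exact_mod_cast (Nat.prime_of_mem_primesBelow hp).one_lt
  have hP1 : ∏ p ∈ N.primesBelow with p % 6 = 1, (1 - 1 / (p : ℝ)) ≠ 0 :=
    prod_ne_zero_iff.2 fun p hp => by
      have := hone p (mem_filter.1 hp).1
      rw [sub_ne_zero, ne_comm]
      exact ((div_lt_one (by linarith)).2 this).ne
  have hQ : ∏ p ∈ N.primesBelow with p % 6 = 1, (1 - 1 / (p : ℝ) ^ 2) ≠ 0 :=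
    prod_ne_zero_iff.2 fun p hp =>
      (one_sub_one_div_sq_pos (Nat.prime_of_mem_primesBelow (mem_filter.1 hp).1).one_lt).ne'
  have hR5 : ∏ p ∈ N.primesBelow with p % 6 = 5, (1 + 1 / (p : ℝ)) ≠ 0 :=
    prod_ne_zero_iff.2 fun p _ => by positivity
  have hB : ∏ p ∈ N.primesBelow, (1 - chiSix p / p) =
      (∏ p ∈ N.primesBelow with p % 6 = 1, (1 - 1 / (p : ℝ))) *
        ∏ p ∈ N.primesBelow with p % 6 = 5, (1 + 1 / (p : ℝ)) := by
    rw [prod_primesBelow_eq_mul_prod_mod_six _ hN]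
    congr 1
    · rw [chiSix_apply, chiSix_apply]
      norm_num
      refine prod_congr rfl fun p hp => ?_
      rw [chiSix_apply, if_pos (mem_filter.1 hp).2, one_div]
    · refine prod_congr rfl fun p hp => ?_
      have h5 := (mem_filter.1 hp).2
      rw [chiSix_apply, h5]
      norm_num
      ring
  have hD5 : ∏ p ∈ N.primesBelow with p % 6 = 5, (1 - 1 / (p : ℝ) ^ 2) =
      (∏ p ∈ N.primesBelow with p % 6 = 5, (1 - 1 / (p : ℝ))) *
        ∏ p ∈ N.primesBelow with p % 6 = 5, (1 + 1 / (p : ℝ)) := by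
    rw [← prod_mul_distrib]
    exact prod_congr rfl fun p _ => by ring
  rw [hB, prod_primesBelow_eq_mul_prod_mod_six (fun p => 1 - 1 / (p : ℝ)) hN,
    prod_primesBelow_eq_mul_prod_mod_six (fun p => 1 - 1 / (p : ℝ) ^ 2) hN, hD5]
  field_simp
  norm_num
  ring

theorem tendsto_log_div_log_floor_add_one :
    Tendsto (fun x : ℝ => Real.log x / Real.log ((⌊x⌋₊ + 1 : ℕ) : ℝ)) atTop (𝓝 1) := by
  have hlim : Tendsto (fun x : ℝ => 1 - Real.log 2 / Real.log x) atTop (𝓝 1) := by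
    simpa using (Real.tendsto_log_atTop.const_div_atTop (Real.log 2)).const_sub 1
  have h1 (x : ℝ) (hx : 2 ≤ x) : 0 < Real.log x ∧
      Real.log x ≤ Real.log ((⌊x⌋₊ + 1 : ℕ) : ℝ) ∧
      Real.log ((⌊x⌋₊ + 1 : ℕ) : ℝ) ≤ Real.log 2 + Real.log x := by
    refine ⟨Real.log_pos (by linarith), Real.log_le_log (by linarith) ?_, ?_⟩
    · push_cast
      exact (Nat.lt_floor_add_one x).le
    · rw [← Real.log_mul (by norm_num) (by linarith)]
      refine Real.log_le_log (by positivity) ?_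
      push_cast
      linarith [Nat.floor_le (by linarith : 0 ≤ x)]
  refine tendsto_of_tendsto_of_tendsto_of_le_of_le' hlim tendsto_const_nhds ?_ ?_
  · filter_upwards [eventually_ge_atTop 2] with x hx
    obtain ⟨h2, h3, h4⟩ := h1 x hx
    rw [le_div_iff₀ (by linarith)]
    have h5 : Real.log 2 ≤ Real.log x := Real.log_le_log (by norm_num) hx
    have h6 : Real.log 2 / Real.log x * Real.log x = Real.log 2 := by field_simp
    have h7 : 0 ≤ Real.log 2 / Real.log x := div_nonneg (Real.log_nonneg (by norm_num)) h2.le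
    nlinarith
  · filter_upwards [eventually_ge_atTop 2] with x hx
    obtain ⟨h2, h3, h4⟩ := h1 x hx
    rw [div_le_one (by linarith)]
    exact h3

/-- **The companion formula for `C(6,5)`:**
`log x · (∏_{p ≤ x, p ≡ 5 (6)} (1 - 1/p))² → (9√3/(2π)) e^{-γ} (∏_{p ≡ 1 (6)} (1 - 1/p²))⁻¹`,
the product over all primes `p ≡ 1 (mod 6)` being absolutely convergent. -/
theorem grosswald_C65 :
    Multipliable (fun p : {p : ℕ // p.Prime ∧ p % 6 = 1} =>
      1 - 1 / ((p : ℕ) : ℝ) ^ 2) ∧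
    Tendsto (fun x : ℝ => Real.log x *
        (∏ p ∈ (Nat.floor x + 1).primesBelow.filter (fun p => p % 6 = 5),
          (1 - 1 / (p : ℝ))) ^ 2)
      atTop (𝓝 (9 * Real.sqrt 3 / (2 * Real.pi) * Real.exp (-Real.eulerMascheroniConstant) *
        (∏' p : {p : ℕ // p.Prime ∧ p % 6 = 1}, (1 - 1 / ((p : ℕ) : ℝ) ^ 2))⁻¹)) := by
  refine ⟨multipliable_one_sub_one_div_sq {p : ℕ | p.Prime ∧ p % 6 = 1}, ?_⟩
  have hQ := tprod_one_sub_one_div_sq_ne_zero (s := {p : ℕ | p.Prime ∧ p % 6 = 1})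
    fun p hp => hp.1.one_lt
  have hN : Tendsto (fun x : ℝ => ⌊x⌋₊ + 1) atTop atTop :=
    (tendsto_add_atTop_nat 1).comp tendsto_nat_floor_atTop
  have h := ((((tendsto_log_mul_prod_primesBelow.const_mul (9 / 2)).mul
    tendsto_prod_primesBelow_one_sub_one_div_sq).mul
    ((tendsto_prod_filter_primesBelow_one_sub_one_div_sq 6 1).inv₀ hQ)).mul
    (tendsto_prod_primesBelow_one_sub_chiSix_div.inv₀ (by positivity))).comp hN
  have hlim := tendsto_log_div_log_floor_add_one.mul h
  convert! hlim.congr' ?_ using 2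
  · rw [inv_inv, one_mul]
    field_simp
  · filter_upwards [eventually_ge_atTop 3] with x hx
    have h3 : 3 ≤ ⌊x⌋₊ := Nat.le_floor (by exact_mod_cast hx)
    have hlog : Real.log ((⌊x⌋₊ + 1 : ℕ) : ℝ) ≠ 0 :=
      (Real.log_pos (by exact_mod_cast (by omega : 1 < ⌊x⌋₊ + 1))).ne'
    rw [sq_prod_primesBelow_mod_six_eq (by omega : 4 ≤ ⌊x⌋₊ + 1)]
    simp only [Function.comp_apply]
    field_simp
end
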